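/- arXiv:1908.09325 — 2 statements merged into one kernel-verified Lean document; each statement's English description precedes it below -/
import Mathlib

section
/- For every ε > 0 there exists an integer k_ε such that for every even simple graph H with k > k_ε edges and every homomorphic image Ĥ of H, the pathwidth of Ĥ is at most (23/135)·k + ε·k. -/
/-- The pathwidth of a simple graph: the least `w` such that there is a path decomposition
(a sequence of bags in which every vertex appears in a nonempty set of consecutive bags and
every edge has both endpoints in a common bag) all of whose bags have at most `w + 1`
vertices. -/
noncomputable def SimpleGraph.pw {W : Type} (G : SimpleGraph W) : ℕ :=
  sInf {w : ℕ | ∃ (r : ℕ) (X : Fin (r + 1) → Finset W),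
    (∀ v : W, ∃ t, v ∈ X t) ∧
    (∀ (v : W) (a b c : Fin (r + 1)), a ≤ b → b ≤ c → v ∈ X a → v ∈ X c → v ∈ X b) ∧
    (∀ u v : W, G.Adj u v → ∃ t, u ∈ X t ∧ v ∈ X t) ∧
    (∀ t, (X t).card ≤ w + 1)}

noncomputable section

open Classical Relation

namespace HomPathwidth

section

variable {W : Type*}

/-! ### Sweeps -/

theorem rtg_mono {α : Type*} {r p : α → α → Prop} (h : ∀ a b, r a b → p a b) {a b : α}
    (hab : ReflTransGen r a b) : ReflTransGen p a b :=
  ReflTransGen.mono h _ _ hab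

theorem rtg_lift {α β : Type*} {r : α → α → Prop} {p : β → β → Prop} (f : α → β)
    (h : ∀ a b, r a b → ReflTransGen p (f a) (f b)) {a b : α} (hab : ReflTransGen r a b) :
    ReflTransGen p (f a) (f b) :=
  ReflTransGen.lift' f h _ _ hab

/-- One step of a sweep of `K`: add a vertex, the cost staying at most `x`. -/
def Step (c : Finset W → ℝ) (K : Finset W) (x : ℝ) (A B : Finset W) : Prop :=
  ∃ v ∈ K, v ∉ A ∧ B = insert v A ∧ A ⊆ K ∧ c A ≤ x ∧ c B ≤ x

/-- Vertices of `A` with a neighbour in `K \ A`. -/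
def bdry (G : SimpleGraph W) (K A : Finset W) : Finset W :=
  A.filter fun v => ∃ u ∈ K \ A, G.Adj v u

/-- `K` can be swept with vertex separation at most `x`. -/
def Sweepable (G : SimpleGraph W) (K : Finset W) (x : ℝ) : Prop :=
  ReflTransGen (Step (fun A => ((bdry G K A).card : ℝ)) K x) ∅ K

theorem sweep_fill {c : Finset W → ℝ} {K : Finset W} {x : ℝ} {A B : Finset W}
    (hAB : A ⊆ B) (hBK : B ⊆ K) (h : ∀ C, A ⊆ C → C ⊆ B → c C ≤ x) :
    ReflTransGen (Step c K x) A B := by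
  induction hn : (B \ A).card generalizing A with
  | zero =>
    have : A = B := by
      apply hAB.antisymm
      rwa [Finset.card_eq_zero, Finset.sdiff_eq_empty_iff_subset] at hn
    rw [this]
  | succ n ih =>
    have hne : (B \ A).Nonempty := by
      rw [← Finset.card_pos]; omega
    obtain ⟨v, hv⟩ := hne
    rw [Finset.mem_sdiff] at hv
    have hsub : insert v A ⊆ B := Finset.insert_subset hv.1 hAB
    refine ReflTransGen.head (b := insert v A)
      ⟨v, hBK hv.1, hv.2, rfl, hAB.trans hBK, h _ subset_rfl hAB,
        h _ (Finset.subset_insert _ _) hsub⟩ ?_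
    refine ih hsub (fun C hC hCB => h C ((Finset.subset_insert _ _).trans hC) hCB) ?_
    have : B \ insert v A = (B \ A).erase v := by
      ext y; simp only [Finset.mem_sdiff, Finset.mem_insert, Finset.mem_erase]; tauto
    rw [this, Finset.card_erase_of_mem (by simp [hv.1, hv.2])]
    omega

theorem bdry_subset (G : SimpleGraph W) (K A : Finset W) : bdry G K A ⊆ A :=
  Finset.filter_subset _ _

theorem mem_bdry {G : SimpleGraph W} {K A : Finset W} {v : W} :
    v ∈ bdry G K A ↔ v ∈ A ∧ ∃ u, u ∈ K ∧ u ∉ A ∧ G.Adj v u := by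
  simp [bdry, and_assoc]

theorem Sweepable.mono {G : SimpleGraph W} {K : Finset W} {x y : ℝ} (h : Sweepable G K x)
    (hxy : x ≤ y) : Sweepable G K y := by
  refine rtg_mono ?_ h
  rintro A B ⟨v, h1, h2, h3, h4, h5, h6⟩
  exact ⟨v, h1, h2, h3, h4, h5.trans hxy, h6.trans hxy⟩

theorem sweepable_of_card_le {G : SimpleGraph W} {K : Finset W} {x : ℝ} (h : (K.card : ℝ) ≤ x) :
    Sweepable G K x := by
  refine sweep_fill (Finset.empty_subset _) subset_rfl fun C _ hC => le_trans ?_ h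
  exact_mod_cast Finset.card_le_card ((bdry_subset G K C).trans hC)

theorem sweepable_of_erase {G : SimpleGraph W} {K : Finset W} {x : ℝ} {u : W} (hu : u ∈ K)
    (hx : 0 ≤ x) (h : Sweepable G (K.erase u) x) : Sweepable G K (x + 1) := by
  have key : ∀ A, ((bdry G K (insert u A)).card : ℝ) ≤ (bdry G (K.erase u) A).card + 1 := by
    intro A
    have : bdry G K (insert u A) ⊆ insert u (bdry G (K.erase u) A) := by
      intro v hv
      rw [mem_bdry] at hv
      obtain ⟨h1, w, h2, h3, h4⟩ := hv
      rw [Finset.mem_insert] at h1 ⊢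
      rcases h1 with h1 | h1
      · exact Or.inl h1
      · right
        rw [mem_bdry]
        rw [Finset.mem_insert, not_or] at h3
        exact ⟨h1, w, Finset.mem_erase.2 ⟨h3.1, h2⟩, h3.2, h4⟩
    exact_mod_cast (Finset.card_le_card this).trans (Finset.card_insert_le _ _)
  have h0 : ReflTransGen (Step (fun A => ((bdry G K A).card : ℝ)) K (x + 1)) ∅ (insert u ∅) := by
    refine sweep_fill (Finset.empty_subset _) (by simpa using hu) fun C _ hC => ?_
    have h1 : (bdry G K C).card ≤ 1 := by
      refine (Finset.card_le_card ((bdry_subset G K C).trans hC)).trans (by simp)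
    have : ((bdry G K C).card : ℝ) ≤ 1 := by exact_mod_cast h1
    linarith
  have h1 : ReflTransGen (Step (fun A => ((bdry G K A).card : ℝ)) K (x + 1))
      (insert u ∅) (insert u (K.erase u)) := by
    refine rtg_lift (insert u) ?_ h
    rintro A B ⟨v, h1, h2, rfl, h4, h5, h6⟩
    rw [Finset.mem_erase] at h1
    refine ReflTransGen.single ⟨v, h1.2, ?_, Finset.insert_comm _ _ _, ?_, ?_, ?_⟩
    · simp [h1.1, h2]
    · exact Finset.insert_subset hu (h4.trans (Finset.erase_subset _ _))
    · exact (key A).trans (by linarith)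
    · exact (key _).trans (by linarith)
  rw [Finset.insert_erase hu] at h1
  exact h0.trans h1

theorem sweepable_union {G : SimpleGraph W} {K₁ K₂ : Finset W} {x : ℝ}
    (hd : Disjoint K₁ K₂) (hadj : ∀ a ∈ K₁, ∀ b ∈ K₂, ¬ G.Adj a b)
    (h₁ : Sweepable G K₁ x) (h₂ : Sweepable G K₂ x) : Sweepable G (K₁ ∪ K₂) x := by
  have key1 : ∀ A, A ⊆ K₁ → bdry G (K₁ ∪ K₂) A ⊆ bdry G K₁ A := by
    intro A hA v hv
    rw [mem_bdry] at hv ⊢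
    obtain ⟨h1, w, h2, h3, h4⟩ := hv
    refine ⟨h1, w, ?_, h3, h4⟩
    rcases Finset.mem_union.1 h2 with h | h
    · exact h
    · exact absurd h4 (hadj _ (hA h1) _ h)
  have key2 : ∀ A, A ⊆ K₂ → bdry G (K₁ ∪ K₂) (K₁ ∪ A) ⊆ bdry G K₂ A := by
    intro A hA v hv
    rw [mem_bdry] at hv ⊢
    obtain ⟨h1, w, h2, h3, h4⟩ := hv
    rw [Finset.mem_union, not_or] at h3
    have hw : w ∈ K₂ := by
      rcases Finset.mem_union.1 h2 with h | h
      · exact absurd h h3.1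
      · exact h
    rcases Finset.mem_union.1 h1 with h | h
    · exact absurd h4 (hadj _ h _ hw)
    · exact ⟨h, w, hw, h3.2, h4⟩
  have s1 : ReflTransGen (Step (fun A => ((bdry G (K₁ ∪ K₂) A).card : ℝ)) (K₁ ∪ K₂) x) ∅ K₁ := by
    refine rtg_mono ?_ h₁
    rintro A B ⟨v, h1, h2, rfl, h4, h5, h6⟩
    refine ⟨v, Finset.mem_union_left _ h1, h2, rfl, h4.trans Finset.subset_union_left, ?_, ?_⟩
    · exact le_trans (Nat.cast_le.2 (Finset.card_le_card (key1 A h4))) h5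
    · exact le_trans (Nat.cast_le.2 (Finset.card_le_card (key1 _ (Finset.insert_subset h1 h4)))) h6
  have s2 : ReflTransGen (Step (fun A => ((bdry G (K₁ ∪ K₂) A).card : ℝ)) (K₁ ∪ K₂) x)
      (K₁ ∪ ∅) (K₁ ∪ K₂) := by
    refine rtg_lift (fun A => K₁ ∪ A) ?_ h₂
    rintro A B ⟨v, h1, h2, rfl, h4, h5, h6⟩
    refine ReflTransGen.single ⟨v, Finset.mem_union_right _ h1, ?_, by simp, 
      Finset.union_subset_union_right h4, ?_, ?_⟩
    · rw [Finset.mem_union, not_or]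
      exact ⟨fun h => Finset.disjoint_left.1 hd h h1, h2⟩
    · exact le_trans (Nat.cast_le.2 (Finset.card_le_card (key2 A h4))) h5
    · exact le_trans (Nat.cast_le.2 (Finset.card_le_card (key2 _ (Finset.insert_subset h1 h4)))) h6
  rw [Finset.union_empty] at s2
  exact s1.trans s2

/-! ### Retractions onto a subset: hanging pieces -/

/-- `p` retracts `U` onto `K` such that every edge of `U` lies in a fibre of `p` or in `K`. -/
structure Hanging (G : SimpleGraph W) (U K : Finset W) (p : W → W) : Prop where
  sub : K ⊆ U
  mem : ∀ x ∈ U, p x ∈ K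
  fix : ∀ v ∈ K, p v = v
  adj : ∀ x ∈ U, ∀ y ∈ U, G.Adj x y → p x = p y ∨ (x ∈ K ∧ y ∈ K)

/-- The part of `U` retracted into `M`. -/
def pre (U : Finset W) (p : W → W) (M : Finset W) : Finset W := U.filter fun x => p x ∈ M

theorem mem_pre {U M : Finset W} {p : W → W} {x : W} : x ∈ pre U p M ↔ x ∈ U ∧ p x ∈ M := by
  simp [pre]

theorem Hanging.restrict {G : SimpleGraph W} {U K M : Finset W} {p : W → W}
    (h : Hanging G U K p) (hM : M ⊆ K) : Hanging G (pre U p M) M p where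
  sub v hv := mem_pre.2 ⟨h.sub (hM hv), by rwa [h.fix v (hM hv)]⟩
  mem x hx := (mem_pre.1 hx).2
  fix v hv := h.fix v (hM hv)
  adj x hx y hy hxy := by
    rw [mem_pre] at hx hy
    rcases h.adj x hx.1 y hy.1 hxy with h1 | h1
    · exact Or.inl h1
    · right
      rw [← h.fix x h1.1, ← h.fix y h1.2]
      exact ⟨hx.2, hy.2⟩

theorem Hanging.sweepable {G : SimpleGraph W} {U K : Finset W} {p : W → W} {x : ℝ} {L : ℕ}
    (h : Hanging G U K p) (hL : ∀ v ∈ K, (pre U p {v}).card ≤ L) (hK : Sweepable G K x) :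
    Sweepable G U (x + L) := by
  have hpre : pre U p K = U := by
    ext y; rw [mem_pre]; exact ⟨fun hy => hy.1, fun hy => ⟨hy, h.mem y hy⟩⟩
  have hempty : pre U p ∅ = ∅ := by simp [pre]
  have key : ReflTransGen (Step (fun A => ((bdry G U A).card : ℝ)) U (x + L))
      (pre U p ∅) (pre U p K) := by
    refine rtg_lift (pre U p) ?_ hK
    rintro A B ⟨v, h1, h2, rfl, h4, h5, h6⟩
    refine sweep_fill ?_ (Finset.filter_subset _ _) ?_
    · intro y hy
      rw [mem_pre] at hy ⊢
      exact ⟨hy.1, Finset.mem_insert_of_mem hy.2⟩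
    · intro C hAC hCB
      have hsub : bdry G U C ⊆ bdry G K A ∪ pre U p {v} := by
        intro y hy
        rw [mem_bdry] at hy
        obtain ⟨hyC, w, hwU, hwC, hyw⟩ := hy
        have hyB := mem_pre.1 (hCB hyC)
        rw [Finset.mem_union]
        rcases Finset.mem_insert.1 hyB.2 with hy' | hy'
        · right
          exact mem_pre.2 ⟨hyB.1, by simp [hy']⟩
        · left
          rcases h.adj y hyB.1 w hwU hyw with he | ⟨hyK, hwK⟩
          · exact absurd (hAC (mem_pre.2 ⟨hwU, he ▸ hy'⟩)) hwC
          · rw [mem_bdry]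
            rw [h.fix y hyK] at hy'
            refine ⟨hy', w, hwK, fun hwA => hwC (hAC (mem_pre.2 ⟨hwU, ?_⟩)), hyw⟩
            rwa [h.fix w hwK]
      have hc : (bdry G U C).card ≤ (bdry G K A).card + L :=
        ((Finset.card_le_card hsub).trans (Finset.card_union_le _ _)).trans
          (Nat.add_le_add_left (hL v h1) _)
      have hc' : ((bdry G U C).card : ℝ) ≤ (bdry G K A).card + L := by exact_mod_cast hc
      exact hc'.trans (by linarith)
  rwa [hempty, hpre] at key

/-! ### Degrees and cuts -/

/-- The number of neighbours of `v` in `K`. -/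
def dg (G : SimpleGraph W) (K : Finset W) (v : W) : ℕ := (K.filter (G.Adj v)).card

/-- The number of ordered adjacent pairs from `A` to `B`. -/
def ed (G : SimpleGraph W) (A B : Finset W) : ℕ := ∑ v ∈ A, dg G B v

/-- The number of edges between `A` and `K \ A`. -/
def cut (G : SimpleGraph W) (K A : Finset W) : ℕ := ed G A (K \ A)

/-- The number of vertices of `A` having degree three in `K`. -/
def n3 (G : SimpleGraph W) (K A : Finset W) : ℕ := (A.filter fun v => dg G K v = 3).card

theorem dg_eq_sum (G : SimpleGraph W) (K : Finset W) (v : W) :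
    dg G K v = ∑ y ∈ K, if G.Adj v y then 1 else 0 := by
  rw [dg, Finset.card_filter]

theorem dg_mono (G : SimpleGraph W) {A K : Finset W} (h : A ⊆ K) (v : W) : dg G A v ≤ dg G K v :=
  Finset.card_le_card (Finset.filter_subset_filter _ h)

theorem dg_union (G : SimpleGraph W) {A B : Finset W} (h : Disjoint A B) (v : W) :
    dg G (A ∪ B) v = dg G A v + dg G B v := by
  simp only [dg_eq_sum, Finset.sum_union h]

theorem dg_add_sdiff (G : SimpleGraph W) {A K : Finset W} (h : A ⊆ K) (v : W) :
    dg G A v + dg G (K \ A) v = dg G K v := by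
  rw [← dg_union G Finset.disjoint_sdiff, Finset.union_sdiff_of_subset h]

theorem dg_erase_self (G : SimpleGraph W) (K : Finset W) (v : W) :
    dg G (K.erase v) v = dg G K v := by
  unfold dg
  congr 1
  ext y
  simp only [Finset.mem_filter, Finset.mem_erase]
  constructor
  · rintro ⟨⟨_, h2⟩, h3⟩; exact ⟨h2, h3⟩
  · rintro ⟨h2, h3⟩; exact ⟨⟨h3.ne', h2⟩, h3⟩

theorem ed_comm (G : SimpleGraph W) (A B : Finset W) : ed G A B = ed G B A := by
  simp only [ed, dg_eq_sum]
  rw [Finset.sum_comm]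
  simp only [G.adj_comm]

theorem ed_union_left (G : SimpleGraph W) {A B : Finset W} (h : Disjoint A B) (D : Finset W) :
    ed G (A ∪ B) D = ed G A D + ed G B D :=
  Finset.sum_union h

theorem ed_union_right (G : SimpleGraph W) {A B : Finset W} (h : Disjoint A B) (D : Finset W) :
    ed G D (A ∪ B) = ed G D A + ed G D B := by
  rw [ed_comm, ed_union_left G h, ed_comm G A, ed_comm G B]

theorem bdry_card_le_cut (G : SimpleGraph W) (K A : Finset W) :
    (bdry G K A).card ≤ cut G K A := by
  rw [cut, ed, bdry, Finset.card_filter]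
  refine Finset.sum_le_sum fun v _ => ?_
  split_ifs with h
  · obtain ⟨u, hu, hvu⟩ := h
    exact Finset.card_pos.2 ⟨u, Finset.mem_filter.2 ⟨hu, hvu⟩⟩
  · exact Nat.zero_le _

theorem cut_sdiff (G : SimpleGraph W) {K A S : Finset W} (hA : A ⊆ K) (hS : S ⊆ A) :
    cut G K (A \ S) + ed G S (K \ A) = cut G K A + ed G S (A \ S) := by
  have h1 : K \ (A \ S) = (K \ A) ∪ S := by
    ext x
    have h1 := @hA x
    have h2 := @hS x
    simp only [Finset.mem_sdiff, Finset.mem_union]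
    tauto
  have h2 : Disjoint (K \ A) S := Finset.disjoint_left.2 fun x hx hS' =>
    (Finset.mem_sdiff.1 hx).2 (hS hS')
  have h3 : A = (A \ S) ∪ S := (Finset.sdiff_union_of_subset hS).symm
  have h4 : cut G K A = ed G (A \ S) (K \ A) + ed G S (K \ A) := by
    rw [cut, ← ed_union_left G Finset.sdiff_disjoint, ← h3]
  rw [h4, cut, h1, ed_union_right G h2, ed_comm G (A \ S) S]
  ring

theorem cut_erase (G : SimpleGraph W) {K A : Finset W} {v : W} (hA : A ⊆ K) (hv : v ∈ A) :
    cut G K (A.erase v) + dg G (K \ A) v = cut G K A + dg G A v := by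
  have h := cut_sdiff G hA (Finset.singleton_subset_iff.2 hv)
  rw [Finset.sdiff_singleton_eq_erase] at h
  simpa [ed, dg_erase_self] using h

theorem cut_compl (G : SimpleGraph W) {K A : Finset W} (hA : A ⊆ K) :
    cut G K (K \ A) = cut G K A := by
  rw [cut, cut, Finset.sdiff_sdiff_eq_self hA, ed_comm]

/-! ### Weighted certificates for sets whose removal lowers a cut -/

/-- A multiplicity function `m` on `A` together with symmetric edge weights `k` below it. -/
structure Certificate (G : SimpleGraph W) (A : Finset W) (m : W → ℕ) (k : W → W → ℕ) : Prop where
  supp : ∀ x, x ∉ A → m x = 0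
  symm : ∀ x y, k x y = k y x
  le : ∀ x y, k x y ≤ m x
  adj : ∀ x y, k x y ≠ 0 → G.Adj x y

/-- The value of a certificate with respect to external degrees `b`. -/
def certValue (G : SimpleGraph W) (A : Finset W) (b : W → ℤ) (m : W → ℕ) (k : W → W → ℕ) : ℤ :=
  ∑ w ∈ A, (m w : ℤ) * (b w - dg G A w) + ∑ w ∈ A, ∑ y ∈ A, (k w y : ℤ)

theorem certificate_combine {G : SimpleGraph W} {A : Finset W} {b : W → ℤ} {s : ℕ} {v : W}
    (hv : v ∈ A) {Z : Finset W} (hZ : ∀ z ∈ Z, z ∈ A ∧ G.Adj v z) {t : W → ℤ}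
    (hcert : ∀ z ∈ Z, ∃ m k, Certificate G A m k ∧ k z v + 1 ≤ m z ∧ ∑ w ∈ A, m w ≤ s ∧
      t z ≤ certValue G A b m k) :
    ∃ m k, Certificate G A m k ∧ (∀ u, u ∉ Z → k v u + 1 ≤ m v) ∧
      ∑ w ∈ A, m w ≤ 1 + Z.card * s ∧
      b v - dg G A v + ∑ z ∈ Z, (t z + 2) ≤ certValue G A b m k := by
  choose! mz kz hc hroot hsum hval using hcert
  have hk : ∀ x y, (∑ z ∈ Z, (kz z x y + (if x = v ∧ y = z then 1 else 0) +
      (if x = z ∧ y = v then 1 else 0)) : ℕ) ≤ (if x = v then 1 else 0) + ∑ z ∈ Z, mz z x := by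
    intro x y
    have h1 : ∀ z ∈ Z, kz z x y + (if x = v ∧ y = z then 1 else 0) +
        (if x = z ∧ y = v then 1 else 0) ≤ mz z x + (if x = v ∧ y = z then 1 else 0) := by
      intro z hz
      by_cases h : x = z ∧ y = v
      · have := hroot z hz
        rw [if_pos h, h.1, h.2]
        omega
      · have := (hc z hz).le x y
        rw [if_neg h]
        omega
    refine (Finset.sum_le_sum h1).trans ?_
    rw [Finset.sum_add_distrib, add_comm]
    refine Nat.add_le_add_right ?_ _
    by_cases hx : x = v
    · simp only [hx, true_and, if_true, Finset.sum_ite_eq]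
      split_ifs <;> omega
    · simp [hx]
  refine ⟨fun x => (if x = v then 1 else 0) + ∑ z ∈ Z, mz z x,
    fun x y => ∑ z ∈ Z, (kz z x y + (if x = v ∧ y = z then 1 else 0) +
      (if x = z ∧ y = v then 1 else 0)), ⟨?_, ?_, hk, ?_⟩, ?_, ?_, ?_⟩
  · intro x hx
    have : x ≠ v := fun h => hx (h ▸ hv)
    simp only [this, if_false, zero_add]
    exact Finset.sum_eq_zero fun z hz => (hc z hz).supp x hx
  · intro x y
    refine Finset.sum_congr rfl fun z hz => ?_
    rw [(hc z hz).symm x y]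
    simp only [and_comm, add_assoc]
    rw [add_comm (if x = v ∧ y = z then 1 else 0)]
  · intro x y hne
    obtain ⟨z, hz, hne⟩ := Finset.exists_ne_zero_of_sum_ne_zero hne
    by_cases h1 : kz z x y = 0
    · by_cases h2 : x = v ∧ y = z
      · rw [h2.1, h2.2]; exact (hZ z hz).2
      · by_cases h3 : x = z ∧ y = v
        · rw [h3.1, h3.2]; exact (hZ z hz).2.symm
        · simp [h1, h2, h3] at hne
    · exact (hc z hz).adj x y h1
  · intro u hu
    have : ∀ z ∈ Z, kz z v u + (if v = v ∧ u = z then 1 else 0) +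
        (if v = z ∧ u = v then 1 else 0) ≤ mz z v := by
      intro z hz
      have h1 : ¬ (v = v ∧ u = z) := fun h => hu (h.2 ▸ hz)
      have h2 : ¬ (v = z ∧ u = v) := fun h => (hZ z hz).2.ne h.1
      rw [if_neg h1, if_neg h2]
      exact (hc z hz).le v u
    have := Finset.sum_le_sum this
    simp only [if_true] at this ⊢
    omega
  · rw [Finset.sum_add_distrib, Finset.sum_comm, Finset.sum_ite_eq' A v, if_pos hv]
    refine Nat.add_le_add_left ?_ _
    rw [← smul_eq_mul]
    exact Finset.sum_le_card_nsmul _ _ _ hsum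
  · have e1 : ∑ w ∈ A, (((if w = v then 1 else 0) + ∑ z ∈ Z, mz z w : ℕ) : ℤ) *
        (b w - dg G A w) = (b v - dg G A v) +
          ∑ z ∈ Z, ∑ w ∈ A, (mz z w : ℤ) * (b w - dg G A w) := by
      rw [Finset.sum_comm (s := Z)]
      push_cast
      simp only [add_mul, Finset.sum_add_distrib, Finset.sum_mul, ite_mul, one_mul, zero_mul]
      rw [Finset.sum_ite_eq' A v, if_pos hv]
    have e2 : ∑ w ∈ A, ∑ y ∈ A, ((∑ z ∈ Z, (kz z w y + (if w = v ∧ y = z then 1 else 0) +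
        (if w = z ∧ y = v then 1 else 0)) : ℕ) : ℤ) =
        ∑ z ∈ Z, (∑ w ∈ A, ∑ y ∈ A, (kz z w y : ℤ) + 2) := by
      have h1 : ∀ z ∈ Z, (∑ w ∈ A, ∑ y ∈ A, (kz z w y : ℤ) + 2) =
          ∑ w ∈ A, ∑ y ∈ A, ((kz z w y : ℤ) + (if w = v ∧ y = z then 1 else 0) +
            (if w = z ∧ y = v then 1 else 0)) := by
        intro z hz
        have hzA := (hZ z hz).1
        simp only [Finset.sum_add_distrib, ite_and]
        simp [hv, hzA]
        ring
      rw [Finset.sum_congr rfl h1, Finset.sum_comm (s := Z)]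
      refine Finset.sum_congr rfl fun w _ => ?_
      rw [Finset.sum_comm (s := Z)]
      push_cast
      rfl
    rw [certValue, e1, e2, add_assoc, ← Finset.sum_add_distrib]
    refine add_le_add le_rfl (Finset.sum_le_sum fun z hz => ?_)
    have := hval z hz
    rw [certValue] at this
    linarith

theorem sum_level (M n : ℕ) (h : n ≤ M) : (∑ i ∈ Finset.range M, if i < n then 1 else 0) = n := by
  rw [← Finset.card_filter]
  have : (Finset.range M).filter (· < n) = Finset.range n := by
    ext i; simp only [Finset.mem_filter, Finset.mem_range]; omega
  rw [this, Finset.card_range]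

theorem sum_level_sub (M n l : ℕ) (h : n ≤ M) :
    (∑ i ∈ Finset.range M, if i < n ∧ ¬ i < l then 1 else 0) = n - l := by
  rw [← Finset.card_filter]
  have : (Finset.range M).filter (fun i => i < n ∧ ¬ i < l) = Finset.Ico l n := by
    ext i; simp only [Finset.mem_filter, Finset.mem_range, Finset.mem_Ico]; omega
  rw [this, Nat.card_Ico]

/-- A level set of a certificate of positive value has fewer edges into `A` than outside. -/
theorem Certificate.exists_level {G : SimpleGraph W} {A B : Finset W} {m : W → ℕ}
    {k : W → W → ℕ} (hc : Certificate G A m k)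
    (hval : 0 < certValue G A (fun w => dg G B w) m k) :
    ∃ S ⊆ A, S.card ≤ ∑ w ∈ A, m w ∧ ed G S (A \ S) < ed G S B := by
  set M := ∑ w ∈ A, m w with hM
  have hmM : ∀ w ∈ A, m w ≤ M := fun w hw => Finset.single_le_sum (fun _ _ => Nat.zero_le _) hw
  set S : ℕ → Finset W := fun i => A.filter fun w => i < m w with hS
  have e1 : ∑ i ∈ Finset.range M, ed G (S i) B = ∑ w ∈ A, m w * dg G B w := by
    simp only [ed, hS, Finset.sum_filter]
    rw [Finset.sum_comm]
    refine Finset.sum_congr rfl fun w hw => ?_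
    rw [← sum_level M (m w) (hmM w hw), Finset.sum_mul]
    refine Finset.sum_congr rfl fun i _ => ?_
    rw [sum_level M (m w) (hmM w hw)]
    split_ifs <;> simp
  have e2 : ∑ i ∈ Finset.range M, ed G (S i) (A \ S i) =
      ∑ w ∈ A, ∑ y ∈ A, if G.Adj w y then m w - m y else 0 := by
    have : ∀ i, ed G (S i) (A \ S i) = ∑ w ∈ A, ∑ y ∈ A,
        if G.Adj w y then (if i < m w ∧ ¬ i < m y then 1 else 0) else 0 := by
      intro i
      have h2 : A \ S i = A.filter fun w => ¬ i < m w := by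
        rw [hS]; ext x; simp only [Finset.mem_sdiff, Finset.mem_filter]; tauto
      rw [h2]
      simp only [ed, hS, Finset.sum_filter, dg_eq_sum]
      refine Finset.sum_congr rfl fun w _ => ?_
      by_cases h : i < m w
      · rw [if_pos h]
        refine Finset.sum_congr rfl fun y _ => ?_
        by_cases h1 : i < m y <;> by_cases h2 : G.Adj w y <;> simp [h, h1, h2]
      · simp [h]
    simp only [this]
    rw [Finset.sum_comm]
    refine Finset.sum_congr rfl fun w hw => ?_
    rw [Finset.sum_comm]
    refine Finset.sum_congr rfl fun y _ => ?_
    by_cases h : G.Adj w y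
    · simp only [h, if_true]
      exact sum_level_sub M _ _ (hmM w hw)
    · simp [h]
  have key : ((∑ i ∈ Finset.range M, ed G (S i) (A \ S i) : ℕ) : ℤ) <
      (∑ i ∈ Finset.range M, ed G (S i) B : ℕ) := by
    have e1' := congrArg (Nat.cast : ℕ → ℤ) e1
    have e2' := congrArg (Nat.cast : ℕ → ℤ) e2
    push_cast at e1' e2' ⊢
    rw [e1', e2']
    have hb : ∀ w ∈ A, (∑ y ∈ A, if G.Adj w y then ((m w - m y : ℕ) : ℤ) else 0) ≤
        m w * dg G A w - ∑ y ∈ A, (k w y : ℤ) := by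
      intro w _
      rw [dg_eq_sum]
      push_cast
      rw [Finset.mul_sum, ← Finset.sum_sub_distrib]
      refine Finset.sum_le_sum fun y _ => ?_
      have h1 := hc.le w y
      have h2 := hc.le y w
      rw [← hc.symm w y] at h2
      by_cases h : G.Adj w y
      · simp only [h, if_true]; omega
      · have h3 : k w y = 0 := by
          by_contra h4; exact h (hc.adj w y h4)
        simp [h, h3]
    have hb' := Finset.sum_le_sum hb
    rw [certValue] at hval
    simp only [mul_sub, Finset.sum_sub_distrib] at hval hb'
    linarith
  have key' : ∑ i ∈ Finset.range M, ed G (S i) (A \ S i) <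
      ∑ i ∈ Finset.range M, ed G (S i) B := by exact_mod_cast key
  obtain ⟨i, _, hi⟩ := Finset.exists_lt_of_sum_lt key'
  refine ⟨S i, Finset.filter_subset _ _, ?_, hi⟩
  rw [hM, hS, Finset.card_filter]
  refine Finset.sum_le_sum fun w _ => ?_
  split_ifs with h <;> omega

/-! ### Messages -/

/-- Size of certificates built from messages of depth `r`. -/
def certSize : ℕ → ℕ
  | 0 => 0
  | r + 1 => 1 + 3 * certSize r

/-- The best value, shifted by two, of a depth `r` certificate rooted at `v` to be attached to
the neighbour `u` of `v`, cut off at zero. -/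
def msg (G : SimpleGraph W) (A : Finset W) (b : W → ℤ) : ℕ → W → W → ℤ
  | 0, _, _ => 0
  | r + 1, u, v =>
    max 0 (2 + b v - dg G A v + ∑ z ∈ (A.filter (G.Adj v)).erase u, msg G A b r v z)

theorem msg_nonneg (G : SimpleGraph W) (A : Finset W) (b : W → ℤ) (r : ℕ) (u v : W) :
    0 ≤ msg G A b r u v := by
  cases r with
  | zero => exact le_rfl
  | succ r => exact le_max_left _ _

theorem certificate_of_messages {G : SimpleGraph W} {A : Finset W} {b : W → ℤ}
    (h3 : ∀ v ∈ A, dg G A v ≤ 3) {r : ℕ}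
    (hmsg : ∀ u v, v ∈ A → 0 < msg G A b r u v → ∃ m k, Certificate G A m k ∧
      k v u + 1 ≤ m v ∧ ∑ w ∈ A, m w ≤ certSize r ∧ msg G A b r u v - 2 ≤ certValue G A b m k)
    {v : W} (hv : v ∈ A) {Y : Finset W} (hY : Y ⊆ A.filter (G.Adj v)) :
    ∃ m k, Certificate G A m k ∧ (∀ u, u ∉ Y → k v u + 1 ≤ m v) ∧
      ∑ w ∈ A, m w ≤ certSize (r + 1) ∧
      b v - dg G A v + ∑ z ∈ Y, msg G A b r v z ≤ certValue G A b m k := by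
  have hY' : ∀ z ∈ Y, z ∈ A ∧ G.Adj v z := fun z hz => by simpa using hY hz
  obtain ⟨m, k, h1, h2, h4, h5⟩ := certificate_combine (b := b) (s := certSize r) hv
    (Z := Y.filter fun z => 0 < msg G A b r v z)
    (fun z hz => hY' z (Finset.mem_filter.1 hz).1)
    (t := fun z => msg G A b r v z - 2)
    (fun z hz => by
      rw [Finset.mem_filter] at hz
      exact hmsg v z (hY' z hz.1).1 hz.2)
  refine ⟨m, k, h1, fun u hu => h2 u fun h => hu (Finset.mem_filter.1 h).1, h4.trans ?_, ?_⟩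
  · rw [certSize]
    refine Nat.add_le_add_left (Nat.mul_le_mul_right _ ?_) _
    exact (Finset.card_le_card ((Finset.filter_subset _ _).trans hY)).trans (h3 v hv)
  · have : ∑ z ∈ Y, msg G A b r v z =
        ∑ z ∈ Y.filter (fun z => 0 < msg G A b r v z), (msg G A b r v z - 2 + 2) := by
      simp only [sub_add_cancel]
      rw [Finset.sum_filter]
      refine Finset.sum_congr rfl fun z _ => ?_
      have := msg_nonneg G A b r v z
      split_ifs <;> omega
    rw [this]
    exact h5

theorem certificate_of_msg {G : SimpleGraph W} {A : Finset W} {b : W → ℤ}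
    (h3 : ∀ v ∈ A, dg G A v ≤ 3) (r : ℕ) : ∀ u v, v ∈ A → 0 < msg G A b r u v →
      ∃ m k, Certificate G A m k ∧ k v u + 1 ≤ m v ∧ ∑ w ∈ A, m w ≤ certSize r ∧
        msg G A b r u v - 2 ≤ certValue G A b m k := by
  induction r with
  | zero => intro u v _ h; exact absurd h (lt_irrefl _)
  | succ r ih =>
    intro u v hv h
    obtain ⟨m, k, h1, h2, h4, h5⟩ := certificate_of_messages h3 ih hv
      (Finset.erase_subset u (A.filter (G.Adj v)))
    refine ⟨m, k, h1, h2 u (Finset.notMem_erase _ _), h4, ?_⟩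
    rw [msg] at h ⊢
    omega

theorem sum_adj_swap (G : SimpleGraph W) (A : Finset W) (f : W → W → ℤ) :
    ∑ v ∈ A, ∑ z ∈ A.filter (G.Adj v), f v z = ∑ v ∈ A, ∑ z ∈ A.filter (G.Adj v), f z v := by
  simp only [Finset.sum_filter]
  rw [Finset.sum_comm]
  simp only [G.adj_comm]

/-- If a cut of a graph of maximum degree three is large, then moving boundedly many vertices
out of one side improves it. -/
theorem exists_helpful {G : SimpleGraph W} {K A : Finset W} (hAK : A ⊆ K)
    (h3 : ∀ v ∈ K, dg G K v ≤ 3) {r N : ℕ} (hN : ∑ v ∈ A, dg G A v ≤ N)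
    (h : (N : ℤ) < r * (3 * cut G K A - n3 G K A)) :
    ∃ S ⊆ A, S.Nonempty ∧ S.card ≤ certSize (r + 1) ∧
      (cut G K (A \ S) < cut G K A ∨
        ∃ v, S = {v} ∧ dg G K v ≤ 2 ∧ cut G K (A \ S) ≤ cut G K A) := by
  by_contra hcon
  push Not at hcon
  have hpos : 1 ≤ certSize (r + 1) := by rw [certSize]; omega
  have hdeg := fun v => dg_add_sdiff G hAK v
  -- local structure at a vertex
  have hloc : ∀ v ∈ A, dg G (K \ A) v ≤ dg G A v ∧
      (dg G K v ≤ 2 → dg G (K \ A) v < dg G A v) := by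
    intro v hv
    have h1 := hcon {v} (by simpa using hv) (by simp) (by simpa using hpos)
    have h2 := cut_erase G hAK hv
    rw [Finset.sdiff_singleton_eq_erase] at h1
    have h4 := h1.2 v rfl
    refine ⟨by omega, fun h5 => ?_⟩
    have := h4 h5
    omega
  have hdA : ∀ v ∈ A, dg G A v ≤ 3 := fun v hv => (dg_mono G hAK v).trans (h3 v (hAK hv))
  set b : W → ℤ := fun w => dg G (K \ A) w with hb
  have hval : ∀ s ≤ r, ∀ v ∈ A,
      b v - dg G A v + ∑ z ∈ A.filter (G.Adj v), msg G A b s v z ≤ 0 := by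
    intro s hs v hv
    by_contra hlt
    obtain ⟨m, k, h1, -, h4, h5⟩ := certificate_of_messages hdA (certificate_of_msg (b := b) hdA s)
      hv (subset_refl _)
    obtain ⟨S, hSA, hScard, hS⟩ := h1.exists_level (B := K \ A) (lt_of_lt_of_le (not_le.1 hlt) h5)
    have hne : S.Nonempty := by
      rw [Finset.nonempty_iff_ne_empty]
      rintro rfl
      simp [ed] at hS
    have hmono : ∀ s t, s ≤ t → certSize s ≤ certSize t := by
      refine monotone_nat_of_le_succ fun n => ?_
      rw [certSize]; omega
    have := (hcon S hSA hne ((hScard.trans h4).trans (hmono _ _ (by omega)))).1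
    have h6 := cut_sdiff G hAK hSA
    omega
  have hstep : ∀ s < r, ∀ v ∈ A, ∑ z ∈ A.filter (G.Adj v), msg G A b s v z +
      (3 * b v - if dg G K v = 3 then 1 else 0) ≤
      ∑ u ∈ A.filter (G.Adj v), msg G A b (s + 1) u v := by
    intro s hs v hv
    have hM := hval s hs.le v hv
    set M := ∑ z ∈ A.filter (G.Adj v), msg G A b s v z with hMdef
    have he : ∑ u ∈ A.filter (G.Adj v), msg G A b (s + 1) u v =
        ∑ u ∈ A.filter (G.Adj v), max 0 (2 + b v - dg G A v + (M - msg G A b s v u)) := by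
      refine Finset.sum_congr rfl fun u hu => ?_
      rw [msg, hMdef, ← Finset.sum_erase_eq_sub hu]
    rw [he]
    have hnn := msg_nonneg G A b s v
    have hlo := hloc v hv
    have hde := hdeg v
    have hd3 := h3 v (hAK hv)
    have hbv : b v = (dg G (K \ A) v : ℤ) := rfl
    have hcard : (A.filter (G.Adj v)).card = dg G A v := rfl
    have hcases : dg G A v = 0 ∨ dg G A v = 1 ∨ dg G A v = 2 ∨ dg G A v = 3 := by
      have := hdA v hv; omega
    rcases hcases with h0 | h0 | h0 | h0
    · rw [h0] at hcard
      rw [Finset.card_eq_zero] at hcard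
      have : M = 0 := by rw [hMdef, hcard, Finset.sum_empty]
      rw [hcard, Finset.sum_empty]
      split_ifs <;> omega
    · rw [h0] at hcard
      obtain ⟨x, hx⟩ := Finset.card_eq_one.1 hcard
      rw [hx, Finset.sum_singleton] at hMdef
      rw [hx, Finset.sum_singleton]
      have := hnn x
      split_ifs <;> omega
    · rw [h0] at hcard
      obtain ⟨x, y, hxy, hx⟩ := Finset.card_eq_two.1 hcard
      rw [hx, Finset.sum_pair hxy] at hMdef
      rw [hx, Finset.sum_pair hxy]
      have := hnn x
      have := hnn y
      split_ifs <;> omega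
    · rw [h0] at hcard
      obtain ⟨x, y, z, hxy, hxz, hyz, hx⟩ := Finset.card_eq_three.1 hcard
      rw [hx, Finset.sum_insert (by simp [hxy, hxz]), Finset.sum_pair hyz] at hMdef
      rw [hx, Finset.sum_insert (by simp [hxy, hxz]), Finset.sum_pair hyz]
      have := hnn x
      have := hnn y
      have := hnn z
      split_ifs <;> omega
  have hPhi : ∀ s ≤ r, (s : ℤ) * (3 * cut G K A - n3 G K A) ≤
      ∑ v ∈ A, ∑ z ∈ A.filter (G.Adj v), msg G A b s v z := by
    intro s
    induction s with
    | zero =>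
      intro _
      simp [msg]
    | succ s ih =>
      intro hs
      have h1 := ih (by omega)
      have h2 := Finset.sum_le_sum (hstep s (by omega))
      rw [sum_adj_swap]
      rw [Finset.sum_add_distrib, Finset.sum_sub_distrib, ← Finset.mul_sum] at h2
      have h4 : ∑ v ∈ A, b v = cut G K A := by simp [cut, ed, hb]
      have h5 : (∑ v ∈ A, if dg G K v = 3 then 1 else 0 : ℤ) = n3 G K A := by
        rw [n3, Finset.card_filter]; push_cast; rfl
      rw [h4, h5] at h2
      push_cast
      linarith
  have h1 := hPhi r le_rfl
  have h2 : ∑ v ∈ A, ∑ z ∈ A.filter (G.Adj v), msg G A b r v z ≤ ∑ v ∈ A, (dg G A v : ℤ) := by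
    refine Finset.sum_le_sum fun v hv => ?_
    have := hval r le_rfl v hv
    have h0 : 0 ≤ b v := Int.natCast_nonneg _
    linarith
  have h4 : (∑ v ∈ A, (dg G A v : ℤ)) ≤ N := by exact_mod_cast hN
  linarith

/-! ### Sweeping graphs of maximum degree three -/

theorem ed_le_of_degree {G : SimpleGraph W} {K S B : Finset W} (h3 : ∀ v ∈ K, dg G K v ≤ 3)
    (hS : S ⊆ K) (hB : B ⊆ K) :
    ed G S B ≤ S.card * 3 := by
  rw [ed, ← smul_eq_mul]
  exact Finset.sum_le_card_nsmul _ _ _ fun v hv => (dg_mono G hB v).trans (h3 v (hS hv))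

theorem n3_mono (G : SimpleGraph W) (K : Finset W) {A B : Finset W} (h : A ⊆ B) :
    n3 G K A ≤ n3 G K B :=
  Finset.card_le_card (Finset.filter_subset_filter _ h)

theorem n3_sdiff (G : SimpleGraph W) (K : Finset W) {A S : Finset W} (h : S ⊆ A) :
    n3 G K (A \ S) + n3 G K S = n3 G K A := by
  rw [n3, n3, n3, ← Finset.card_union_of_disjoint, ← Finset.filter_union,
    Finset.sdiff_union_of_subset h]
  exact Finset.disjoint_filter_filter Finset.sdiff_disjoint

theorem refill {G : SimpleGraph W} {K A S : Finset W} {x : ℝ} {C : ℕ} (hA : A ⊆ K)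
    (h3 : ∀ v ∈ K, dg G K v ≤ 3) (hC : S.card ≤ C) (hx : cut G K A ≤ x) :
    ReflTransGen (Step (fun A => (cut G K A : ℝ)) K (x + 3 * C)) (A \ S) A := by
  refine sweep_fill Finset.sdiff_subset hA fun D h1 h2 => ?_
  have e : A \ (A \ D) = D := Finset.sdiff_sdiff_eq_self h2
  have hsub : A \ D ⊆ S := by
    intro y hy
    rw [Finset.mem_sdiff] at hy
    by_contra hyS
    exact hy.2 (h1 (Finset.mem_sdiff.2 ⟨hy.1, hyS⟩))
  have h4 := cut_sdiff G hA (Finset.sdiff_subset (s := A) (t := D))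
  rw [e] at h4
  have h5 := ed_le_of_degree h3 ((Finset.sdiff_subset (s := A) (t := D)).trans hA) (h2.trans hA)
  have h6 := (Finset.card_le_card hsub).trans hC
  have h7 : cut G K D ≤ cut G K A + 3 * C := by omega
  have : (cut G K D : ℝ) ≤ cut G K A + 3 * C := by exact_mod_cast h7
  linarith

theorem sweep_down {G : SimpleGraph W} {K : Finset W} (h3 : ∀ v ∈ K, dg G K v ≤ 3) {r N T : ℕ}
    (hN : ∑ v ∈ K, dg G K v ≤ N) {x : ℝ}
    (hx : ∀ A ⊆ K, 2 * n3 G K A ≤ T → (r : ℤ) * (3 * cut G K A - n3 G K A) ≤ N →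
      (cut G K A : ℝ) + 3 ≤ x) (n : ℕ) :
    ∀ A ⊆ K, A.card ≤ n → 2 * n3 G K A ≤ T → (cut G K A : ℝ) ≤ x →
      ReflTransGen (Step (fun A => (cut G K A : ℝ)) K (x + 3 * certSize (r + 1))) ∅ A := by
  induction n with
  | zero =>
    intro A _ hc _ _
    rw [Finset.card_eq_zero.1 (Nat.le_zero.1 hc)]
  | succ n ih =>
    intro A hA hc hT hcut
    rcases A.eq_empty_or_nonempty with rfl | ⟨v, hv⟩
    · exact ReflTransGen.refl
    have main : ∀ S ⊆ A, S.Nonempty → S.card ≤ certSize (r + 1) → (cut G K (A \ S) : ℝ) ≤ x →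
        ReflTransGen (Step (fun A => (cut G K A : ℝ)) K (x + 3 * certSize (r + 1))) ∅ A := by
      intro S hS hne hSc hScut
      refine (ih (A \ S) (Finset.sdiff_subset.trans hA) ?_ ?_ hScut).trans
        (refill hA h3 hSc hcut)
      · rw [Finset.card_sdiff_of_subset hS]
        have := hne.card_pos
        omega
      · have := n3_mono G K (Finset.sdiff_subset (s := A) (t := S))
        omega
    by_cases hh : (N : ℤ) < r * (3 * cut G K A - n3 G K A)
    · have hNA : ∑ v ∈ A, dg G A v ≤ N :=
        ((Finset.sum_le_sum fun v _ => dg_mono G hA v).trans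
          (Finset.sum_le_sum_of_subset hA)).trans hN
      obtain ⟨S, h1, h2, h4, h5⟩ := exists_helpful hA h3 hNA hh
      refine main S h1 h2 h4 (le_trans (Nat.cast_le.2 ?_) hcut)
      rcases h5 with h5 | ⟨_, _, _, h5⟩
      · exact h5.le
      · exact h5
    · have h1 := hx A hA hT (not_lt.1 hh)
      refine main {v} (by simpa using hv) (by simp) (by rw [certSize, Finset.card_singleton]; omega) ?_
      rw [Finset.sdiff_singleton_eq_erase]
      have h2 := cut_erase G hA hv
      have h4 := (dg_mono G hA v).trans (h3 v (hA hv))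
      have h5 : (cut G K (A.erase v) : ℝ) ≤ cut G K A + 3 := by
        exact_mod_cast (by omega : cut G K (A.erase v) ≤ cut G K A + 3)
      linarith

theorem exists_bisection {G : SimpleGraph W} {K : Finset W} (h3 : ∀ v ∈ K, dg G K v ≤ 3)
    {r N : ℕ} (hN : ∑ v ∈ K, dg G K v ≤ N) :
    ∃ A ⊆ K, n3 G K K ≤ 2 * n3 G K A ∧ 2 * n3 G K A ≤ n3 G K K + 2 * certSize (r + 1) ∧
      (r : ℤ) * (3 * cut G K A - n3 G K A) ≤ N := by
  set C := certSize (r + 1) with hC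
  have hC1 : 1 ≤ C := by rw [hC, certSize]; omega
  set F := K.powerset.filter fun A => n3 G K K ≤ 2 * n3 G K A ∧ 2 * n3 G K A ≤ n3 G K K + 2 * C
    with hF
  have hne : F.Nonempty := by
    obtain ⟨A, hA, hcard⟩ := Finset.exists_subset_card_eq
      (s := K.filter fun v => dg G K v = 3) (n := (n3 G K K + 1) / 2) (by rw [← n3]; omega)
    have h1 : n3 G K A = (n3 G K K + 1) / 2 := by
      rw [n3, Finset.filter_true_of_mem fun v hv => (Finset.mem_filter.1 (hA hv)).2, hcard]
    refine ⟨A, Finset.mem_filter.2 ⟨Finset.mem_powerset.2 (hA.trans (Finset.filter_subset _ _)), ?_⟩⟩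
    omega
  obtain ⟨A, hAF, hmin⟩ := Finset.exists_min_image F
    (fun A => cut G K A * (K.card + 1) + A.card) hne
  rw [hF, Finset.mem_filter, Finset.mem_powerset] at hAF
  obtain ⟨hAK, hA1, hA2⟩ := hAF
  refine ⟨A, hAK, hA1, hA2, ?_⟩
  by_contra hh
  have hNA : ∑ v ∈ A, dg G A v ≤ N :=
    ((Finset.sum_le_sum fun v _ => dg_mono G hAK v).trans
      (Finset.sum_le_sum_of_subset hAK)).trans hN
  obtain ⟨S, hS, hSne, hSc, hcase⟩ := exists_helpful hAK h3 hNA (not_le.1 hh)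
  have hlex : ∀ D ⊆ K, cut G K D < cut G K A →
      ¬ (n3 G K K ≤ 2 * n3 G K D ∧ 2 * n3 G K D ≤ n3 G K K + 2 * C) := by
    intro D hD hlt hfam
    have h1 := hmin D (Finset.mem_filter.2 ⟨Finset.mem_powerset.2 hD, hfam⟩)
    have h2 := Finset.card_le_card hD
    have h4 : (cut G K D + 1) * (K.card + 1) ≤ cut G K A * (K.card + 1) :=
      Nat.mul_le_mul_right _ hlt
    rw [add_mul] at h4
    omega
  have hsd := n3_sdiff G K hS
  have hsub : A \ S ⊆ K := Finset.sdiff_subset.trans hAK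
  have hScard : n3 G K S ≤ C := (Finset.card_filter_le _ _).trans hSc
  have hAn := n3_mono G K hAK
  rcases hcase with hlt | ⟨v, rfl, hdv, hle⟩
  · by_cases hcs : n3 G K K ≤ 2 * n3 G K (A \ S)
    · exact hlex _ hsub hlt ⟨hcs, by omega⟩
    · have h1 := n3_sdiff G K hsub
      exact hlex (K \ (A \ S)) Finset.sdiff_subset (by rwa [cut_compl G hsub]) ⟨by omega, by omega⟩
  · have h0 : n3 G K {v} = 0 := by
      rw [n3, Finset.card_eq_zero, Finset.filter_eq_empty_iff]
      intro x hx
      rw [Finset.mem_singleton.1 hx]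
      omega
    have h1 := hmin (A \ {v}) (Finset.mem_filter.2 ⟨Finset.mem_powerset.2 hsub, by omega, by omega⟩)
    have h2 : (A \ {v}).card < A.card := by
      rw [Finset.card_sdiff_of_subset hS, Finset.card_singleton]
      have := Finset.card_pos.2 ⟨v, hS (Finset.mem_singleton_self v)⟩
      omega
    have h4 := Nat.mul_le_mul_right (K.card + 1) hle
    omega

theorem sweepable_of_degree_le_three {G : SimpleGraph W} {K : Finset W}
    (h3 : ∀ v ∈ K, dg G K v ≤ 3) {r N : ℕ} (hr : 0 < r) (hN : ∑ v ∈ K, dg G K v ≤ N) :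
    Sweepable G K ((n3 G K K : ℝ) / 6 + N / (3 * r) + (4 * certSize (r + 1) + 3)) := by
  set C := certSize (r + 1) with hC
  have hr' : (0 : ℝ) < r := by exact_mod_cast hr
  set x : ℝ := (n3 G K K : ℝ) / 6 + C / 3 + N / (3 * r) + 3 with hx
  have hbd : ∀ A ⊆ K, 2 * n3 G K A ≤ n3 G K K + 2 * C →
      (r : ℤ) * (3 * cut G K A - n3 G K A) ≤ N → (cut G K A : ℝ) + 3 ≤ x := by
    intro A _ h1 h2
    have h1' : 2 * (n3 G K A : ℝ) ≤ n3 G K K + 2 * C := by exact_mod_cast h1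
    have h2' : (r : ℝ) * (3 * cut G K A - n3 G K A) ≤ N := by exact_mod_cast h2
    have h4 : (N : ℝ) / (3 * r) = N / r / 3 := by field_simp
    have h5 : (3 * cut G K A - n3 G K A : ℝ) ≤ N / r := by
      rw [le_div_iff₀ hr']; linarith
    rw [hx, h4]
    linarith
  obtain ⟨A, hAK, h1, h2, h4⟩ := exists_bisection h3 (r := r) hN
  have hcut := hbd A hAK h2 h4
  have s1 := sweep_down h3 hN hbd A.card A hAK le_rfl h2 (by linarith)
  have hsd := n3_sdiff G K hAK
  have s2 := sweep_down h3 hN hbd (K \ A).card (K \ A) Finset.sdiff_subset le_rfl (by omega)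
    (by rw [cut_compl G hAK]; linarith)
  have s3 : ReflTransGen (Step (fun A => (cut G K A : ℝ)) K (x + 3 * C)) (K \ (K \ A)) (K \ ∅) := by
    refine rtg_lift (fun D => K \ D) ?_ (ReflTransGen.swap _ _ s2)
    rintro B D ⟨v, hv1, hv2, rfl, hv4, hv5, hv6⟩
    refine ReflTransGen.single ⟨v, hv1, ?_, ?_, Finset.sdiff_subset, ?_, ?_⟩
    · simp
    · ext y
      simp only [Finset.mem_sdiff, Finset.mem_insert]
      by_cases hy : y = v
      · simp [hy, hv1, hv2]
      · simp [hy]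
    · simp only
      rwa [cut_compl G (Finset.insert_subset hv1 hv4)]
    · simp only
      rwa [cut_compl G hv4]
  rw [Finset.sdiff_sdiff_eq_self hAK, Finset.sdiff_empty] at s3
  refine Sweepable.mono (x := x + 3 * C) ?_ ?_
  · refine rtg_mono ?_ (s1.trans s3)
    rintro B D ⟨v, hv1, hv2, hv3, hv4, hv5, hv6⟩
    exact ⟨v, hv1, hv2, hv3, hv4, le_trans (Nat.cast_le.2 (bdry_card_le_cut G K B)) hv5,
      le_trans (Nat.cast_le.2 (bdry_card_le_cut G K D)) hv6⟩
  · have : (1 : ℝ) ≤ C := by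
      rw [hC, certSize]
      push_cast
      have : (0 : ℝ) ≤ certSize r := Nat.cast_nonneg _
      linarith
    rw [hx]
    linarith

/-! ### Sweeps with hanging pieces of bounded size -/

/-- Any `U` retracting onto `K` with fibres of size at most `L` can be swept at cost `x`, up to
an additive constant `S` and an error term proportional to `|U|`. -/
def Good (G : SimpleGraph W) (L : ℕ) (S : ℝ) (K : Finset W) (x : ℝ) : Prop :=
  ∀ (U : Finset W) (p : W → W), Hanging G U K p → (∀ v ∈ K, (pre U p {v}).card ≤ L) →
    Sweepable G U (x + 4 / L * U.card + S)

section

variable {G : SimpleGraph W} {L : ℕ} {S : ℝ} {K M M₁ M₂ U : Finset W} {x y : ℝ} {p : W → W}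
  {u : W}

theorem Good.mono (h : Good G L S K x) (hxy : x ≤ y) : Good G L S K y :=
  fun U p h1 h2 => (h U p h1 h2).mono (by linarith)

theorem pre_subset (U : Finset W) (p : W → W) (M : Finset W) : pre U p M ⊆ U :=
  Finset.filter_subset _ _

theorem pre_disjoint (U : Finset W) (p : W → W) (h : Disjoint M₁ M₂) :
    Disjoint (pre U p M₁) (pre U p M₂) :=
  Finset.disjoint_left.2 fun _ h1 h2 =>
    Finset.disjoint_left.1 h (mem_pre.1 h1).2 (mem_pre.1 h2).2

theorem Hanging.no_edge (h : Hanging G U K p) (hM : Disjoint M₁ M₂)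
    (hadj : ∀ a ∈ M₁, ∀ b ∈ M₂, ¬ G.Adj a b) :
    ∀ a ∈ pre U p M₁, ∀ b ∈ pre U p M₂, ¬ G.Adj a b := by
  intro a ha b hb hab
  rw [mem_pre] at ha hb
  rcases h.adj a ha.1 b hb.1 hab with h1 | ⟨h1, h2⟩
  · exact Finset.disjoint_left.1 hM ha.2 (h1 ▸ hb.2)
  · have h3 := ha.2
    have h4 := hb.2
    rw [h.fix a h1] at h3
    rw [h.fix b h2] at h4
    exact hadj a h3 b h4 hab

theorem Good.restrict (hg : Good G L S M x) (h : Hanging G U K p) (hM : M ⊆ K)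
    (hL : ∀ v ∈ K, (pre U p {v}).card ≤ L) :
    Sweepable G (pre U p M) (x + 4 / L * (pre U p M).card + S) := by
  refine hg _ p (h.restrict hM) fun v hv => le_trans (Finset.card_le_card ?_) (hL v (hM hv))
  exact Finset.filter_subset_filter _ (pre_subset _ _ _)

theorem sweepable_of_erase_fibre (h : Hanging G U K p) (hu : u ∈ K)
    (hL : (pre U p {u}).card ≤ L) (hx : (L : ℝ) ≤ x)
    (hs : Sweepable G (pre U p (K.erase u)) x) : Sweepable G U (x + 1) := by
  refine sweepable_of_erase (h.sub hu) ((Nat.cast_nonneg L).trans hx) ?_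
  have e : U.erase u = pre U p (K.erase u) ∪ (pre U p {u}).erase u := by
    ext y
    simp only [Finset.mem_erase, Finset.mem_union, mem_pre, Finset.mem_singleton]
    constructor
    · rintro ⟨h1, h2⟩
      by_cases h3 : p y = u
      · exact Or.inr ⟨h1, h2, h3⟩
      · exact Or.inl ⟨h2, h3, h.mem y h2⟩
    · rintro (⟨h1, h2, -⟩ | ⟨h1, h2, -⟩)
      · refine ⟨fun h3 => h2 ?_, h1⟩
        rw [h3]
        exact h.fix u hu
      · exact ⟨h1, h2⟩
  have hd : Disjoint (K.erase u) {u} := by simp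
  rw [e]
  refine sweepable_union ((pre_disjoint U p hd).mono_right (Finset.erase_subset _ _)) ?_ hs ?_
  · intro a ha b hb hab
    rw [Finset.mem_erase, mem_pre, Finset.mem_singleton] at hb
    rw [mem_pre, Finset.mem_erase] at ha
    rcases h.adj a ha.1 b hb.2.1 hab with h1 | ⟨-, h1⟩
    · exact ha.2.1 (h1.trans hb.2.2)
    · exact hb.1 ((h.fix b h1).symm.trans hb.2.2)
  · refine sweepable_of_card_le (le_trans ?_ hx)
    exact_mod_cast (Finset.card_le_card (Finset.erase_subset _ _)).trans hL

theorem error_mono (hU : M ⊆ U) : 4 / (L : ℝ) * M.card ≤ 4 / L * U.card :=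
  mul_le_mul_of_nonneg_left (Nat.cast_le.2 (Finset.card_le_card hU)) (by positivity)

theorem error_nonneg : 0 ≤ 4 / (L : ℝ) * U.card := by positivity

theorem Good.of_erase (hS : L ≤ S) (hx : 0 ≤ x) (hu : u ∈ K) (h : Good G L S (K.erase u) x) :
    Good G L S K (x + 1) := by
  intro U p hU hL
  have h1 := h.restrict hU (Finset.erase_subset _ _) hL
  have h2 := error_mono (L := L) (pre_subset U p (K.erase u))
  have h3 := error_nonneg (L := L) (U := U)
  have h4 := sweepable_of_erase_fibre (x := x + 4 / L * U.card + S) hU hu (hL u hu)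
    (by linarith) (h1.mono (by linarith))
  exact h4.mono (by linarith)

theorem Good.union (hd : Disjoint M₁ M₂) (hadj : ∀ a ∈ M₁, ∀ b ∈ M₂, ¬ G.Adj a b)
    (h₁ : Good G L S M₁ x) (h₂ : Good G L S M₂ x) : Good G L S (M₁ ∪ M₂) x := by
  intro U p hU hL
  have e : U = pre U p M₁ ∪ pre U p M₂ := by
    ext y
    have := hU.mem y
    simp only [Finset.mem_union, mem_pre] at this ⊢
    tauto
  have h2 := error_mono (L := L) (pre_subset U p M₁)
  have h3 := error_mono (L := L) (pre_subset U p M₂)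
  have := sweepable_union (pre_disjoint U p hd) (hU.no_edge hd hadj)
    ((h₁.restrict hU Finset.subset_union_left hL).mono
      (y := x + 4 / L * U.card + S) (by linarith))
    ((h₂.restrict hU Finset.subset_union_right hL).mono (by linarith))
  rwa [← e] at this

theorem Hanging.absorb (h : Hanging G U (insert u (M₁ ∪ M₂)) p) (hd : Disjoint M₁ M₂)
    (hu₁ : u ∉ M₁) (hadj : ∀ a ∈ M₁, ∀ b ∈ M₂, ¬ G.Adj a b) :
    Hanging G U (insert u M₂) fun y => if p y ∈ M₁ then u else p y := by
  have hfix : ∀ v ∈ insert u M₂, p v = v := fun v hv =>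
    h.fix v (by simp only [Finset.mem_insert, Finset.mem_union] at hv ⊢; tauto)
  have hout : ∀ v ∈ insert u M₂, v ∉ M₁ := by
    intro v hv hv1
    rcases Finset.mem_insert.1 hv with rfl | hv
    · exact hu₁ hv1
    · exact Finset.disjoint_left.1 hd hv1 hv
  refine ⟨fun v hv => h.sub ?_, ?_, ?_, ?_⟩
  · simp only [Finset.mem_insert, Finset.mem_union] at hv ⊢; tauto
  · intro y hy
    have := h.mem y hy
    simp only [Finset.mem_insert, Finset.mem_union] at this ⊢
    split_ifs <;> tauto
  · intro v hv
    rw [hfix v hv, if_neg (hout v hv)]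
  · intro a ha b hb hab
    rcases h.adj a ha b hb hab with h1 | ⟨h1, h2⟩
    · left; rw [h1]
    · rw [h.fix a h1, h.fix b h2]
      by_cases ha1 : a ∈ M₁ <;> by_cases hb1 : b ∈ M₁
      · simp [ha1, hb1]
      · left
        have hb2 : b ∉ M₂ := fun hb2 => hadj a ha1 b hb2 hab
        simp only [Finset.mem_insert, Finset.mem_union] at h2
        have : b = u := by tauto
        simp [ha1, this]
      · left
        have hb2 : a ∉ M₂ := fun ha2 => hadj b hb1 a ha2 hab.symm
        simp only [Finset.mem_insert, Finset.mem_union] at h1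
        have : a = u := by tauto
        simp [hb1, this]
      · right
        simp only [Finset.mem_insert, Finset.mem_union] at h1 h2 ⊢
        tauto

theorem Good.absorb (hd : Disjoint M₁ M₂) (hu₁ : u ∉ M₁) (hu₂ : u ∉ M₂)
    (hadj : ∀ a ∈ M₁, ∀ b ∈ M₂, ¬ G.Adj a b) (hg : Good G L S (insert u M₂) x)
    (h : Hanging G U (insert u (M₁ ∪ M₂)) p)
    (hL : ∀ v ∈ insert u (M₁ ∪ M₂), (pre U p {v}).card ≤ L)
    (hc : (pre U p M₁).card + (pre U p {u}).card ≤ L) :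
    Sweepable G U (x + 4 / L * U.card + S) := by
  refine hg U _ (h.absorb hd hu₁ hadj) fun v hv => ?_
  rcases Finset.mem_insert.1 hv with rfl | hv2
  · refine le_trans (Finset.card_le_card ?_) ((Finset.card_union_le _ _).trans hc)
    intro y hy
    simp only [mem_pre, Finset.mem_singleton, Finset.mem_union] at hy ⊢
    by_cases h1 : p y ∈ M₁
    · exact Or.inl ⟨hy.1, h1⟩
    · rw [if_neg h1] at hy
      exact Or.inr hy
  · refine le_trans (Finset.card_le_card ?_) (hL v (by simp [hv2]))
    intro y hy
    simp only [mem_pre, Finset.mem_singleton] at hy ⊢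
    by_cases h1 : p y ∈ M₁
    · rw [if_pos h1] at hy
      exact absurd (hy.2 ▸ hv2) hu₂
    · rwa [if_neg h1] at hy

theorem Good.of_cut_vertex (hL0 : 0 < L) (hS : L ≤ S) (hx : 0 ≤ x) (hd : Disjoint M₁ M₂)
    (hu₁ : u ∉ M₁) (hu₂ : u ∉ M₂) (hadj : ∀ a ∈ M₁, ∀ b ∈ M₂, ¬ G.Adj a b)
    (h₁ : Good G L S (insert u M₁) x) (h₂ : Good G L S (insert u M₂) x)
    (h₁' : Good G L S M₁ (x + 3)) (h₂' : Good G L S M₂ (x + 3)) :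
    Good G L S (insert u (M₁ ∪ M₂)) x := by
  intro U p hU hL
  by_cases c₁ : (pre U p M₁).card + (pre U p {u}).card ≤ L
  · exact h₂.absorb hd hu₁ hu₂ hadj hU hL c₁
  by_cases c₂ : (pre U p M₂).card + (pre U p {u}).card ≤ L
  · rw [Finset.union_comm] at hU hL
    exact h₁.absorb hd.symm hu₂ hu₁ (fun a ha b hb hab => hadj b hb a ha hab.symm) hU hL c₂
  have hK : (insert u (M₁ ∪ M₂)).erase u = M₁ ∪ M₂ :=
    Finset.erase_insert (by simp [hu₁, hu₂])
  have hpre : pre U p (M₁ ∪ M₂) = pre U p M₁ ∪ pre U p M₂ := by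
    ext y; simp only [Finset.mem_union, mem_pre]; tauto
  have hdu : Disjoint (M₁ ∪ M₂) {u} := by simp [hu₁, hu₂]
  have hcard : (pre U p M₁).card + (pre U p M₂).card + (pre U p {u}).card ≤ U.card := by
    have h1 := pre_disjoint U p hdu
    have h2 := pre_disjoint U p hd
    rw [← Finset.card_union_of_disjoint h2, ← hpre, ← Finset.card_union_of_disjoint h1]
    exact Finset.card_le_card (Finset.union_subset (pre_subset _ _ _) (pre_subset _ _ _))
  have hL' : (0 : ℝ) < L := Nat.cast_pos.2 hL0
  have herr : ∀ n : ℕ, n + L ≤ U.card → 4 / (L : ℝ) * n + 4 ≤ 4 / L * U.card := by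
    intro n hn
    have h1 : ((n : ℝ) + L) ≤ U.card := by exact_mod_cast hn
    have h2 := mul_le_mul_of_nonneg_left h1 (by positivity : (0 : ℝ) ≤ 4 / L)
    have h3 : 4 / (L : ℝ) * (n + L) = 4 / L * n + 4 := by field_simp
    linarith
  have e1 := herr (pre U p M₁).card (by omega)
  have e2 := herr (pre U p M₂).card (by omega)
  have e3 : 0 ≤ 4 / (L : ℝ) * (pre U p M₁).card := error_nonneg
  have s1 := h₁'.restrict hU (Finset.subset_union_left.trans (Finset.subset_insert _ _)) hL
  have s2 := h₂'.restrict hU (Finset.subset_union_right.trans (Finset.subset_insert _ _)) hL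
  have s := sweepable_union (pre_disjoint U p hd) (hU.no_edge hd hadj)
    (s1.mono (y := x + 4 / L * U.card + S - 1) (by linarith)) (s2.mono (by linarith))
  rw [← hpre] at s
  have hu := Finset.mem_insert_self u (M₁ ∪ M₂)
  have := sweepable_of_erase_fibre hU hu (hL u hu) (x := x + 4 / L * U.card + S - 1) (by linarith)
    (by rwa [hK])
  simpa using this

theorem Good.of_sweepable {E : ℝ} (hS : E + L ≤ S) (h : Sweepable G K (x + E)) :
    Good G L S K x := by
  intro U p hU hL
  have h1 := error_nonneg (L := L) (U := U)
  exact (hU.sweepable hL h).mono (by linarith)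

theorem Good.of_card_le_two (hS : 2 * (L : ℝ) ≤ S) (hx : 0 ≤ x) (hK : K.card ≤ 2) :
    Good G L S K x := by
  intro U p hU hL
  have h1 := error_nonneg (L := L) (U := U)
  refine sweepable_of_card_le ?_
  have h2 : U.card ≤ L * K.card := by
    refine Finset.card_le_mul_card_image_of_maps_to (f := p) hU.mem L fun v hv => ?_
    refine le_trans (Finset.card_le_card ?_) (hL v hv)
    intro y
    simp [mem_pre]
  have h3 : U.card ≤ L * 2 := h2.trans (Nat.mul_le_mul_left _ hK)
  have h4 : (U.card : ℝ) ≤ L * 2 := by exact_mod_cast h3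
  linarith

end

/-! ### Cores and connectedness -/

/-- The largest subset of `K` inducing minimum degree at least two. -/
def core (G : SimpleGraph W) (K : Finset W) : Finset W :=
  (K.powerset.filter fun A => ∀ v ∈ A, 2 ≤ dg G A v).biUnion id

/-- The graph induced on `K` is connected. -/
def Conn (G : SimpleGraph W) (K : Finset W) : Prop :=
  ∀ A ⊆ K, A.Nonempty → (∀ v ∈ A, ∀ w ∈ K, G.Adj v w → w ∈ A) → A = K

section

variable {G : SimpleGraph W} {K A M₁ M₂ : Finset W} {u z : W}

theorem core_subset (G : SimpleGraph W) (K : Finset W) : core G K ⊆ K := by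
  intro v hv
  rw [core, Finset.mem_biUnion] at hv
  obtain ⟨A, hA, hv⟩ := hv
  exact Finset.mem_powerset.1 (Finset.mem_filter.1 hA).1 hv

theorem subset_core (hA : A ⊆ K) (h : ∀ v ∈ A, 2 ≤ dg G A v) : A ⊆ core G K := fun _ hv =>
  Finset.mem_biUnion.2 ⟨A, Finset.mem_filter.2 ⟨Finset.mem_powerset.2 hA, h⟩, hv⟩

theorem two_le_dg_core {v : W} (hv : v ∈ core G K) : 2 ≤ dg G (core G K) v := by
  obtain ⟨A, hA, hvA⟩ := Finset.mem_biUnion.1 hv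
  rw [Finset.mem_filter, Finset.mem_powerset] at hA
  exact (hA.2 v hvA).trans (dg_mono G (subset_core hA.1 hA.2) v)

theorem core_mono (h : A ⊆ K) : core G A ⊆ core G K :=
  subset_core ((core_subset G A).trans h) fun _ => two_le_dg_core

theorem core_eq_self (h : ∀ v ∈ K, 2 ≤ dg G K v) : core G K = K :=
  (core_subset G K).antisymm (subset_core subset_rfl h)

theorem core_erase (hz : dg G K z ≤ 1) : core G (K.erase z) = core G K := by
  refine (core_mono (Finset.erase_subset _ _)).antisymm (subset_core ?_ fun _ => two_le_dg_core)
  intro v hv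
  refine Finset.mem_erase.2 ⟨?_, core_subset G K hv⟩
  rintro rfl
  have := two_le_dg_core hv
  have := dg_mono G (core_subset G K) v
  omega

theorem core_empty : core G (∅ : Finset W) = ∅ :=
  Finset.subset_empty.1 (core_subset G ∅)

theorem exists_split_of_not_conn (h : ¬ Conn G K) : ∃ M₁ M₂, K = M₁ ∪ M₂ ∧ Disjoint M₁ M₂ ∧
    M₁.Nonempty ∧ M₂.Nonempty ∧ ∀ a ∈ M₁, ∀ b ∈ M₂, ¬ G.Adj a b := by
  simp only [Conn, not_forall] at h
  obtain ⟨A, hA, hne, hcl, hAK⟩ := h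
  refine ⟨A, K \ A, (Finset.union_sdiff_of_subset hA).symm, Finset.disjoint_sdiff, hne, ?_, ?_⟩
  · rw [Finset.sdiff_nonempty]
    exact fun h => hAK (hA.antisymm h)
  · intro a ha b hb hab
    rw [Finset.mem_sdiff] at hb
    exact hb.2 (hcl a ha b hb.1 hab)

theorem Conn.erase (h : Conn G K) (hz : z ∈ K) (hd : dg G K z ≤ 1) : Conn G (K.erase z) := by
  intro A hA hne hcl
  have hzA : z ∉ A := fun h => (Finset.mem_erase.1 (hA h)).1 rfl
  have hAK : A ⊆ K := hA.trans (Finset.erase_subset _ _)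
  by_cases hadj : ∃ v ∈ A, G.Adj v z
  · obtain ⟨v, hv, hvz⟩ := hadj
    have : insert z A = K := by
      refine h _ (Finset.insert_subset hz hAK) (Finset.insert_nonempty _ _) ?_
      intro a ha w hw haw
      by_cases hwz : w = z
      · rw [hwz]; exact Finset.mem_insert_self _ _
      rcases Finset.mem_insert.1 ha with rfl | ha
      · have : w = v := by
          refine Finset.card_le_one.1 hd w ?_ v ?_
          · simp [hw, haw]
          · simp [hAK hv, hvz.symm]
        rw [this]
        exact Finset.mem_insert_of_mem hv
      · exact Finset.mem_insert_of_mem (hcl a ha w (Finset.mem_erase.2 ⟨hwz, hw⟩) haw)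
    rw [← this, Finset.erase_insert hzA]
  · push Not at hadj
    have : A = K := by
      refine h A hAK hne fun a ha w hw haw => ?_
      refine hcl a ha w (Finset.mem_erase.2 ⟨?_, hw⟩) haw
      rintro rfl
      exact hadj a ha haw
    exact absurd (this ▸ hz) hzA

theorem Conn.insert_part (h : Conn G (insert u (M₁ ∪ M₂))) (hu₁ : u ∉ M₁)
    (hd : Disjoint M₁ M₂) (hadj : ∀ a ∈ M₁, ∀ b ∈ M₂, ¬ G.Adj a b) : Conn G (insert u M₂) := by
  intro A hA hne hcl
  have hsub : insert u M₂ ⊆ insert u (M₁ ∪ M₂) :=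
    Finset.insert_subset_insert _ Finset.subset_union_right
  have hAM : ∀ a ∈ A, a ∉ M₁ := by
    intro a ha ha1
    rcases Finset.mem_insert.1 (hA ha) with rfl | h2
    · exact hu₁ ha1
    · exact Finset.disjoint_left.1 hd ha1 h2
  by_cases huA : u ∈ A
  · have : A ∪ M₁ = insert u (M₁ ∪ M₂) := by
      refine h _ (Finset.union_subset (hA.trans hsub)
        (Finset.subset_union_left.trans (Finset.subset_insert _ _)))
        (hne.mono Finset.subset_union_left) ?_
      intro a ha w hw haw
      simp only [Finset.mem_insert, Finset.mem_union] at hw ha ⊢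
      rcases hw with rfl | hw | hw
      · exact Or.inl huA
      · exact Or.inr hw
      · rcases ha with ha | ha
        · exact Or.inl (hcl a ha w (Finset.mem_insert_of_mem hw) haw)
        · exact absurd haw (hadj a ha w hw)
    refine hA.antisymm fun v hv => ?_
    have h1 := hsub hv
    rw [← this, Finset.mem_union] at h1
    refine h1.resolve_right fun hv1 => ?_
    rcases Finset.mem_insert.1 hv with rfl | h2
    · exact hu₁ hv1
    · exact Finset.disjoint_left.1 hd hv1 h2
  · have : A = insert u (M₁ ∪ M₂) := by
      refine h _ (hA.trans hsub) hne fun a ha w hw haw => ?_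
      have haM : a ∈ M₂ := by
        rcases Finset.mem_insert.1 (hA ha) with rfl | h2
        · exact absurd ha huA
        · exact h2
      refine hcl a ha w ?_ haw
      simp only [Finset.mem_insert, Finset.mem_union] at hw ⊢
      rcases hw with hw | hw | hw
      · exact Or.inl hw
      · exact absurd haw.symm (hadj w hw a haM)
      · exact Or.inr hw
    exact absurd (this ▸ Finset.mem_insert_self _ _) huA

theorem sum_dg_erase (hu : u ∈ K) : (∑ v ∈ K.erase u, dg G K v) =
    ∑ v ∈ K.erase u, dg G (K.erase u) v + dg G K u := by
  have h1 : K = K.erase u ∪ {u} := by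
    rw [Finset.union_comm, ← Finset.insert_eq, Finset.insert_erase hu]
  have h2 : Disjoint (K.erase u) {u} := by simp
  have h3 : ed G (K.erase u) K = ed G (K.erase u) (K.erase u) + ed G (K.erase u) {u} := by
    rw [← ed_union_right G h2, ← h1]
  rw [ed_comm G _ {u}] at h3
  have h4 : ed G {u} (K.erase u) = dg G K u := by simp [ed, dg_erase_self]
  rw [h4] at h3
  exact h3

/-- Passing to a nonempty core of a connected graph does not change the cyclomatic excess. -/
theorem Conn.sum_core (n : ℕ) : ∀ K : Finset W, K.card = n → Conn G K → (core G K).Nonempty →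
    ∑ v ∈ K, ((dg G K v : ℤ) - 2) = ∑ v ∈ core G K, ((dg G (core G K) v : ℤ) - 2) := by
  induction n with
  | zero =>
    intro K hK _ hne
    rw [Finset.card_eq_zero.1 hK, core_empty] at hne
    exact absurd hne Finset.not_nonempty_empty
  | succ n ih =>
    intro K hK hc hne
    by_cases hall : ∀ v ∈ K, 2 ≤ dg G K v
    · rw [core_eq_self hall]
    push Not at hall
    obtain ⟨z, hz, hdz⟩ := hall
    have hd1 : dg G K z ≤ 1 := by omega
    have hcore := core_erase hd1
    by_cases h0 : dg G K z = 0
    · have : {z} = K := by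
        refine hc {z} (by simpa using hz) (by simp) fun v hv w hw hvw => ?_
        rw [Finset.mem_singleton] at hv
        subst hv
        rw [dg, Finset.card_eq_zero] at h0
        have : w ∈ K.filter (G.Adj v) := by simp [hw, hvw]
        rw [h0] at this
        exact absurd this (Finset.notMem_empty _)
      rw [← hcore, ← this, Finset.erase_singleton, core_empty] at hne
      exact absurd hne Finset.not_nonempty_empty
    · have h1 := ih (K.erase z) (by rw [Finset.card_erase_of_mem hz, hK]; rfl) (hc.erase hz hd1)
        (by rwa [hcore])
      rw [hcore] at h1
      rw [← h1, ← Finset.add_sum_erase K _ hz]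
      have h2 := congrArg (Nat.cast : ℕ → ℤ) (sum_dg_erase (G := G) hz)
      push_cast at h2
      rw [Finset.sum_sub_distrib, Finset.sum_sub_distrib, h2]
      have : dg G K z = 1 := by omega
      rw [this]
      push_cast
      ring

end

/-! ### Vertex weights -/

/-- The weight of a vertex of given degree. -/
def wt : ℕ → ℝ
  | 0 => 0
  | 1 => 0
  | 2 => 0
  | 3 => 1 / 6
  | 4 => 1 / 3
  | 5 => 13 / 30
  | n + 6 => 23 / 45 + 7 / 90 * n

theorem wt_gain_seven_ninetieths {i j : ℕ} (hi : 2 ≤ i) (hij : i ≤ j) :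
    wt i + 7 / 90 * (j - i) ≤ wt j := by
  induction j, hij using Nat.le_induction with
  | base => simp
  | succ n hn ih =>
    have : wt n + 7 / 90 ≤ wt (n + 1) := by
      have h2 : 2 ≤ n := hi.trans hn
      match n, h2 with
      | 2, _ => norm_num [wt]
      | 3, _ => norm_num [wt]
      | 4, _ => norm_num [wt]
      | 5, _ => norm_num [wt]
      | n + 6, _ =>
        have : wt (n + 6 + 1) = 23 / 45 + 7 / 90 * ((n + 1 : ℕ) : ℝ) := rfl
        rw [this, wt]
        push_cast
        linarith
    push_cast
    linarith

theorem wt_mono : Monotone wt := by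
  intro i j hij
  rcases Nat.lt_or_ge j 3 with hj | hj
  · have h1 : wt i = 0 := by
      have : i < 3 := lt_of_le_of_lt hij hj
      interval_cases i <;> rfl
    have h2 : wt j = 0 := by interval_cases j <;> rfl
    rw [h1, h2]
  · rcases Nat.lt_or_ge i 2 with hi | hi
    · have h1 : wt i = wt 2 := by interval_cases i <;> rfl
      rw [h1]
      have := wt_gain_seven_ninetieths le_rfl (by omega : 2 ≤ j)
      have h3 : ((2 : ℕ) : ℝ) ≤ j := Nat.cast_le.2 (by omega)
      have h4 := mul_nonneg (by norm_num : (0 : ℝ) ≤ 7 / 90) (sub_nonneg.2 h3)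
      exact (le_add_of_nonneg_right h4).trans this
    · have := wt_gain_seven_ninetieths hi hij
      have h3 : (i : ℝ) ≤ j := Nat.cast_le.2 hij
      linarith

theorem wt_nonneg (i : ℕ) : 0 ≤ wt i := wt_mono (Nat.zero_le i)

theorem wt_gain_sixth {i j : ℕ} (hi : 2 ≤ i) (hij : i ≤ j) (hj : j ≤ 4) :
    1 / 6 * ((j : ℝ) - i) ≤ wt j - wt i := by
  have := hij.trans hj
  interval_cases i <;> interval_cases j <;> norm_num [wt]

theorem wt_gain_tenth {i j : ℕ} (hi : 2 ≤ i) (hij : i ≤ j) (hj : j ≤ 5) :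
    1 / 10 * ((j : ℝ) - i) ≤ wt j - wt i := by
  have := hij.trans hj
  interval_cases i <;> interval_cases j <;> norm_num [wt]

theorem wt_bonus_five {i j : ℕ} (hi : 2 ≤ i) (hij : i < j) (hj : j ≤ 5)
    (h : ¬ (j = 5 ∧ i + 1 = 5)) : 1 / 10 * ((j : ℝ) - i) + 1 / 15 ≤ wt j - wt i := by
  have := hij.trans_le hj
  interval_cases i <;> interval_cases j <;> first | omega | norm_num [wt]

theorem wt_bonus_six {i j : ℕ} (hi : 2 ≤ i) (hij : i < j) (hj : j ≤ 6)
    (h : ¬ (j = 6 ∧ i + 1 = 6)) : 7 / 90 * ((j : ℝ) - i) + 1 / 45 ≤ wt j - wt i := by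
  have := hij.trans_le hj
  interval_cases i <;> interval_cases j <;> first | omega | norm_num [wt]

theorem wt_rate_five {j : ℕ} (hi : 2 ≤ j) (hj : j ≤ 5) :
    13 / 90 * ((j : ℝ) - 2) ≤ wt j := by
  interval_cases j <;> norm_num [wt]

theorem wt_rate_six {j : ℕ} (hi : 2 ≤ j) (hj : j ≤ 6) :
    23 / 180 * ((j : ℝ) - 2) ≤ wt j := by
  interval_cases j <;> norm_num [wt]

theorem wt_large {d : ℕ} (h : 7 ≤ d) : 1 + 1 / 15 ≤ wt d + 7 / 90 * d := by
  obtain ⟨n, rfl⟩ := Nat.exists_eq_add_of_le' h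
  have : wt (n + 7) = 23 / 45 + 7 / 90 * ((n + 1 : ℕ) : ℝ) := rfl
  rw [this]
  push_cast
  have : (0 : ℝ) ≤ n := Nat.cast_nonneg n
  linarith

theorem wt_le_of_le_two_mul {d e : ℕ} (h : d ≤ 2 * e) : wt d ≤ 23 / 135 * e := by
  have hcast : ∀ c : ℕ, c ≤ e → (c : ℝ) ≤ e := fun c hc => by exact_mod_cast hc
  match d, h with
  | 0, _ | 1, _ | 2, _ => simp only [wt]; positivity
  | 3, h =>
    have := hcast 2 (by omega)
    push_cast at this
    rw [wt]
    linarith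
  | 4, h =>
    have := hcast 2 (by omega)
    push_cast at this
    rw [wt]
    linarith
  | 5, h =>
    have := hcast 3 (by omega)
    push_cast at this
    rw [wt]
    linarith
  | n + 6, h =>
    have h1 : (n : ℝ) + 6 ≤ 2 * e := by exact_mod_cast h
    have : (0 : ℝ) ≤ n := Nat.cast_nonneg n
    rw [wt]
    linarith

/-! ### The potential -/

/-- Maximum degree. -/
def mx (G : SimpleGraph W) (Y : Finset W) : ℕ := Y.sup (dg G Y)

/-- Total weight. -/
def mu (G : SimpleGraph W) (Y : Finset W) : ℝ := ∑ v ∈ Y, wt (dg G Y v)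

/-- All degrees are two or maximum. -/
def Flat (G : SimpleGraph W) (Y : Finset W) : Prop := ∀ v ∈ Y, dg G Y v = 2 ∨ dg G Y v = mx G Y

/-- The surcharge for flat graphs of given maximum degree. -/
def theta (d : ℕ) : ℝ := if d = 5 then 1 / 15 else if d = 6 then 1 / 45 else 0

/-- The surcharge of `Y`. -/
def surcharge (G : SimpleGraph W) (Y : Finset W) : ℝ := if Flat G Y then theta (mx G Y) else 0

/-- The potential bounding the cost of sweeping a connected graph with core `Y`. -/
def pot (G : SimpleGraph W) (Y : Finset W) : ℝ :=
  mu G Y + (min (mx G Y) 7 : ℕ) + surcharge G Y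

section

variable {G : SimpleGraph W} {K Y : Finset W} {u : W}

theorem theta_nonneg (d : ℕ) : 0 ≤ theta d := by
  rw [theta]; split_ifs <;> norm_num

theorem theta_le (d : ℕ) : theta d ≤ 1 / 15 := by
  rw [theta]; split_ifs <;> norm_num

theorem surcharge_nonneg : 0 ≤ surcharge G Y := by
  rw [surcharge]; split_ifs
  · exact theta_nonneg _
  · exact le_rfl

theorem surcharge_le_theta : surcharge G Y ≤ theta (mx G Y) := by
  rw [surcharge]; split_ifs
  · exact le_rfl
  · exact theta_nonneg _

theorem mu_mono (h : Y ⊆ K) : mu G Y ≤ mu G K :=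
  (Finset.sum_le_sum fun v _ => wt_mono (dg_mono G h v)).trans
    (Finset.sum_le_sum_of_subset_of_nonneg h fun _ _ _ => wt_nonneg _)

theorem mu_nonneg : 0 ≤ mu G Y := Finset.sum_nonneg fun _ _ => wt_nonneg _

theorem pot_nonneg : 0 ≤ pot G Y := by
  have h1 := mu_nonneg (G := G) (Y := Y)
  have h2 := surcharge_nonneg (G := G) (Y := Y)
  have h3 : (0 : ℝ) ≤ (min (mx G Y) 7 : ℕ) := Nat.cast_nonneg _
  rw [pot]
  linarith

theorem dg_le_mx {v : W} (hv : v ∈ Y) : dg G Y v ≤ mx G Y := Finset.le_sup (f := dg G Y) hv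

theorem mx_mono (h : Y ⊆ K) : mx G Y ≤ mx G K :=
  Finset.sup_le fun v hv => (dg_mono G h v).trans (dg_le_mx (h hv))

theorem exists_dg_eq_mx (h : 0 < mx G K) : ∃ u ∈ K, dg G K u = mx G K := by
  have hne : K.Nonempty := by
    rw [Finset.nonempty_iff_ne_empty]
    rintro rfl
    simp [mx] at h
  obtain ⟨u, hu, h1⟩ := Finset.exists_mem_eq_sup K hne (dg G K)
  exact ⟨u, hu, h1.symm⟩

/-- Degree in `Y`, with the neutral value two outside `Y`. -/
def dgTwo (G : SimpleGraph W) (Y : Finset W) (v : W) : ℕ := if v ∈ Y then dg G Y v else 2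

theorem sum_dgTwo (hu : u ∈ K) (hc : Conn G (K.erase u)) (hne : (core G (K.erase u)).Nonempty) :
    ∑ v ∈ K.erase u, ((dg G K v : ℝ) - dgTwo G (core G (K.erase u)) v) = dg G K u := by
  set Y := core G (K.erase u) with hY
  have h1 := hc.sum_core _ _ rfl hne
  rw [← hY] at h1
  have h2 := congrArg (Nat.cast : ℕ → ℤ) (sum_dg_erase (G := G) hu)
  have h3 : ∑ v ∈ K.erase u, ((dgTwo G Y v : ℤ) - 2) = ∑ v ∈ Y, ((dg G Y v : ℤ) - 2) := by
    rw [← Finset.sum_subset (core_subset G (K.erase u))]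
    · refine Finset.sum_congr rfl fun v hv => ?_
      rw [dgTwo, if_pos hv]
    · intro v _ hv
      rw [dgTwo, if_neg hv]
      rfl
  push_cast at h2
  have h4 : ∑ v ∈ K.erase u, ((dg G K v : ℤ) - dgTwo G Y v) = dg G K u := by
    rw [← h1, Finset.sum_sub_distrib, Finset.sum_sub_distrib] at h3
    rw [Finset.sum_sub_distrib]
    linarith
  exact_mod_cast h4

theorem mu_sub_mu (hu : u ∈ K) (hY : Y ⊆ K.erase u) : mu G K - mu G Y =
    wt (dg G K u) + ∑ v ∈ K.erase u, (wt (dg G K v) - wt (dgTwo G Y v)) := by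
  have h1 : mu G Y = ∑ v ∈ K.erase u, wt (dgTwo G Y v) := by
    rw [mu, ← Finset.sum_subset hY]
    · refine Finset.sum_congr rfl fun v hv => ?_
      rw [dgTwo, if_pos hv]
    · intro v _ hv
      rw [dgTwo, if_neg hv]
      rfl
  rw [h1, Finset.sum_sub_distrib, mu, ← Finset.add_sum_erase K _ hu]
  ring

theorem dgTwo_bounds (hK : ∀ v ∈ K, 2 ≤ dg G K v) {v : W} (hv : v ∈ K.erase u) :
    2 ≤ dgTwo G (core G (K.erase u)) v ∧ dgTwo G (core G (K.erase u)) v ≤ dg G K v := by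
  rw [dgTwo]
  split_ifs with h
  · exact ⟨two_le_dg_core h, dg_mono G ((core_subset G _).trans (Finset.erase_subset _ _)) v⟩
  · exact ⟨le_rfl, hK v (Finset.mem_of_mem_erase hv)⟩

theorem pot_core_erase (hK : ∀ v ∈ K, 2 ≤ dg G K v) (hu : u ∈ K) (hd : dg G K u = mx G K)
    (h4 : 4 ≤ mx G K) (hc : Conn G (K.erase u)) :
    pot G (core G (K.erase u)) + 1 ≤ pot G K ∨ (¬ Flat G K ∧ ∀ v ∈ K.erase u,
      dgTwo G (core G (K.erase u)) v < dg G K v →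
        dg G K v = mx G K ∧ dgTwo G (core G (K.erase u)) v + 1 = mx G K) := by
  set Y := core G (K.erase u) with hYdef
  set d := mx G K with hddef
  have hYC : Y ⊆ K.erase u := core_subset G _
  have hYK : Y ⊆ K := hYC.trans (Finset.erase_subset _ _)
  have hsK := surcharge_nonneg (G := G) (Y := K)
  have hsY := surcharge_le_theta (G := G) (Y := Y)
  have hmxY : mx G Y ≤ d := mx_mono hYK
  have hmu := mu_sub_mu (G := G) hu hYC
  rw [hd] at hmu
  have hb := fun v hv => dgTwo_bounds (u := u) hK (v := v) hv
  have hle : ∀ v ∈ K.erase u, dg G K v ≤ d := fun v hv => dg_le_mx (Finset.mem_of_mem_erase hv)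
  have hstage : ((min (mx G Y) 7 : ℕ) : ℝ) ≤ (min d 7 : ℕ) :=
    Nat.cast_le.2 (min_le_min_right 7 hmxY)
  have hsum0 : 0 ≤ ∑ v ∈ K.erase u, (wt (dg G K v) - wt (dgTwo G Y v)) :=
    Finset.sum_nonneg fun v hv => sub_nonneg.2 (wt_mono (hb v hv).2)
  have hwt4 : 1 / 3 ≤ wt d := by
    have : wt 4 = 1 / 3 := rfl
    rw [← this]
    exact wt_mono h4
  rcases Finset.eq_empty_or_nonempty Y with hY0 | hne
  · left
    have h1 : (4 : ℝ) ≤ (min d 7 : ℕ) := by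
      exact_mod_cast (by omega : 4 ≤ min d 7)
    have h2 : mx G (∅ : Finset W) = 0 := by simp [mx]
    have h3 : pot G Y = 0 := by
      rw [hY0, pot, h2, surcharge, h2]
      simp [mu, theta]
    have h5 := mu_nonneg (G := G) (Y := K)
    rw [h3, pot]
    linarith
  have hcount := sum_dgTwo hu hc hne
  rw [← hYdef, hd] at hcount
  have hrate : ∀ c : ℝ, (∀ v ∈ K.erase u, c * ((dg G K v : ℝ) - dgTwo G Y v) ≤
      wt (dg G K v) - wt (dgTwo G Y v)) →
      c * d ≤ ∑ v ∈ K.erase u, (wt (dg G K v) - wt (dgTwo G Y v)) := by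
    intro c h
    rw [← hcount, Finset.mul_sum]
    exact Finset.sum_le_sum h
  have hbonus : ∀ c t : ℝ, (∀ v ∈ K.erase u, c * ((dg G K v : ℝ) - dgTwo G Y v) ≤
      wt (dg G K v) - wt (dgTwo G Y v)) → (∃ v ∈ K.erase u,
      c * ((dg G K v : ℝ) - dgTwo G Y v) + t ≤ wt (dg G K v) - wt (dgTwo G Y v)) →
      c * d + t ≤ ∑ v ∈ K.erase u, (wt (dg G K v) - wt (dgTwo G Y v)) := by
    rintro c t h ⟨v, hv, h1⟩
    rw [← hcount, Finset.mul_sum, ← Finset.add_sum_erase _ _ hv, ← Finset.add_sum_erase _ _ hv]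
    have := Finset.sum_le_sum fun w (hw : w ∈ (K.erase u).erase v) =>
      h w (Finset.mem_of_mem_erase hw)
    linarith
  have hseven : ∀ v ∈ K.erase u, 7 / 90 * ((dg G K v : ℝ) - dgTwo G Y v) ≤
      wt (dg G K v) - wt (dgTwo G Y v) := by
    intro v hv
    have := wt_gain_seven_ninetieths (hb v hv).1 (hb v hv).2
    linarith
  have hflatY : mx G Y = d → Flat G Y → ∀ v ∈ K.erase u, dgTwo G Y v = dg G K v ∨
      dgTwo G Y v = 2 := by
    intro hmd hfl v hv
    by_cases hvY : v ∈ Y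
    · rcases hfl v hvY with h1 | h1
      · right; rw [dgTwo, if_pos hvY, h1]
      · left
        have h2 := dg_mono G hYK v
        have h3 := hle v hv
        rw [dgTwo, if_pos hvY]
        omega
    · right; rw [dgTwo, if_neg hvY]
  have hsurY := theta_le (mx G Y)
  by_cases h7 : 7 ≤ d
  · left
    have h1 := wt_large h7
    have h2 := hrate _ hseven
    rw [pot, pot]
    linarith
  by_cases hlt : mx G Y < d
  · left
    have h1 : ((min (mx G Y) 7 : ℕ) : ℝ) + 1 ≤ (min d 7 : ℕ) := by
      exact_mod_cast (by omega : min (mx G Y) 7 + 1 ≤ min d 7)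
    rw [pot, pot]
    linarith
  have hmd : mx G Y = d := by omega
  have hflat_rate : ∀ c : ℝ, (∀ j : ℕ, 2 ≤ j → j ≤ d → c * ((j : ℝ) - 2) ≤ wt j) → Flat G Y →
      c * d ≤ ∑ v ∈ K.erase u, (wt (dg G K v) - wt (dgTwo G Y v)) := by
    intro c h hfl
    refine hrate c fun v hv => ?_
    rcases hflatY hmd hfl v hv with h1 | h1
    · rw [h1]; simp
    · rw [h1]
      have h2 := h (dg G K v) (hK v (Finset.mem_of_mem_erase hv)) (hle v hv)
      have h3 : wt 2 = 0 := rfl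
      rw [h3]
      push_cast
      linarith
  have hd456 : d = 4 ∨ d = 5 ∨ d = 6 := by omega
  have finish : ∀ c t : ℝ, t = theta d → (1 - t = wt d + c * d) →
      (∀ v ∈ K.erase u, c * ((dg G K v : ℝ) - dgTwo G Y v) ≤ wt (dg G K v) - wt (dgTwo G Y v)) →
      (∀ v ∈ K.erase u, dgTwo G Y v < dg G K v →
        ¬ (dg G K v = d ∧ dgTwo G Y v + 1 = d) →
        c * ((dg G K v : ℝ) - dgTwo G Y v) + t ≤ wt (dg G K v) - wt (dgTwo G Y v)) →
      (Flat G Y → 1 + t ≤ wt d +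
        ∑ v ∈ K.erase u, (wt (dg G K v) - wt (dgTwo G Y v))) →
      pot G Y + 1 ≤ pot G K ∨ (¬ Flat G K ∧ ∀ v ∈ K.erase u, dgTwo G Y v < dg G K v →
        dg G K v = d ∧ dgTwo G Y v + 1 = d) := by
    intro c t ht hct h1 h2 h3
    by_cases hfY : Flat G Y
    · left
      have := h3 hfY
      rw [hmd, ← ht] at hsY
      rw [pot, pot]
      linarith
    have hs0 : surcharge G Y = 0 := if_neg hfY
    have h5 := hrate c h1
    by_cases hfK : Flat G K
    · left
      have hs1 : surcharge G K = t := by rw [surcharge, if_pos hfK, ht]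
      rw [pot, pot, hs0, hs1]
      linarith
    by_cases hbon : ∀ v ∈ K.erase u, dgTwo G Y v < dg G K v →
        dg G K v = d ∧ dgTwo G Y v + 1 = d
    · exact Or.inr ⟨hfK, hbon⟩
    · left
      push Not at hbon
      obtain ⟨v, hv, hv1, hv2⟩ := hbon
      have h6 := hbonus c t h1 ⟨v, hv, h2 v hv hv1 fun h => hv2 h.1 h.2⟩
      rw [pot, pot, hs0]
      linarith
  rcases hd456 with h | h | h
  · left
    have h1 := hrate (1 / 6) fun v hv =>
      wt_gain_sixth (hb v hv).1 (hb v hv).2 ((hle v hv).trans h.le)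
    have h2 : theta (mx G Y) = 0 := by rw [hmd, h]; norm_num [theta]
    have h3 : wt d = 1 / 3 := by rw [h]; rfl
    have h5 : (d : ℝ) = 4 := by rw [h]; norm_num
    rw [h5] at h1
    rw [pot, pot]
    linarith
  · have h3 : wt d = 13 / 30 := by rw [h]; rfl
    have h5 : (d : ℝ) = 5 := by rw [h]; norm_num
    refine finish (1 / 10) (1 / 15) (by rw [h]; norm_num [theta]) (by rw [h3, h5]; norm_num)
      (fun v hv => wt_gain_tenth (hb v hv).1 (hb v hv).2 ((hle v hv).trans h.le))
      (fun v hv hlt' hn => wt_bonus_five (hb v hv).1 hlt' ((hle v hv).trans h.le) (by rwa [h] at hn))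
      fun hfl => ?_
    have := hflat_rate (13 / 90) (fun j hj hjd => wt_rate_five hj (hjd.trans h.le)) hfl
    rw [h5] at this
    rw [h3]
    linarith
  · have h3 : wt d = 23 / 45 := by rw [h]; norm_num [wt]
    have h5 : (d : ℝ) = 6 := by rw [h]; norm_num
    refine finish (7 / 90) (1 / 45) (by rw [h]; norm_num [theta]) (by rw [h3, h5]; norm_num)
      hseven
      (fun v hv hlt' hn => wt_bonus_six (hb v hv).1 hlt' ((hle v hv).trans h.le) (by rwa [h] at hn))
      fun hfl => ?_
    have := hflat_rate (23 / 180) (fun j hj hjd => wt_rate_six hj (hjd.trans h.le)) hfl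
    rw [h5] at this
    rw [h3]
    linarith

end

section

variable {G : SimpleGraph W} {K Y M₁ M₂ : Finset W} {u : W}

theorem exists_pot_drop (hK : ∀ v ∈ K, 2 ≤ dg G K v) (hconn : Conn G K) (h4 : 4 ≤ mx G K)
    (hc : ∀ u ∈ K, dg G K u = mx G K → Conn G (K.erase u)) :
    ∃ u ∈ K, dg G K u = mx G K ∧ pot G (core G (K.erase u)) + 1 ≤ pot G K := by
  by_contra hcon
  push Not at hcon
  have hall := fun u hu hd =>
    (pot_core_erase (u := u) hK hu hd h4 (hc u hu hd)).resolve_left (not_le.2 (hcon u hu hd))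
  obtain ⟨u₀, hu₀, hd₀⟩ := exists_dg_eq_mx (G := G) (K := K) (by omega)
  -- a vertex losing a neighbour either leaves the core or has maximum degree
  have hlose : ∀ u ∈ K, dg G K u = mx G K → ∀ v, v ∉ core G (K.erase u) → ∀ w ∈ K.erase u,
      v ∈ K → G.Adj v w → w ∈ core G (K.erase u) → dg G K w = mx G K := by
    intro u hu hd v hv w hw hvK hvw hwY
    refine ((hall u hu hd).2 w hw ?_).1
    rw [dgTwo, if_pos hwY]
    have h1 : core G (K.erase u) ⊆ K.erase v := fun y hy => Finset.mem_erase.2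
      ⟨fun h => hv (h ▸ hy), Finset.mem_of_mem_erase (core_subset G _ hy)⟩
    refine (dg_mono G h1 w).trans_lt ?_
    refine Finset.card_lt_card ⟨Finset.filter_subset_filter _ (Finset.erase_subset _ _), ?_⟩
    intro h2
    have h5 : v ∈ K.filter (G.Adj w) := by simp [hvK, hvw.symm]
    simpa using h2 h5
  have hZ : K.filter (fun v => dg G K v = mx G K ∨ ∃ u ∈ K, dg G K u = mx G K ∧ v ∈ K.erase u ∧
      v ∉ core G (K.erase u)) = K := by
    refine hconn _ (Finset.filter_subset _ _) ⟨u₀, by simp [hu₀, hd₀]⟩ ?_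
    intro v hv w hw hvw
    rw [Finset.mem_filter] at hv ⊢
    refine ⟨hw, ?_⟩
    obtain ⟨hvK, hv | ⟨u, hu, hd, hvC, hvY⟩⟩ := hv
    · have hwC : w ∈ K.erase v := Finset.mem_erase.2 ⟨hvw.ne', hw⟩
      by_cases hwY : w ∈ core G (K.erase v)
      · refine Or.inl (hlose v hvK hv v ?_ w hwC hvK hvw hwY)
        exact fun h => (Finset.mem_erase.1 (core_subset G _ h)).1 rfl
      · exact Or.inr ⟨v, hvK, hv, hwC, hwY⟩
    · by_cases hwu : w = u
      · left; rw [hwu]; exact hd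
      have hwC : w ∈ K.erase u := Finset.mem_erase.2 ⟨hwu, hw⟩
      by_cases hwY : w ∈ core G (K.erase u)
      · exact Or.inl (hlose u hu hd v hvY w hwC hvK hvw hwY)
      · exact Or.inr ⟨u, hu, hd, hwC, hwY⟩
  refine (hall u₀ hu₀ hd₀).1 fun v hv => ?_
  rw [← hZ, Finset.mem_filter] at hv
  obtain ⟨hvK, hv | ⟨u, hu, hd, hvC, hvY⟩⟩ := hv
  · exact Or.inr hv
  · have h1 := (hall u hu hd).2 v hvC
    rw [dgTwo, if_neg hvY] at h1
    have h2 := hK v hvK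
    by_cases h3 : dg G K v = 2
    · exact Or.inl h3
    · exact Or.inr (h1 (by omega)).1

theorem pot_core_insert_le (hK : K = insert u (M₁ ∪ M₂)) (hconn : Conn G K) (hd : Disjoint M₁ M₂)
    (hu₁ : u ∉ M₁) (hadj : ∀ a ∈ M₁, ∀ b ∈ M₂, ¬ G.Adj a b) (hne : M₁.Nonempty)
    (hdu : dg G K u = mx G K) (h4 : 4 ≤ mx G K) :
    pot G (core G (insert u M₂)) ≤ pot G K := by
  have hsub : insert u M₂ ⊆ K := by
    rw [hK]; exact Finset.insert_subset_insert _ Finset.subset_union_right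
  have huK : u ∈ K := hsub (Finset.mem_insert_self _ _)
  have hM₁K : M₁ ⊆ K := by
    rw [hK]; exact Finset.subset_union_left.trans (Finset.subset_insert _ _)
  have hlose : dg G (insert u M₂) u < dg G K u := by
    by_contra hcon
    have hno : ∀ a ∈ M₁, ¬ G.Adj u a := by
      intro a ha hua
      refine hcon (Finset.card_lt_card ⟨Finset.filter_subset_filter _ hsub, fun h => ?_⟩)
      have h1 : a ∈ K.filter (G.Adj u) := Finset.mem_filter.2 ⟨hM₁K ha, hua⟩
      rcases Finset.mem_insert.1 (Finset.mem_filter.1 (h h1)).1 with rfl | h2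
      · exact hu₁ ha
      · exact Finset.disjoint_left.1 hd ha h2
    have : M₁ = K := by
      refine hconn M₁ hM₁K hne fun a ha w hw haw => ?_
      rw [hK, Finset.mem_insert, Finset.mem_union] at hw
      rcases hw with rfl | hw | hw
      · exact absurd haw.symm (hno a ha)
      · exact hw
      · exact absurd haw (hadj a ha w hw)
    exact hu₁ (this ▸ huK)
  set Y := core G (insert u M₂) with hY
  have hYK : Y ⊆ K := (core_subset G _).trans hsub
  have hmu := mu_mono (G := G) hYK
  have hmx := mx_mono (G := G) hYK
  have hsK := surcharge_nonneg (G := G) (Y := K)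
  have hsY := surcharge_le_theta (G := G) (Y := Y)
  have ht := theta_le (mx G Y)
  have hstage : ((min (mx G Y) 7 : ℕ) : ℝ) ≤ (min (mx G K) 7 : ℕ) :=
    Nat.cast_le.2 (min_le_min_right 7 hmx)
  rw [pot, pot]
  by_cases h7 : 7 ≤ mx G Y
  · have : theta (mx G Y) = 0 := by
      rw [theta, if_neg (by omega), if_neg (by omega)]
    linarith
  by_cases hlt : mx G Y < mx G K
  · have h1 : ((min (mx G Y) 7 : ℕ) : ℝ) + 1 ≤ (min (mx G K) 7 : ℕ) := by
      exact_mod_cast (by omega : min (mx G Y) 7 + 1 ≤ min (mx G K) 7)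
    linarith
  have hmd : mx G Y = mx G K := by omega
  by_cases hfl : Flat G Y
  · have hwtu : (if u ∈ Y then wt (dg G Y u) else 0) = 0 := by
      split_ifs with huY
      · have h1 := dg_mono G (core_subset G (insert u M₂)) u
        rw [← hY] at h1
        rcases hfl u huY with h2 | h2
        · rw [h2]; rfl
        · omega
      · rfl
    have h1 : mu G Y ≤ mu G K - wt (dg G K u) := by
      have e1 : mu G Y = (if u ∈ Y then wt (dg G Y u) else 0) +
          ∑ v ∈ Y.erase u, wt (dg G Y v) := by
        split_ifs with huY
        · exact (Finset.add_sum_erase Y (fun v => wt (dg G Y v)) huY).symm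
        · rw [Finset.erase_eq_of_notMem huY, zero_add, mu]
      have e2 : mu G K = wt (dg G K u) + ∑ v ∈ K.erase u, wt (dg G K v) :=
        (Finset.add_sum_erase K (fun v => wt (dg G K v)) huK).symm
      have e3 : ∑ v ∈ Y.erase u, wt (dg G Y v) ≤ ∑ v ∈ K.erase u, wt (dg G K v) :=
        (Finset.sum_le_sum fun v _ => wt_mono (dg_mono G hYK v)).trans
          (Finset.sum_le_sum_of_subset_of_nonneg (Finset.erase_subset_erase _ hYK)
            fun _ _ _ => wt_nonneg _)
      rw [e1, e2, hwtu]
      linarith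
    have h2 : 1 / 3 ≤ wt (dg G K u) := by
      have : wt 4 = 1 / 3 := rfl
      rw [← this, hdu]
      exact wt_mono h4
    linarith
  · have : surcharge G Y = 0 := if_neg hfl
    linarith

theorem mu_eq_of_degree_le_three (h3 : ∀ v ∈ K, dg G K v ≤ 3) :
    mu G K = (n3 G K K : ℝ) / 6 := by
  rw [mu, n3, Finset.card_filter]
  push_cast
  rw [Finset.sum_div]
  refine Finset.sum_congr rfl fun v hv => ?_
  have := h3 v hv
  interval_cases dg G K v <;> norm_num [wt]

/-- The bound for arbitrary, not necessarily connected, subsets. -/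
def weakPot (G : SimpleGraph W) (Y : Finset W) : ℝ := mu G Y + (min (mx G Y) 7 : ℕ) + 1

theorem weakPot_mono (h : Y ⊆ K) : weakPot G Y ≤ weakPot G K := by
  have h1 := mu_mono (G := G) h
  have h2 : ((min (mx G Y) 7 : ℕ) : ℝ) ≤ (min (mx G K) 7 : ℕ) :=
    Nat.cast_le.2 (min_le_min_right 7 (mx_mono h))
  rw [weakPot, weakPot]
  linarith

theorem pot_le_weakPot : pot G Y ≤ weakPot G Y := by
  have h1 := surcharge_le_theta (G := G) (Y := Y)
  have h2 := theta_le (mx G Y)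
  rw [pot, weakPot]
  linarith

theorem weakPot_le_pot : weakPot G Y ≤ pot G Y + 3 := by
  have h1 := surcharge_nonneg (G := G) (Y := Y)
  rw [pot, weakPot]
  linarith

theorem good_of_base {L : ℕ} {S E : ℝ} (hL : 0 < L) (hE : 0 ≤ E) (hS : E + 2 * L ≤ S)
    (hbase : ∀ K, (∀ v ∈ K, dg G K v ≤ 3) → Sweepable G K ((n3 G K K : ℝ) / 6 + E)) (n : ℕ) :
    ∀ K : Finset W, K.card ≤ n → (Conn G K → Good G L S K (pot G (core G K))) ∧
      Good G L S K (weakPot G (core G K)) := by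
  have hL0 : (0 : ℝ) ≤ L := Nat.cast_nonneg L
  have hLS : (L : ℝ) ≤ S := by linarith
  have h2LS : 2 * (L : ℝ) ≤ S := by linarith
  induction n with
  | zero =>
    intro K hK
    have h0 : ∀ x : ℝ, 0 ≤ x → Good G L S K x := fun x hx =>
      Good.of_card_le_two h2LS hx (by omega)
    exact ⟨fun _ => h0 _ pot_nonneg, h0 _ (pot_nonneg.trans pot_le_weakPot)⟩
  | succ n ih =>
    intro K hKn
    have hweak : ∀ A Y : Finset W, A.card < K.card → A ⊆ Y →
        Good G L S A (weakPot G (core G Y)) := fun A Y hA hAY =>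
      (ih A (by omega)).2.mono (weakPot_mono (core_mono hAY))
    suffices hs : Conn G K → Good G L S K (pot G (core G K)) by
      refine ⟨hs, ?_⟩
      by_cases hconn : Conn G K
      · exact (hs hconn).mono pot_le_weakPot
      · obtain ⟨M₁, M₂, rfl, hd, hne₁, hne₂, hadj⟩ := exists_split_of_not_conn hconn
        have hcard := Finset.card_union_of_disjoint hd
        have h1 := hne₁.card_pos
        have h2 := hne₂.card_pos
        exact Good.union hd hadj (hweak M₁ _ (by omega) Finset.subset_union_left)
          (hweak M₂ _ (by omega) Finset.subset_union_right)
    intro hconn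
    by_cases hcard2 : K.card ≤ 2
    · exact Good.of_card_le_two h2LS pot_nonneg hcard2
    by_cases hall : ∀ v ∈ K, 2 ≤ dg G K v
    · rw [core_eq_self hall]
      by_cases h3 : mx G K ≤ 3
      · have hdeg : ∀ v ∈ K, dg G K v ≤ 3 := fun v hv => (dg_le_mx hv).trans h3
        have h1 := hbase K hdeg
        rw [← mu_eq_of_degree_le_three hdeg] at h1
        refine (Good.of_sweepable (x := mu G K) (by linarith) h1).mono ?_
        have h2 := surcharge_nonneg (G := G) (Y := K)
        have h4 : (0 : ℝ) ≤ (min (mx G K) 7 : ℕ) := Nat.cast_nonneg _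
        rw [pot]
        linarith
      by_cases hc : ∀ u ∈ K, dg G K u = mx G K → Conn G (K.erase u)
      · obtain ⟨u, hu, hdu, hpot⟩ := exists_pot_drop hall hconn (by omega) hc
        have h1 := (ih (K.erase u) (by rw [Finset.card_erase_of_mem hu]; omega)).1 (hc u hu hdu)
        exact (h1.of_erase hLS pot_nonneg hu).mono hpot
      · push Not at hc
        obtain ⟨u, hu, hdu, hcu⟩ := hc
        obtain ⟨M₁, M₂, hM, hd, hne₁, hne₂, hadj⟩ := exists_split_of_not_conn hcu
        have hK : K = insert u (M₁ ∪ M₂) := by rw [← hM, Finset.insert_erase hu]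
        have hu12 : u ∉ M₁ ∪ M₂ := by rw [← hM]; exact Finset.notMem_erase _ _
        rw [Finset.mem_union, not_or] at hu12
        have hadj' : ∀ a ∈ M₂, ∀ b ∈ M₁, ¬ G.Adj a b := fun a ha b hb h => hadj b hb a ha h.symm
        have hK' : K = insert u (M₂ ∪ M₁) := by rw [hK, Finset.union_comm]
        have hcard : K.card = M₁.card + M₂.card + 1 := by
          rw [hK, Finset.card_insert_of_notMem (by simp [hu12]), Finset.card_union_of_disjoint hd]
        have p1 := hne₁.card_pos
        have p2 := hne₂.card_pos
        have hi1 := Finset.card_insert_of_notMem hu12.1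
        have hi2 := Finset.card_insert_of_notMem hu12.2
        have hs1 : M₁ ⊆ K := by
          rw [hK]; exact Finset.subset_union_left.trans (Finset.subset_insert _ _)
        have hs2 : M₂ ⊆ K := by
          rw [hK]; exact Finset.subset_union_right.trans (Finset.subset_insert _ _)
        have c1 : Conn G (insert u M₁) := (hK' ▸ hconn).insert_part hu12.2 hd.symm hadj'
        have c2 : Conn G (insert u M₂) := (hK ▸ hconn).insert_part hu12.1 hd hadj
        have g1 := ((ih (insert u M₁) (by omega)).1 c1).mono
          (pot_core_insert_le hK' hconn hd.symm hu12.2 hadj' hne₂ hdu (by omega))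
        have g2 := ((ih (insert u M₂) (by omega)).1 c2).mono
          (pot_core_insert_le hK hconn hd hu12.1 hadj hne₁ hdu (by omega))
        have w1 := (hweak M₁ K (by omega) hs1).mono weakPot_le_pot
        have w2 := (hweak M₂ K (by omega) hs2).mono weakPot_le_pot
        rw [core_eq_self hall] at w1 w2
        have := Good.of_cut_vertex hL hLS pot_nonneg hd hu12.1 hu12.2 hadj g1 g2 w1 w2
        rwa [← hK] at this
    · push Not at hall
      obtain ⟨z, hz, hdz⟩ := hall
      have hd1 : dg G K z ≤ 1 := by omega
      have hcore := core_erase hd1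
      have hexy : ∃ y ∈ K, G.Adj z y := by
        by_contra hno
        push Not at hno
        have : {z} = K := by
          refine hconn {z} (by simpa using hz) (by simp) fun v hv w hw hvw => ?_
          rw [Finset.mem_singleton] at hv
          exact absurd (hv ▸ hvw) (hno w hw)
        rw [← this] at hcard2
        simp at hcard2
      obtain ⟨y, hy, hzy⟩ := hexy
      have huniq : ∀ w ∈ K, G.Adj z w → w = y := fun w hw hzw =>
        Finset.card_le_one.1 hd1 w (by simp [hw, hzw]) y (by simp [hy, hzy])
      have hyz : y ∈ K.erase z := Finset.mem_erase.2 ⟨hzy.ne', hy⟩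
      have hcz := Finset.card_erase_of_mem hz
      have hcy := Finset.card_erase_of_mem hyz
      set M := (K.erase z).erase y with hM
      have hins : insert y M = K.erase z := Finset.insert_erase hyz
      have hKe : K = insert y ({z} ∪ M) := by
        rw [← Finset.insert_eq, Finset.insert_comm, hins, Finset.insert_erase hz]
      have hzM : z ∉ M := fun h => by simp [hM] at h
      have hyM : y ∉ M := Finset.notMem_erase _ _
      have g1 : Good G L S (insert y {z}) (pot G (core G K)) :=
        Good.of_card_le_two h2LS pot_nonneg Finset.card_le_two
      have g2 : Good G L S (insert y M) (pot G (core G K)) := by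
        rw [hins, ← hcore]
        exact (ih (K.erase z) (by omega)).1 (hconn.erase hz hd1)
      have w1 : Good G L S {z} (pot G (core G K) + 3) :=
        Good.of_card_le_two h2LS (by linarith [pot_nonneg (G := G) (Y := core G K)]) (by simp)
      have w2 : Good G L S M (pot G (core G K) + 3) :=
        (hweak M K (by omega) ((Finset.erase_subset _ _).trans (Finset.erase_subset _ _))).mono
          weakPot_le_pot
      have hadj : ∀ a ∈ ({z} : Finset W), ∀ b ∈ M, ¬ G.Adj a b := by
        intro a ha b hb hab
        rw [Finset.mem_singleton] at ha
        subst ha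
        have hbK : b ∈ K := Finset.mem_of_mem_erase (Finset.mem_of_mem_erase hb)
        exact hyM (huniq b hbK hab ▸ hb)
      have := Good.of_cut_vertex hL hLS pot_nonneg (by simpa using hzM)
        (by simpa using hzy.ne') hyM hadj g1 g2 w1 w2
      rwa [← hKe] at this

end

end

section

variable {V W : Type}

/-! ### From sweeps to path decompositions -/

theorem exists_sequence_of_reflTransGen {α : Type*} {r : α → α → Prop} {a b : α}
    (h : ReflTransGen r a b) :
    ∃ (n : ℕ) (f : ℕ → α), f 0 = a ∧ f n = b ∧ ∀ t < n, r (f t) (f (t + 1)) := by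
  induction h using ReflTransGen.head_induction_on with
  | refl => exact ⟨0, fun _ => b, rfl, rfl, fun t ht => absurd ht (Nat.not_lt_zero t)⟩
  | @head a c hac _ ih =>
    obtain ⟨n, f, h0, hn, hf⟩ := ih
    refine ⟨n + 1, fun t => t.casesOn a f, rfl, hn, fun t ht => ?_⟩
    cases t with
    | zero => simpa [h0] using hac
    | succ t => exact hf t (by omega)

theorem pw_le_of_sweepable [Fintype W] {G : SimpleGraph W} {x : ℝ} (hx : 0 ≤ x)
    (h : Sweepable G Finset.univ x) : (G.pw : ℝ) ≤ x := by
  refine le_trans ?_ (Nat.floor_le hx)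
  refine Nat.cast_le.2 (Nat.sInf_le ?_)
  obtain ⟨n, f, h0, hn, hf⟩ := exists_sequence_of_reflTransGen h
  have hmono : ∀ s t, s ≤ t → t ≤ n → f s ⊆ f t := by
    intro s t hst
    induction t, hst using Nat.le_induction with
    | base => intro _; exact subset_rfl
    | succ t _ ih =>
      intro ht
      obtain ⟨v, -, -, hB, -⟩ := hf t ht
      exact (ih (by omega)).trans (hB ▸ Finset.subset_insert v (f t))
  have henter : ∀ v, ∃ t < n, v ∉ f t ∧ v ∈ f (t + 1) := by
    intro v
    have hex : ∃ t, v ∈ f t := ⟨n, by rw [hn]; exact Finset.mem_univ v⟩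
    have hle : Nat.find hex ≤ n := Nat.find_min' hex (by rw [hn]; exact Finset.mem_univ v)
    have hmem := Nat.find_spec hex
    obtain ⟨t, ht⟩ : ∃ t, Nat.find hex = t + 1 := by
      refine Nat.exists_eq_succ_of_ne_zero fun h => ?_
      rw [h, h0] at hmem
      exact absurd hmem (Finset.notMem_empty v)
    refine ⟨t, by omega, Nat.find_min hex (by omega), ht ▸ hmem⟩
  rcases n with _ | r
  · refine ⟨0, fun _ => ∅, fun v => ?_, by simp, fun v => ?_, by simp⟩
    all_goals
      obtain ⟨t, ht, -⟩ := henter v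
      exact absurd ht (Nat.not_lt_zero t)
  · refine ⟨r, fun t => (f (t + 1)).filter fun v => v ∉ f t ∨ ∃ u ∉ f t, G.Adj v u,
      fun v => ?_, fun v a b c hab hbc ha hc => ?_, ?_, fun t => ?_⟩
    · obtain ⟨t, ht, h1, h2⟩ := henter v
      exact ⟨⟨t, ht⟩, Finset.mem_filter.2 ⟨h2, Or.inl h1⟩⟩
    · rw [Finset.mem_filter] at ha hc ⊢
      have h1 : f (a + 1) ⊆ f (b + 1) := hmono _ _ (Nat.succ_le_succ hab) b.2
      have h2 : f b ⊆ f c := hmono _ _ hbc c.2.le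
      refine ⟨h1 ha.1, hc.2.imp (fun h hv => h (h2 hv)) ?_⟩
      rintro ⟨u, hu, huv⟩
      exact ⟨u, fun h => hu (h2 h), huv⟩
    · have key : ∀ u v s t, s < r + 1 → t < r + 1 → s ≤ t → u ∈ f (s + 1) → v ∉ f t →
          v ∈ f (t + 1) → G.Adj u v → ∃ t : Fin (r + 1),
          u ∈ (f (t + 1)).filter (fun v => v ∉ f t ∨ ∃ u ∉ f t, G.Adj v u) ∧
          v ∈ (f (t + 1)).filter (fun v => v ∉ f t ∨ ∃ u ∉ f t, G.Adj v u) := by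
        intro u v s t _ ht hst hu hv hv' huv
        exact ⟨⟨t, ht⟩, Finset.mem_filter.2 ⟨hmono _ _ (Nat.succ_le_succ hst) ht hu,
          Or.inr ⟨v, hv, huv⟩⟩, Finset.mem_filter.2 ⟨hv', Or.inl hv⟩⟩
      intro u v huv
      obtain ⟨s, hs, hu1, hu2⟩ := henter u
      obtain ⟨t, ht, hv1, hv2⟩ := henter v
      rcases le_total s t with hst | hst
      · exact key u v s t hs ht hst hu2 hv1 hv2 huv
      · obtain ⟨i, hi1, hi2⟩ := key v u t s ht hs hst hv2 hu1 hu2 huv.symm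
        exact ⟨i, hi2, hi1⟩
    · obtain ⟨a, -, -, hB, -, hA, -⟩ := hf t t.2
      have hcard : (bdry G Finset.univ (f t)).card ≤ ⌊x⌋₊ := Nat.le_floor hA
      refine le_trans (Finset.card_le_card (t := insert a (bdry G Finset.univ (f t))) ?_)
        ((Finset.card_insert_le _ _).trans (Nat.succ_le_succ hcard))
      intro v hv
      rw [Finset.mem_filter, hB, Finset.mem_insert] at hv
      rw [Finset.mem_insert, mem_bdry]
      by_cases hva : v = a
      · exact Or.inl hva
      · have hvt := hv.1.resolve_left hva
        obtain ⟨u, hu, huv⟩ := hv.2.resolve_left (not_not.2 hvt)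
        exact Or.inr ⟨hvt, u, Finset.mem_univ u, hu, huv⟩

/-! ### The bound in terms of degrees -/

theorem sweepable_univ [Fintype W] {G : SimpleGraph W} {N L r : ℕ} (hL : 0 < L) (hr : 0 < r)
    (hN : ∑ v, dg G Finset.univ v ≤ N) :
    Sweepable G Finset.univ ((∑ v, wt (dg G Finset.univ v)) + 4 / L * N + N / (3 * r) +
      (4 * certSize (r + 1) + 2 * L + 11)) := by
  set U : Finset W := Finset.univ.filter fun v => 0 < dg G Finset.univ v with hU
  set E : ℝ := N / (3 * r) + (4 * certSize (r + 1) + 3) with hE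
  have hE0 : 0 ≤ E := by positivity
  have hcard : U.card ≤ N := by
    refine le_trans ?_ hN
    rw [hU, Finset.card_eq_sum_ones, Finset.sum_filter]
    exact Finset.sum_le_sum fun v _ => by split_ifs <;> omega
  have hbase : ∀ K, (∀ v ∈ K, dg G K v ≤ 3) → Sweepable G K ((n3 G K K : ℝ) / 6 + E) := by
    intro K h3
    have hK : ∑ v ∈ K, dg G K v ≤ N :=
      (Finset.sum_le_sum fun v _ => dg_mono G (Finset.subset_univ K) v).trans
        ((Finset.sum_le_sum_of_subset (Finset.subset_univ K)).trans hN)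
    exact (sweepable_of_degree_le_three h3 hr hK).mono (by rw [hE]; linarith)
  have hgood := (good_of_base hL hE0 le_rfl hbase U.card U le_rfl).2
  have hhang : Hanging G U U id :=
    ⟨subset_rfl, fun _ h => h, fun _ _ => rfl, fun x hx y hy _ => Or.inr ⟨hx, hy⟩⟩
  have hsweep := hgood U id hhang fun v _ => by
    refine le_trans (Finset.card_le_card (t := {v}) fun y hy => ?_)
      ((Finset.card_singleton v).trans_le hL)
    exact (mem_pre.1 hy).2
  have hpot : weakPot G (core G U) ≤ (∑ v, wt (dg G Finset.univ v)) + 8 := by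
    refine (weakPot_mono (Finset.subset_univ _)).trans ?_
    have h7 : ((min (mx G Finset.univ) 7 : ℕ) : ℝ) ≤ 7 := by exact_mod_cast min_le_right _ _
    rw [weakPot, mu]
    linarith
  have hisol : ∀ v ∈ Finset.univ \ U, ∀ u, ¬ G.Adj v u := by
    intro v hv u huv
    have : 0 < dg G Finset.univ v := Finset.card_pos.2 ⟨u, by simp [huv]⟩
    exact (Finset.mem_sdiff.1 hv).2 (by simp [hU, this])
  have hx : (0 : ℝ) ≤ (∑ v, wt (dg G Finset.univ v)) + 4 / L * N + N / (3 * r) +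
      (4 * certSize (r + 1) + 2 * L + 11) := by
    have := Finset.sum_nonneg fun v (_ : v ∈ Finset.univ) => wt_nonneg (dg G Finset.univ v)
    positivity
  rw [← Finset.union_sdiff_of_subset (Finset.subset_univ U)]
  refine sweepable_union Finset.disjoint_sdiff (fun a _ b hb hab => hisol b hb a hab.symm)
    (hsweep.mono ?_) ?_
  · have h1 : 4 / (L : ℝ) * U.card ≤ 4 / L * N := by gcongr
    rw [Finset.union_sdiff_of_subset (Finset.subset_univ U)]
    linarith
  · rw [Finset.union_sdiff_of_subset (Finset.subset_univ U)]
    refine sweep_fill (Finset.empty_subset _) subset_rfl fun C _ hC => ?_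
    have : bdry G (Finset.univ \ U) C = ∅ := by
      refine Finset.eq_empty_of_forall_notMem fun v hv => ?_
      obtain ⟨h1, u, -, -, huv⟩ := mem_bdry.1 hv
      exact hisol v (hC h1) u huv
    rw [this]
    simpa using hx

/-! ### Homomorphic images of even graphs -/

theorem exists_half_degrees [Fintype V] [Fintype W] {H : SimpleGraph V} {G : SimpleGraph W}
    {h : V → W} (heven : ∀ v, Even (H.neighborSet v).ncard)
    (hadj : ∀ x y, G.Adj x y → ∃ u v, H.Adj u v ∧ h u = x ∧ h v = y) :
    ∃ e : W → ℕ, (∀ w, dg G Finset.univ w ≤ 2 * e w) ∧ ∑ w, e w = H.edgeSet.ncard := by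
  have hdeg : ∀ v, (H.neighborSet v).ncard = H.degree v := fun v =>
    Set.ncard_eq_toFinset_card' _
  choose c hc using heven
  refine ⟨fun w => ∑ v with h v = w, c v, fun w => ?_, ?_⟩
  · rw [Finset.mul_sum]
    have h1 : Finset.univ.filter (G.Adj w) ⊆
        (Finset.univ.filter fun v => h v = w).biUnion fun v => (H.neighborFinset v).image h := by
      intro y hy
      obtain ⟨u, v, huv, rfl, rfl⟩ := hadj w y (Finset.mem_filter.1 hy).2
      refine Finset.mem_biUnion.2 ⟨u, by simp, Finset.mem_image.2 ⟨v, ?_, rfl⟩⟩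
      simpa using huv
    refine (Finset.card_le_card h1).trans (Finset.card_biUnion_le.trans ?_)
    refine Finset.sum_le_sum fun v _ => Finset.card_image_le.trans ?_
    have := hc v
    rw [hdeg] at this
    rw [SimpleGraph.card_neighborFinset_eq_degree]
    omega
  · rw [Finset.sum_fiberwise Finset.univ h c]
    have h1 := H.sum_degrees_eq_twice_card_edges
    have h2 : ∑ v, H.degree v = 2 * ∑ v, c v := by
      rw [Finset.mul_sum]
      refine Finset.sum_congr rfl fun v _ => ?_
      rw [← hdeg, hc]
      ring
    have h3 : H.edgeSet.ncard = H.edgeFinset.card := by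
      rw [Set.ncard_eq_toFinset_card', SimpleGraph.edgeFinset]
    omega

theorem pw_le_of_even [Fintype V] [Fintype W] {H : SimpleGraph V} {G : SimpleGraph W}
    {h : V → W} (heven : ∀ v, Even (H.neighborSet v).ncard)
    (hadj : ∀ x y, G.Adj x y → ∃ u v, H.Adj u v ∧ h u = x ∧ h v = y) {L r : ℕ}
    (hL : 0 < L) (hr : 0 < r) :
    (G.pw : ℝ) ≤ 23 / 135 * H.edgeSet.ncard + (8 / L + 1 / r) * H.edgeSet.ncard +
      (4 * certSize (r + 1) + 2 * L + 11) := by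
  obtain ⟨e, he, hsum⟩ := exists_half_degrees heven hadj
  have hN : ∑ v, dg G Finset.univ v ≤ 2 * H.edgeSet.ncard := by
    rw [← hsum, Finset.mul_sum]
    exact Finset.sum_le_sum fun w _ => he w
  have hwt : ∑ v, wt (dg G Finset.univ v) ≤ 23 / 135 * H.edgeSet.ncard := by
    rw [← hsum, Nat.cast_sum, Finset.mul_sum]
    exact Finset.sum_le_sum fun w _ => wt_le_of_le_two_mul (he w)
  have hr0 : (0 : ℝ) < r := Nat.cast_pos.2 hr
  refine pw_le_of_sweepable (by positivity) ((sweepable_univ hL hr hN).mono ?_)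
  push_cast
  have h1 : 4 / (L : ℝ) * (2 * H.edgeSet.ncard) = 8 / L * H.edgeSet.ncard := by ring
  have h2 : (2 * H.edgeSet.ncard : ℝ) / (3 * r) ≤ 1 / r * H.edgeSet.ncard := by
    rw [div_le_iff₀ (by positivity)]
    have : 1 / (r : ℝ) * H.edgeSet.ncard * (3 * r) = 3 * H.edgeSet.ncard := by
      field_simp
    rw [this]
    have : (0 : ℝ) ≤ H.edgeSet.ncard := Nat.cast_nonneg _
    linarith
  rw [h1]
  linarith

theorem exists_threshold {ε : ℝ} (hε : 0 < ε) : ∃ L r kε : ℕ, 0 < L ∧ 0 < r ∧ ∀ k : ℕ, kε < k →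
    (8 / L + 1 / r) * k + (4 * certSize (r + 1) + 2 * L + 11) ≤ ε * k := by
  obtain ⟨m, hm⟩ := exists_nat_gt (36 / ε)
  have hm0 : (0 : ℝ) < m := lt_trans (by positivity) hm
  obtain ⟨q, hq⟩ := exists_nat_gt ((4 * certSize (m + 1) + 2 * m + 11) * (2 / ε))
  refine ⟨m, m, q, Nat.cast_pos.1 hm0, Nat.cast_pos.1 hm0, fun k hk => ?_⟩
  have hqk : (q : ℝ) < k := Nat.cast_lt.2 hk
  have h1 : 8 / (m : ℝ) + 1 / m ≤ ε / 2 := by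
    rw [← add_div, div_le_iff₀ hm0]
    rw [div_lt_iff₀ hε] at hm
    linarith
  have h2 : (4 * certSize (m + 1) + 2 * m + 11 : ℝ) ≤ ε / 2 * k := by
    have h3 := (hq.trans hqk).le
    rw [← mul_div_assoc, div_le_iff₀ hε] at h3
    linarith
  have h4 : (8 / (m : ℝ) + 1 / m) * k ≤ ε / 2 * k :=
    mul_le_mul_of_nonneg_right h1 (Nat.cast_nonneg k)
  linarith

end

end HomPathwidth

end

/-- For every `ε > 0` there exists an integer `k_ε` such that for every even simple graph
`H` with `k > k_ε` edges and every homomorphic image `Ĥ` of `H` (via a surjection `h` that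
maps the two endpoints of each edge to distinct vertices), the pathwidth of `Ĥ` is at most
`(23/135)·k + ε·k`. -/
theorem pathwidth_hom_image_even :
    ∀ ε : ℝ, 0 < ε → ∃ kε : ℕ,
      ∀ (V W : Type) [Fintype V] [Fintype W]
        (H : SimpleGraph V) (Hhat : SimpleGraph W) (h : V → W),
        (∀ v : V, Even (H.neighborSet v).ncard) →
        kε < H.edgeSet.ncard →
        Function.Surjective h →
        (∀ u v : V, H.Adj u v → h u ≠ h v) →
        (∀ x y : W, Hhat.Adj x y ↔ ∃ u v : V, H.Adj u v ∧ h u = x ∧ h v = y) →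
        (Hhat.pw : ℝ) ≤ (23 / 135) * (H.edgeSet.ncard : ℝ) + ε * (H.edgeSet.ncard : ℝ) := by
  intro ε hε
  obtain ⟨L, r, kε, hL, hr, hk⟩ := HomPathwidth.exists_threshold hε
  refine ⟨kε, fun V W _ _ H Hhat h heven hlt _ _ hadj => ?_⟩
  have h1 := HomPathwidth.pw_le_of_even heven (fun x y => (hadj x y).1) hL hr
  have h2 := hk _ hlt
  linarith
end

section
/- For every k ≥ 6, there is no feasible and irreducible connection k-pattern M that decomposes into swaps among which there are two 2-swaps M[X] and M[Y] interacting at least twice (i.e., there are at least two indices i ∈ [k−1] with i ∈ X and i+1 ∈ Y, or i ∈ Y and i+1 ∈ X). -/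
/-!  Connection patterns for `k`-opt swaps (1-indexed: deleted edges are indexed by
`[k] = Finset.Icc 1 k`, pattern vertices `2i-1` and `2i` are the left and right endpoints
of the `i`-th deleted edge). -/

/-- The pattern vertices corresponding to an index set `X ⊆ [k]`:
`{2i−1, 2i : i ∈ X}`. -/
def pvs (X : Finset ℕ) : Finset ℕ := X.biUnion fun i => {2 * i - 1, 2 * i}

/-- `N` is a perfect matching on the vertex set `S`: its edges are loopless, lie inside
`S`, and every vertex of `S` is on exactly one edge of `N`. -/
def IsMatchingOn (N : Finset (Sym2 ℕ)) (S : Finset ℕ) : Prop :=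
  (∀ e ∈ N, ¬ e.IsDiag) ∧ (∀ e ∈ N, ∀ v ∈ e, v ∈ S) ∧
  (∀ v ∈ S, ∃! e, e ∈ N ∧ v ∈ e)

/-- The cyclic successor of `i` in the finite set `X`. -/
noncomputable def nextIn (X : Finset ℕ) (i : ℕ) : ℕ :=
  if h : (X.filter fun j => i < j).Nonempty then (X.filter fun j => i < j).min' h
  else if h' : X.Nonempty then X.min' h' else 0

/-- The "segment" edges of an index set `X`: for each `i ∈ X`, joining the right endpoint
`2i` of the `i`-th deleted edge to the left endpoint `2·nextIn X i − 1` of the cyclically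
next deleted edge (representing the path of the Hamiltonian cycle between them). -/
noncomputable def segEdges (X : Finset ℕ) : Finset (Sym2 ℕ) :=
  X.image fun i => s(2 * i, 2 * nextIn X i - 1)

/-- The sub-pattern `M[X]` of `M`: the edges of `M` lying inside `{2i−1, 2i : i ∈ X}`. -/
def subPat (M : Finset (Sym2 ℕ)) (X : Finset ℕ) : Finset (Sym2 ℕ) :=
  M.filter fun e => e ∈ (pvs X).sym2

/-- The connection pattern `N` on index set `X` is feasible: a swap fitting into it turns
a Hamiltonian cycle into a single Hamiltonian cycle again.  Intrinsically: the (2-regular)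
graph on `{2i−1, 2i : i ∈ X}` consisting of the matching `N` together with the segment
edges of `X` is a single cycle, i.e. connected. -/
def FeasiblePat (N : Finset (Sym2 ℕ)) (X : Finset ℕ) : Prop :=
  ∀ u ∈ pvs X, ∀ v ∈ pvs X,
    (SimpleGraph.fromEdgeSet ((N ∪ segEdges X : Finset (Sym2 ℕ)) : Set (Sym2 ℕ))).Reachable u v

/-- The connection pattern `N` on index set `X` is sequential:
`N ∪ {{2i−1, 2i} : i ∈ X}` forms a single (simple) cycle. -/
def SequentialPat (N : Finset (Sym2 ℕ)) (X : Finset ℕ) : Prop :=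
  ∀ u ∈ pvs X, ∀ v ∈ pvs X,
    (SimpleGraph.fromEdgeSet
      ((N ∪ X.image fun i => s(2 * i - 1, 2 * i) : Finset (Sym2 ℕ)) : Set (Sym2 ℕ))).Reachable u v

/-- A connection `k`-pattern `M` is reducible if it decomposes into two feasible patterns
(two moves). -/
def Reducible (M : Finset (Sym2 ℕ)) (k : ℕ) : Prop :=
  ∃ X Y : Finset ℕ, X ∪ Y = Finset.Icc 1 k ∧ Disjoint X Y ∧ X.Nonempty ∧ Y.Nonempty ∧
    IsMatchingOn (subPat M X) (pvs X) ∧ IsMatchingOn (subPat M Y) (pvs Y) ∧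
    FeasiblePat (subPat M X) X ∧ FeasiblePat (subPat M Y) Y

/-- The number of interactions between index sets `X` and `Y` inside `[k]`. -/
def numInteractions (k : ℕ) (X Y : Finset ℕ) : ℕ :=
  ((Finset.Icc 1 (k - 1)).filter fun i =>
    (i ∈ X ∧ i + 1 ∈ Y) ∨ (i ∈ Y ∧ i + 1 ∈ X)).card

/-- The pattern obtained from `M` by swapping `i` and `i+1`: exchange the matching
partners of `2i−1` and `2i+1`, and exchange the matching partners of `2i` and `2i+2`. -/
def swapAdjPat (M : Finset (Sym2 ℕ)) (i : ℕ) : Finset (Sym2 ℕ) :=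
  M.image (Sym2.map fun m => Equiv.swap (2 * i - 1) (2 * i + 1) (Equiv.swap (2 * i) (2 * i + 2) m))

/-! ### Vertices of a pattern and invariant colourings -/

theorem mem_pvs {X : Finset ℕ} (h0 : 0 ∉ X) {v : ℕ} :
    v ∈ pvs X ↔ 1 ≤ v ∧ (v + 1) / 2 ∈ X := by
  simp only [pvs, Finset.mem_biUnion, Finset.mem_insert, Finset.mem_singleton]
  constructor
  · rintro ⟨i, hi, h⟩
    have : i ≠ 0 := fun h => h0 (h ▸ hi)
    have e : (v + 1) / 2 = i := by omega
    exact ⟨by omega, e ▸ hi⟩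
  · rintro ⟨h1, h⟩
    exact ⟨_, h, by omega⟩

theorem zero_notMem_of_subset {k : ℕ} {X : Finset ℕ} (h : X ⊆ Finset.Icc 1 k) : 0 ∉ X := fun h0 => by
  simpa using h h0

theorem FeasiblePat.const {N : Finset (Sym2 ℕ)} {X : Finset ℕ} (h : FeasiblePat N X)
    {c : ℕ → Prop} (hN : ∀ u v, s(u, v) ∈ N → c u = c v)
    (hs : ∀ i ∈ X, c (2 * i) = c (2 * nextIn X i - 1)) {u v : ℕ} (hu : u ∈ pvs X)
    (hv : v ∈ pvs X) : c u = c v := by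
  obtain ⟨w⟩ := h u hu v hv
  clear h hu hv
  induction w with
  | nil => rfl
  | @cons a b d hab w ih =>
    have hb : c a = c b := by
      rw [SimpleGraph.fromEdgeSet_adj] at hab
      have := hab.1
      simp only [Finset.coe_union, Set.mem_union, Finset.mem_coe, segEdges, Finset.mem_image] at this
      rcases this with h | ⟨i, hi, h⟩
      · exact hN _ _ h
      · rcases Sym2.eq_iff.1 h with ⟨rfl, rfl⟩ | ⟨rfl, rfl⟩
        · exact hs i hi
        · exact (hs i hi).symm
    exact hb.trans ih

theorem feasiblePat_of_const {N : Finset (Sym2 ℕ)} {X : Finset ℕ}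
    (h : ∀ c : ℕ → Prop, (∀ u v, s(u, v) ∈ N → c u = c v) →
      (∀ i ∈ X, c (2 * i) = c (2 * nextIn X i - 1)) → ∀ u ∈ pvs X, ∀ v ∈ pvs X, c u = c v) :
    FeasiblePat N X := by
  intro u hu v hv
  have key : ∀ x y, s(x, y) ∈ N ∪ segEdges X →
      (SimpleGraph.fromEdgeSet ((N ∪ segEdges X : Finset (Sym2 ℕ)) : Set (Sym2 ℕ))).Reachable u x =
      (SimpleGraph.fromEdgeSet ((N ∪ segEdges X : Finset (Sym2 ℕ)) : Set (Sym2 ℕ))).Reachable u y := by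
    intro x y hxy
    by_cases e : x = y
    · rw [e]
    have ha : (SimpleGraph.fromEdgeSet
        ((N ∪ segEdges X : Finset (Sym2 ℕ)) : Set (Sym2 ℕ))).Adj x y := by
      rw [SimpleGraph.fromEdgeSet_adj]
      exact ⟨hxy, e⟩
    exact propext ⟨fun r => r.trans ha.reachable, fun r => r.trans ha.symm.reachable⟩
  have := h (fun x => (SimpleGraph.fromEdgeSet
    ((N ∪ segEdges X : Finset (Sym2 ℕ)) : Set (Sym2 ℕ))).Reachable u x)
    (fun x y hxy => key x y (Finset.mem_union_left _ hxy))
    (fun i hi => key _ _ (Finset.mem_union_right _ (Finset.mem_image_of_mem _ hi))) u hu v hv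
  exact this.mp (SimpleGraph.Reachable.refl u)

/-! ### Cyclic successors and contraction of unused deleted edges -/

theorem nextIn_of_succ_mem {W : Finset ℕ} {i : ℕ} (h : i + 1 ∈ W) : nextIn W i = i + 1 := by
  have hm : i + 1 ∈ W.filter fun j => i < j := by simp [h]
  rw [nextIn, dif_pos ⟨_, hm⟩]
  refine le_antisymm (Finset.min'_le _ _ hm) (Finset.le_min' _ _ _ fun y hy => ?_)
  exact (Finset.mem_filter.1 hy).2

theorem nextIn_of_succ_notMem {W : Finset ℕ} {i : ℕ} (h : i + 1 ∉ W) :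
    nextIn W i = nextIn W (i + 1) := by
  have : (W.filter fun j => i < j) = W.filter fun j => i + 1 < j := by
    refine Finset.filter_congr fun j hj => ?_
    have : j ≠ i + 1 := fun e => h (e ▸ hj)
    omega
  simp only [nextIn, this]

theorem nextIn_last {k : ℕ} {W : Finset ℕ} (hW : W ⊆ Finset.Icc 1 k) :
    nextIn W k = nextIn W 0 := by
  have h1 : (W.filter fun j => k < j) = ∅ := by
    refine Finset.filter_eq_empty_iff.2 fun j hj => ?_
    have := Finset.mem_Icc.1 (hW hj)
    omega
  have h2 : (W.filter fun j => 0 < j) = W := by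
    refine Finset.filter_eq_self.2 fun j hj => ?_
    have := Finset.mem_Icc.1 (hW hj)
    omega
  simp only [nextIn, h1, h2, Finset.not_nonempty_empty, dite_false]
  split <;> rfl

theorem FeasiblePat.const_Icc {k : ℕ} {M : Finset (Sym2 ℕ)} (h : FeasiblePat M (Finset.Icc 1 k))
    {c : ℕ → Prop} (hM : ∀ u v, s(u, v) ∈ M → c u = c v)
    (hs : ∀ i, 1 ≤ i → i < k → c (2 * i) = c (2 * i + 1)) (hk : c (2 * k) = c 1) {u v : ℕ}
    (hu : u ∈ pvs (Finset.Icc 1 k)) (hv : v ∈ pvs (Finset.Icc 1 k)) : c u = c v := by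
  refine h.const hM (fun i hi => ?_) hu hv
  obtain ⟨h1, h2⟩ := Finset.mem_Icc.1 hi
  rcases h2.lt_or_eq with h2 | rfl
  · rw [nextIn_of_succ_mem (by simp; omega)]
    exact hs i h1 h2
  · rw [nextIn_last subset_rfl, nextIn_of_succ_mem (by simp; omega)]
    exact hk

/-- To see that a sub-pattern is feasible one may reinsert the unused deleted edges as
trivial matching edges. -/
theorem feasiblePat_subPat {k : ℕ} {M : Finset (Sym2 ℕ)} {W : Finset ℕ}
    (hW : W ⊆ Finset.Icc 1 k)
    (h : ∀ c : ℕ → Prop,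
      (∀ u v, s(u, v) ∈ M → u ∈ pvs W → v ∈ pvs W → c u = c v) →
      (∀ i, 1 ≤ i → i ≤ k → i ∉ W → c (2 * i - 1) = c (2 * i)) →
      (∀ i, 1 ≤ i → i < k → c (2 * i) = c (2 * i + 1)) → c (2 * k) = c 1 →
      ∀ u ∈ pvs W, ∀ v ∈ pvs W, c u = c v) :
    FeasiblePat (subPat M W) W := by
  refine feasiblePat_of_const fun c hM hs u hu v hv => ?_
  have h0 := zero_notMem_of_subset hW
  set f : ℕ → ℕ := fun v => if (v + 1) / 2 ∈ W then v else 2 * nextIn W ((v + 1) / 2) - 1 with hf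
  have fW : ∀ v ∈ pvs W, f v = v := fun v hv => if_pos ((mem_pvs h0).1 hv).2
  have fR : ∀ i, c (f (2 * i)) = c (2 * nextIn W i - 1) := by
    intro i
    have e : (2 * i + 1) / 2 = i := by omega
    by_cases hi : i ∈ W
    · simp only [hf, e, if_pos hi, hs i hi]
    · simp only [hf, e, if_neg hi]
  have fL : ∀ i, f (2 * i + 1) = 2 * nextIn W i - 1 := by
    intro i
    have e : (2 * i + 1 + 1) / 2 = i + 1 := by omega
    by_cases hi : i + 1 ∈ W
    · simp only [hf, e, if_pos hi, nextIn_of_succ_mem hi]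
      omega
    · simp only [hf, e, if_neg hi, nextIn_of_succ_notMem hi]
  have := h (fun v => c (f v)) ?_ ?_ ?_ ?_ u hu v hv
  · simpa only [fW u hu, fW v hv] using this
  · intro u v huv hu hv
    simp only [fW u hu, fW v hv]
    exact hM u v (Finset.mem_filter.2 ⟨huv, by simp [hu, hv]⟩)
  · intro i hi hik hiW
    have e1 : (2 * i - 1 + 1) / 2 = i := by omega
    have e2 : (2 * i + 1) / 2 = i := by omega
    simp only [hf, e1, e2, if_neg hiW]
  · intro i _ _
    simp only [fR, fL]
  · have := fL 0
    simp only [mul_zero, zero_add] at this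
    simp only [fR, this, nextIn_last hW]

/-- Runs of trivial matching edges join the ends of a gap. -/
theorem gap_const {c : ℕ → Prop} {i j : ℕ} (hij : i < j)
    (ht : ∀ l, i < l → l < j → c (2 * l - 1) = c (2 * l))
    (hs : ∀ l, i ≤ l → l < j → c (2 * l) = c (2 * l + 1)) : c (2 * i) = c (2 * j - 1) := by
  induction j, hij using Nat.le_induction with
  | base => exact hs i le_rfl (by omega)
  | succ j hj ih =>
    have e := ih (fun l h1 h2 => ht l h1 (by omega)) (fun l h1 h2 => hs l h1 (by omega))
    rw [e, ht j hj (by omega)]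
    exact hs j (by omega) (by omega)

/-! ### Perfect matchings as involutions -/

theorem IsMatchingOn.exists_partner {M : Finset (Sym2 ℕ)} {S : Finset ℕ} (h : IsMatchingOn M S) :
    ∃ m : ℕ → ℕ, ∀ u v, s(u, v) ∈ M ↔ u ∈ S ∧ v = m u := by
  have : ∀ u, ∃ w, u ∈ S → s(u, w) ∈ M := by
    intro u
    by_cases hu : u ∈ S
    · obtain ⟨e, ⟨he, hue⟩, -⟩ := h.2.2 u hu
      obtain ⟨w, rfl⟩ := hue
      exact ⟨w, fun _ => he⟩
    · exact ⟨0, fun h => absurd h hu⟩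
  choose m hm using this
  refine ⟨m, fun u v => ⟨fun huv => ?_, ?_⟩⟩
  · have hu := h.2.1 _ huv u (by simp)
    refine ⟨hu, ?_⟩
    have := (h.2.2 u hu).unique ⟨huv, by simp⟩ ⟨hm u hu, by simp⟩
    rcases Sym2.eq_iff.1 this with ⟨-, h⟩ | ⟨h, h'⟩
    · exact h
    · rw [h', ← h]
  · rintro ⟨hu, rfl⟩
    exact hm u hu

theorem isMatchingOn_subPat {M : Finset (Sym2 ℕ)} {S W : Finset ℕ} {m : ℕ → ℕ}
    (hM : IsMatchingOn M S) (hm : ∀ u v, s(u, v) ∈ M ↔ u ∈ S ∧ v = m u) (hW : pvs W ⊆ S)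
    (hc : ∀ u ∈ pvs W, m u ∈ pvs W) : IsMatchingOn (subPat M W) (pvs W) := by
  refine ⟨fun e he => hM.1 e (Finset.mem_filter.1 he).1,
    fun e he => Finset.mem_sym2_iff.1 (Finset.mem_filter.1 he).2, fun v hv => ?_⟩
  refine ⟨s(v, m v), ⟨Finset.mem_filter.2 ⟨(hm _ _).2 ⟨hW hv, rfl⟩, ?_⟩, by simp⟩, ?_⟩
  · simp [hv, hc v hv]
  · rintro e ⟨he, w, rfl⟩
    rw [((hm _ _).1 (Finset.mem_filter.1 he).1).2]

theorem partner_mem {M : Finset (Sym2 ℕ)} {S W : Finset ℕ} {m : ℕ → ℕ}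
    (hm : ∀ u v, s(u, v) ∈ M ↔ u ∈ S ∧ v = m u)
    (hW : IsMatchingOn (subPat M W) (pvs W)) {u : ℕ} (hu : u ∈ pvs W) :
    m u ∈ pvs W ∧ m u ≠ u ∧ m (m u) = u := by
  obtain ⟨e, ⟨he, w, rfl⟩, -⟩ := hW.2.2 u hu
  have hM := (Finset.mem_filter.1 he).1
  obtain ⟨-, rfl⟩ := (hm _ _).1 hM
  refine ⟨hW.2.1 _ he _ (by simp), fun h => hW.1 _ he (by simp [h]), ?_⟩
  rw [Sym2.eq_swap] at hM
  exact ((hm _ _).1 hM).2.symm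

/-! ### Links through the part of the pattern outside a sub-pattern -/

section Link

variable (k : ℕ) (M : Finset (Sym2 ℕ)) (Q : Finset ℕ) (E : ℕ → Prop)

/-- A colouring is invariant outside `Q` if it is invariant along the edges of `M` avoiding `Q`
and along all segments except those following the indices in `E`. -/
def InvOutside (c : ℕ → Prop) : Prop :=
  (∀ u v, s(u, v) ∈ M → u ∉ pvs Q → v ∉ pvs Q → c u = c v) ∧
  (∀ e, 1 ≤ e → e < k → ¬ E e → c (2 * e) = c (2 * e + 1)) ∧ c (2 * k) = c 1

/-- Two vertices are linked if they are joined outside `Q`. -/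
def Linked (u v : ℕ) : Prop := ∀ c, InvOutside k M Q E c → c u = c v

variable {k M Q E}

theorem exists_linked (hfeas : FeasiblePat M (Finset.Icc 1 k)) (hQ : Q ⊆ Finset.Icc 1 k)
    (hMQ : ∀ u v, s(u, v) ∈ M → u ∈ pvs Q → v ∈ pvs Q)
    (hE : ∀ e, E e → 1 ≤ e ∧ e < k ∧ 2 * e ∈ pvs Q ∧ 2 * e + 1 ∈ pvs Q)
    {C : ℕ → Prop} (hCM : ∀ u v, s(u, v) ∈ M → u ∈ pvs Q → v ∈ pvs Q → C u = C v)
    (hCE : ∀ e, E e → C (2 * e) = C (2 * e + 1))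
    {u₀ v₀ : ℕ} (hu₀ : u₀ ∈ pvs Q) (hv₀ : v₀ ∈ pvs Q) (h₀ : C u₀) (h₁ : ¬ C v₀) :
    ∃ u ∈ pvs Q, ∃ v ∈ pvs Q, C u ∧ ¬ C v ∧ (∀ e, E e → u ≠ 2 * e ∧ u ≠ 2 * e + 1) ∧
      (∀ e, E e → v ≠ 2 * e ∧ v ≠ 2 * e + 1) ∧ Linked k M Q E u v := by
  by_contra! hcon
  have hk0 : ∀ e, E e → 1 ≤ e ∧ e < k := fun e he => ⟨(hE e he).1, (hE e he).2.1⟩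
  set T : ℕ → Prop := fun u => u ∈ pvs Q ∧ ∀ e, E e → u ≠ 2 * e ∧ u ≠ 2 * e + 1 with hT
  have hcon' : ∀ u v, T u → T v → Linked k M Q E u v → C u → C v := by
    intro u v hu hv hl hc
    by_contra hc'
    exact hcon u hu.1 v hv.1 hc hc' hu.2 hv.2 hl
  set c : ℕ → Prop := fun v => (v ∈ pvs Q ∧ C v) ∨
    (v ∉ pvs Q ∧ ∃ t, T t ∧ C t ∧ Linked k M Q E t v) with hc
  have symm : ∀ u v, Linked k M Q E u v → Linked k M Q E v u := fun u v h d hd => (h d hd).symm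
  have trans : ∀ u v w, Linked k M Q E u v → Linked k M Q E v w → Linked k M Q E u w :=
    fun u v w h h' d hd => (h d hd).trans (h' d hd)
  have step : ∀ u v, (u ∈ pvs Q → T u) → (v ∈ pvs Q → T v) → Linked k M Q E u v → c u → c v := by
    intro u v hu hv hl h
    have : ∃ t, T t ∧ C t ∧ Linked k M Q E t v := by
      rcases h with ⟨h1, h2⟩ | ⟨-, t, h1, h2, h3⟩
      · exact ⟨u, hu h1, h2, hl⟩
      · exact ⟨t, h1, h2, trans _ _ _ h3 hl⟩
    by_cases hvQ : v ∈ pvs Q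
    · obtain ⟨t, h1, h2, h3⟩ := this
      exact Or.inl ⟨hvQ, hcon' t v h1 (hv hvQ) h3 h2⟩
    · exact Or.inr ⟨hvQ, this⟩
  have step' : ∀ u v, (u ∈ pvs Q → T u) → (v ∈ pvs Q → T v) → Linked k M Q E u v → c u = c v :=
    fun u v hu hv hl => propext ⟨step u v hu hv hl, step v u hv hu (symm _ _ hl)⟩
  have cQ : ∀ u, u ∈ pvs Q → c u = C u := fun u hu => by simp [hc, hu]
  have key : c u₀ = c v₀ := by
    have hsub : pvs Q ⊆ pvs (Finset.Icc 1 k) := Finset.biUnion_subset_biUnion_of_subset_left _ hQ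
    refine hfeas.const_Icc (fun u v huv => ?_) (fun e h1 h2 => ?_) ?_ (hsub hu₀) (hsub hv₀)
    · by_cases hu : u ∈ pvs Q
      · have hv := hMQ u v huv hu
        rw [cQ u hu, cQ v hv]
        exact hCM u v huv hu hv
      · have hv : v ∉ pvs Q := fun hv => hu (hMQ v u (by rwa [Sym2.eq_swap]) hv)
        exact step' u v (fun h => absurd h hu) (fun h => absurd h hv)
          fun d hd => hd.1 u v huv hu hv
    · by_cases he : E e
      · obtain ⟨-, -, h3, h4⟩ := hE e he
        rw [cQ _ h3, cQ _ h4]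
        exact hCE e he
      · refine step' _ _ (fun h => ⟨h, fun e' he' => ?_⟩) (fun h => ⟨h, fun e' he' => ?_⟩)
          fun d hd => hd.2.1 e h1 h2 he
        all_goals
          have : e ≠ e' := fun h => he (h ▸ he')
          omega
    · refine step' _ _ (fun h => ⟨h, fun e' he' => ?_⟩) (fun h => ⟨h, fun e' he' => ?_⟩)
        fun d hd => hd.2.2
      all_goals
        have := hk0 e' he'
        omega
  rw [cQ _ hu₀, cQ _ hv₀] at key
  exact h₁ (key ▸ h₀)

theorem const_of_const_on (hfeas : FeasiblePat M (Finset.Icc 1 k)) (hQ : Q ⊆ Finset.Icc 1 k)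
    (hMQ : ∀ u v, s(u, v) ∈ M → u ∈ pvs Q → v ∈ pvs Q)
    {c : ℕ → Prop} (hM : ∀ u v, s(u, v) ∈ M → u ∉ pvs Q → v ∉ pvs Q → c u = c v)
    (hs : ∀ i, 1 ≤ i → i < k → c (2 * i) = c (2 * i + 1)) (hk : c (2 * k) = c 1)
    {u₀ : ℕ} (hu₀ : u₀ ∈ pvs Q) (hconst : ∀ u ∈ pvs Q, c u = c u₀) :
    ∀ u ∈ pvs (Finset.Icc 1 k), c u = c u₀ := by
  intro u hu
  have hsub : pvs Q ⊆ pvs (Finset.Icc 1 k) := Finset.biUnion_subset_biUnion_of_subset_left _ hQ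
  set d : ℕ → Prop := fun v => if v ∈ pvs Q then c u₀ else c v with hd
  have hdc : ∀ v, d v = c v := by
    intro v
    by_cases hv : v ∈ pvs Q
    · simp [hd, hv, hconst v hv]
    · simp [hd, hv]
  have := hfeas.const_Icc (c := d) (fun u v huv => ?_) (fun i h1 h2 => ?_) ?_ hu (hsub hu₀)
  · rwa [hdc, hdc] at this
  · by_cases hu : u ∈ pvs Q
    · simp [hd, hu, hMQ u v huv hu]
    · have hv : v ∉ pvs Q := fun hv => hu (hMQ v u (by rwa [Sym2.eq_swap]) hv)
      rw [hdc, hdc, hM u v huv hu hv]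
  · rw [hdc, hdc, hs i h1 h2]
  · rw [hdc, hdc, hk]

end Link

/-! ### The finite model

The four indices of two 2-swaps are listed increasingly as positions `0, 1, 2, 3`; the endpoints
of the deleted edge at position `i` are numbered `2 * i` and `2 * i + 1`. -/

/-- The vertices met from `x` by applying `f` and `g` alternately. -/
def walk (f g : ℕ → ℕ) : ℕ → ℕ → List ℕ
  | 0, _ => []
  | n + 1, x => x :: f x :: walk f g n (g (f x))

/-- Position of the other index of the swap containing position `i`; the swaps
are nested or alternate. -/
def mate (nested : Bool) (i : ℕ) : ℕ := if nested then 3 - i else (i + 2) % 4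

/-- Whether position `i` belongs to the swap containing position `0`. -/
def inFirst (nested : Bool) (i : ℕ) : Bool := i == 0 || i == mate nested 0

/-- The other endpoint of the same deleted edge. -/
def flipEnd (j : ℕ) : ℕ := 2 * (j / 2) + (1 - j % 2)

/-- The matching on the finite model in which the first swap has type `tx` and
the second has type `ty`, where type `0` is trivial, type `1` reverses a path and type `2`
splits the cycle. -/
def modelPartner (nested : Bool) (tx ty j : ℕ) : ℕ :=
  match if inFirst nested (j / 2) then tx else ty with
  | 0 => flipEnd j
  | 1 => 2 * mate nested (j / 2) + j % 2
  | _ => 2 * mate nested (j / 2) + (1 - j % 2)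

/-- The restriction of a matching to the selected positions, trivial elsewhere. -/
def restrictMatch (sel : ℕ → Bool) (mu : ℕ → ℕ) (j : ℕ) : ℕ :=
  if sel (j / 2) then mu j else flipEnd j

/-- The other endpoint of a segment, when all four gaps are segments. -/
def segAll (j : ℕ) : ℕ := if j % 2 = 1 then (j + 1) % 8 else (j + 7) % 8

/-- The other endpoint of a segment, when only the gaps following the positions in `I` are
segments. -/
def segIn (I : List ℕ) (j : ℕ) : ℕ :=
  if j % 2 = 1 then if j / 2 ∈ I then j + 1 else j
  else if 0 < j ∧ j / 2 - 1 ∈ I then j - 1 else j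

/-- Endpoints of no segment following a position in `I`. -/
def IsTerminal (I : List ℕ) (j : ℕ) : Prop := ∀ i ∈ I, j ≠ 2 * i + 1 ∧ j ≠ 2 * i + 2

instance (I : List ℕ) (j : ℕ) : Decidable (IsTerminal I j) := by
  delta IsTerminal; infer_instance

/-- A way to split off the selected positions, given a link between vertices `i` and `j`. -/
def Splits (I : List ℕ) (mu : ℕ → ℕ) (sel : ℕ → Bool) (i j : ℕ) : Prop :=
  (∃ l < 4, sel l = true) ∧ (∀ l < 8, sel (mu l / 2) = sel (l / 2)) ∧
  (∀ l < 8, l ∈ walk (restrictMatch sel mu) segAll 4 0) ∧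
  ∀ l < 8, l ∈ walk (restrictMatch (fun l => !sel l) mu) (segIn I) 4 i ∨
    l ∈ walk (restrictMatch (fun l => !sel l) mu) (segIn I) 4 j

instance (I : List ℕ) (mu : ℕ → ℕ) (sel : ℕ → Bool) (i j : ℕ) : Decidable (Splits I mu sel i j) := by
  delta Splits; infer_instance

/-- A link between `i` and `j` would join `C` to its complement. -/
def IsCrossing (I C : List ℕ) (i j : ℕ) : Prop :=
  i ∈ C ∧ IsTerminal I i ∧ j ∉ C ∧ IsTerminal I j

instance (I C : List ℕ) (i j : ℕ) : Decidable (IsCrossing I C i j) := by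
  delta IsCrossing; infer_instance

/-- The vertex set `C` is a union of components of the finite model, and each link joining
it to its complement gives a way to split off some positions. -/
def IsSplittingCut (I : List ℕ) (mu : ℕ → ℕ) (sels : List (ℕ → Bool)) (C : List ℕ) : Prop :=
  (∃ j < 8, j ∈ C) ∧ (∃ j < 8, j ∉ C) ∧
  (∀ j < 8, mu j ∈ C ↔ j ∈ C) ∧
  (∀ i ∈ I, 2 * i + 1 ∈ C ↔ 2 * i + 2 ∈ C) ∧
  ∀ i < 8, ∀ j < 8, IsCrossing I C i j →
    ∃ sel ∈ sels, Splits I mu sel i j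

instance (I : List ℕ) (mu : ℕ → ℕ) (sels : List (ℕ → Bool)) (C : List ℕ) :
    Decidable (IsSplittingCut I mu sels C) := by
  delta IsSplittingCut; infer_instance

theorem exists_isSplittingCut :
    ∀ cfg ∈ [(false, [0, 1]), (false, [1, 2]), (false, [0, 2]), (true, [0, 2])],
    ∀ tx ∈ [0, 1, 2], ∀ ty ∈ [0, 1, 2], ∃ s ∈ [0, 2, 4],
      IsSplittingCut cfg.2 (modelPartner cfg.1 tx ty)
        [inFirst cfg.1, fun l => !inFirst cfg.1 l, fun _ => true]
        (walk (modelPartner cfg.1 tx ty) (segIn cfg.2) 4 s) := by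
  decide +kernel

theorem modelPartner_lt : ∀ nested, ∀ tx < 3, ∀ ty < 3, ∀ j < 8,
    modelPartner nested tx ty j < 8 := by
  decide +kernel

theorem walk_const {f g : ℕ → ℕ} {c : ℕ → Prop} (hf : ∀ l < 8, f l < 8 ∧ c (f l) = c l)
    (hg : ∀ l < 8, g l < 8 ∧ c (g l) = c l) {n x l : ℕ} (hx : x < 8) (hl : l ∈ walk f g n x) :
    c l = c x := by
  induction n generalizing x with
  | zero => simp [walk] at hl
  | succ n ih =>
    rcases List.mem_cons.1 hl with rfl | hl
    · rfl
    rcases List.mem_cons.1 hl with rfl | hl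
    · exact (hf x hx).2
    · rw [ih (hg _ (hf x hx).1).1 hl, (hg _ (hf x hx).1).2, (hf x hx).2]

theorem flipEnd_lt {j : ℕ} (hj : j < 8) : flipEnd j < 8 := by
  unfold flipEnd
  omega

/-! ### Transfer from the finite model -/

/-- The indices at the selected positions. -/
def selIdx (p : ℕ → ℕ) (sel : ℕ → Bool) : Finset ℕ :=
  ((Finset.range 4).filter fun i => sel i = true).image p

/-- The pattern vertex with number `j` in the finite model. -/
def vtx (p : ℕ → ℕ) (j : ℕ) : ℕ := 2 * p (j / 2) - 1 + j % 2

section Transfer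

variable {k : ℕ} {p : ℕ → ℕ}

theorem mem_selIdx {sel : ℕ → Bool} {x : ℕ} :
    x ∈ selIdx p sel ↔ ∃ i < 4, sel i = true ∧ x = p i := by
  simp only [selIdx, Finset.mem_image, Finset.mem_filter, Finset.mem_range]
  constructor
  · rintro ⟨i, ⟨h1, h2⟩, rfl⟩
    exact ⟨i, h1, h2, rfl⟩
  · rintro ⟨i, h1, h2, rfl⟩
    exact ⟨i, ⟨h1, h2⟩, rfl⟩

/-- `p` lists four increasing indices in `[k]`. -/
def IsListing (k : ℕ) (p : ℕ → ℕ) : Prop :=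
  1 ≤ p 0 ∧ p 0 < p 1 ∧ p 1 < p 2 ∧ p 2 < p 3 ∧ p 3 ≤ k

theorem IsListing.inj (hp : IsListing k p) {i j : ℕ} (hi : i < 4) (hj : j < 4) (h : p i = p j) :
    i = j := by
  obtain ⟨h0, h1, h2, h3, h4⟩ := hp
  interval_cases i <;> interval_cases j <;> omega

theorem IsListing.bounds (hp : IsListing k p) {i : ℕ} (hi : i < 4) : 1 ≤ p i ∧ p i ≤ k := by
  obtain ⟨h0, h1, h2, h3, h4⟩ := hp
  interval_cases i <;> omega

theorem IsListing.selIdx_subset (hp : IsListing k p) (sel : ℕ → Bool) :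
    selIdx p sel ⊆ Finset.Icc 1 k := by
  intro x hx
  obtain ⟨i, hi, -, rfl⟩ := mem_selIdx.1 hx
  exact Finset.mem_Icc.2 (hp.bounds hi)

theorem IsListing.mem_selIdx_iff (hp : IsListing k p) {sel : ℕ → Bool} {i : ℕ} (hi : i < 4) :
    p i ∈ selIdx p sel ↔ sel i = true := by
  rw [mem_selIdx]
  constructor
  · rintro ⟨l, hl, h, e⟩
    rwa [hp.inj hi hl e]
  · exact fun h => ⟨i, hi, h, rfl⟩

theorem IsListing.vtx_mem (hp : IsListing k p) {sel : ℕ → Bool} {j : ℕ} (hj : j < 8) :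
    vtx p j ∈ pvs (selIdx p sel) ↔ sel (j / 2) = true := by
  have hb := hp.bounds (i := j / 2) (by omega)
  rw [mem_pvs (zero_notMem_of_subset (hp.selIdx_subset sel)),
    ← hp.mem_selIdx_iff (i := j / 2) (by omega)]
  have e : (vtx p j + 1) / 2 = p (j / 2) := by unfold vtx; omega
  rw [e]
  have : 1 ≤ vtx p j := by unfold vtx; omega
  simp [this]

theorem IsListing.vtx_even (p : ℕ → ℕ) (i : ℕ) : vtx p (2 * i) = 2 * p i - 1 := by
  simp [vtx]

theorem IsListing.vtx_odd (hp : IsListing k p) {i : ℕ} (hi : i < 4) :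
    vtx p (2 * i + 1) = 2 * p i := by
  have := hp.bounds hi
  have e : (2 * i + 1) / 2 = i := by omega
  simp only [vtx, e]
  omega

theorem IsListing.vtx_inj (hp : IsListing k p) {i j : ℕ} (hi : i < 8) (hj : j < 8)
    (h : vtx p i = vtx p j) : i = j := by
  have h1 := hp.bounds (i := i / 2) (by omega)
  have h2 := hp.bounds (i := j / 2) (by omega)
  unfold vtx at h
  have := hp.inj (i := i / 2) (j := j / 2) (by omega) (by omega) (by omega)
  rw [this] at h
  omega

theorem IsListing.exists_vtx (hp : IsListing k p) {sel : ℕ → Bool} {u : ℕ}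
    (hu : u ∈ pvs (selIdx p sel)) : ∃ j < 8, sel (j / 2) = true ∧ u = vtx p j := by
  obtain ⟨h1, h2⟩ := (mem_pvs (zero_notMem_of_subset (hp.selIdx_subset sel))).1 hu
  obtain ⟨i, hi, hs, e⟩ := mem_selIdx.1 h2
  rcases Nat.even_or_odd' u with ⟨l, hl | hl⟩
  · refine ⟨2 * i + 1, by omega, ?_, ?_⟩
    · rwa [show (2 * i + 1) / 2 = i by omega]
    · rw [hp.vtx_odd hi]
      omega
  · refine ⟨2 * i, by omega, ?_, ?_⟩
    · rwa [show (2 * i) / 2 = i by omega]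
    · rw [IsListing.vtx_even]
      omega

theorem IsListing.flipEnd_const (hp : IsListing k p) {c : ℕ → Prop} {j : ℕ} (hj : j < 8)
    (h : c (2 * p (j / 2) - 1) = c (2 * p (j / 2))) : c (vtx p j) = c (vtx p (flipEnd j)) := by
  have hj' : j / 2 < 4 := by omega
  rcases Nat.mod_two_eq_zero_or_one j with e | e
  · have e1 : j = 2 * (j / 2) := by omega
    have e2 : flipEnd j = 2 * (j / 2) + 1 := by unfold flipEnd; omega
    rw [e2, hp.vtx_odd hj', ← h, ← IsListing.vtx_even, ← e1]
  · have e1 : j = 2 * (j / 2) + 1 := by omega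
    have e2 : flipEnd j = 2 * (j / 2) := by unfold flipEnd; omega
    rw [e2, IsListing.vtx_even, h, ← hp.vtx_odd hj', ← e1]

theorem IsListing.segment_const (hp : IsListing k p) {c : ℕ → Prop}
    (ht : ∀ l, 1 ≤ l → l ≤ k → (∀ i < 4, l ≠ p i) → c (2 * l - 1) = c (2 * l))
    (hs : ∀ l, 1 ≤ l → l < k → c (2 * l) = c (2 * l + 1)) (hk : c (2 * k) = c 1)
    {i : ℕ} (hi : i < 4) : c (vtx p (2 * i + 1)) = c (vtx p ((2 * i + 2) % 8)) := by
  have hne : ∀ l, (l ≠ p 0 ∧ l ≠ p 1 ∧ l ≠ p 2 ∧ l ≠ p 3) → ∀ i < 4, l ≠ p i := by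
    intro l h i hi
    interval_cases i <;> omega
  rw [hp.vtx_odd hi]
  obtain ⟨h0, h1, h2, h3, h4⟩ := hp
  by_cases hi3 : i = 3
  · subst hi3
    have a : c 1 = c (2 * p 0 - 1) := by
      rcases h0.lt_or_eq with h | h
      · rw [show (1 : ℕ) = 2 * 1 - 1 by rfl, ht 1 le_rfl (by omega) (hne _ (by omega))]
        exact gap_const h (fun l _ _ => ht l (by omega) (by omega) (hne _ (by omega)))
          (fun l _ _ => hs l (by omega) (by omega))
      · rw [← h]
    have b : c (2 * p 3) = c (2 * k) := by
      rcases h4.lt_or_eq with h | h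
      · rw [← ht k (by omega) le_rfl (hne _ (by omega))]
        exact gap_const h (fun l _ _ => ht l (by omega) (by omega) (hne _ (by omega)))
          (fun l _ _ => hs l (by omega) (by omega))
      · rw [h]
    rw [b, hk, a]
    rfl
  · have e : (2 * i + 2) % 8 = 2 * (i + 1) := by omega
    rw [e, IsListing.vtx_even]
    have hi' : i < 3 := by omega
    have hbd : 1 ≤ p i ∧ p i < p (i + 1) ∧ p (i + 1) ≤ k := by
      interval_cases i <;> simp only [Nat.reduceAdd] <;> omega
    have hbt : ∀ l, p i < l → l < p (i + 1) → ∀ i < 4, l ≠ p i := by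
      intro l hl1 hl2
      refine hne l ?_
      interval_cases i <;> simp only [Nat.reduceAdd] at hl1 hl2 <;> omega
    exact gap_const hbd.2.1 (fun l a b => ht l (by omega) (by omega) (hbt l a b))
      (fun l _ _ => hs l (by omega) (by omega))

variable {M : Finset (Sym2 ℕ)} {m : ℕ → ℕ} {I : List ℕ} {mu : ℕ → ℕ}

/-- The indices whose segment joins two consecutive positions listed in `I`. -/
def InnerIdx (p : ℕ → ℕ) (I : List ℕ) (e : ℕ) : Prop := ∃ i ∈ I, e = p i

theorem reducible_of_splits (hk : 5 ≤ k) (hM : IsMatchingOn M (pvs (Finset.Icc 1 k)))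
    (hfeas : FeasiblePat M (Finset.Icc 1 k)) (hp : IsListing k p)
    (hm : ∀ u v, s(u, v) ∈ M ↔ u ∈ pvs (Finset.Icc 1 k) ∧ v = m u)
    (hmu : ∀ j < 8, mu j < 8 ∧ m (vtx p j) = vtx p (mu j))
    (hI : ∀ i ∈ I, i < 3 ∧ p (i + 1) = p i + 1) {sel : ℕ → Bool} {i j : ℕ}
    (hi : i < 8) (hj : j < 8) (h : Splits I mu sel i j)
    (hl : Linked k M (selIdx p fun _ => true) (InnerIdx p I) (vtx p i) (vtx p j)) :
    Reducible M k := by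
  obtain ⟨⟨l₀, hl₀, hsl₀⟩, hclosed, hr₁, hr₂⟩ := h
  set W := selIdx p sel with hWdef
  set Q := selIdx p fun _ => true with hQdef
  have hW : W ⊆ Finset.Icc 1 k := hp.selIdx_subset sel
  have hQ : Q ⊆ Finset.Icc 1 k := hp.selIdx_subset _
  have hU : Finset.Icc 1 k \ W ⊆ Finset.Icc 1 k := Finset.sdiff_subset
  have hV0 := zero_notMem_of_subset (subset_refl (Finset.Icc 1 k))
  have mono : ∀ {A : Finset ℕ}, A ⊆ Finset.Icc 1 k → pvs A ⊆ pvs (Finset.Icc 1 k) :=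
    fun h => Finset.biUnion_subset_biUnion_of_subset_left _ h
  have hmm : ∀ u ∈ pvs (Finset.Icc 1 k), m u ∈ pvs (Finset.Icc 1 k) ∧ m (m u) = u := by
    intro u hu
    have := (hm u (m u)).2 ⟨hu, rfl⟩
    rw [Sym2.eq_swap] at this
    exact ⟨((hm _ _).1 this).1, ((hm _ _).1 this).2.symm⟩
  have hWc : ∀ u ∈ pvs W, m u ∈ pvs W := by
    intro u hu
    obtain ⟨j, hj, hs, rfl⟩ := hp.exists_vtx hu
    rw [(hmu j hj).2]
    exact (hp.vtx_mem (hmu j hj).1).2 (by rw [hclosed j hj, hs])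
  have hUW : ∀ u, u ∈ pvs (Finset.Icc 1 k \ W) ↔ u ∈ pvs (Finset.Icc 1 k) ∧ u ∉ pvs W := by
    intro u
    rw [mem_pvs (zero_notMem_of_subset hU), mem_pvs hV0, mem_pvs (zero_notMem_of_subset hW),
      Finset.mem_sdiff]
    tauto
  have hUc : ∀ u ∈ pvs (Finset.Icc 1 k \ W), m u ∈ pvs (Finset.Icc 1 k \ W) := by
    intro u hu
    obtain ⟨h1, h2⟩ := (hUW u).1 hu
    refine (hUW _).2 ⟨(hmm u h1).1, fun h => h2 ?_⟩
    rw [← (hmm u h1).2]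
    exact hWc _ h
  have hMQ : ∀ u v, s(u, v) ∈ M → u ∈ pvs Q → v ∈ pvs Q := by
    intro u v huv hu
    obtain ⟨j, hj, -, rfl⟩ := hp.exists_vtx hu
    rw [((hm _ _).1 huv).2, (hmu j hj).2]
    exact (hp.vtx_mem (hmu j hj).1).2 rfl
  have hvQ : ∀ {j}, j < 8 → vtx p j ∈ pvs Q := fun hj => (hp.vtx_mem hj).2 rfl
  have hedge : ∀ {j}, j < 8 → s(vtx p j, vtx p (mu j)) ∈ M := fun hj =>
    (hm _ _).2 ⟨mono hQ (hvQ hj), (hmu _ hj).2.symm⟩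
  refine ⟨W, Finset.Icc 1 k \ W, Finset.union_sdiff_of_subset hW, Finset.disjoint_sdiff,
    ⟨p l₀, (hp.mem_selIdx_iff hl₀).2 hsl₀⟩, ?_, isMatchingOn_subPat hM hm (mono hW) hWc,
    isMatchingOn_subPat hM hm (mono hU) hUc, ?_, ?_⟩
  · rw [Finset.sdiff_nonempty]
    intro hsub
    have h1 := Finset.card_le_card hsub
    have h2 : W.card ≤ 4 := Finset.card_image_le.trans
      ((Finset.card_filter_le _ _).trans (Finset.card_range 4).le)
    simp at h1
    omega
  · refine feasiblePat_subPat hW fun c hcM hct hcs hck => ?_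
    have key : ∀ {j}, j < 8 → c (vtx p j) = c (vtx p 0) := by
      refine fun {j} hj => walk_const (c := fun j => c (vtx p j)) (fun l hl => ?_)
        (fun l hl => ?_) (by omega) (hr₁ j hj)
      · by_cases hs : sel (l / 2) = true
        · simp only [restrictMatch, hs, if_true]
          refine ⟨(hmu l hl).1, (hcM _ _ (hedge hl) ((hp.vtx_mem hl).2 hs)
            ((hp.vtx_mem (hmu l hl).1).2 ?_)).symm⟩
          rw [hclosed l hl, hs]
        · simp only [restrictMatch, hs]
          have hb := hp.bounds (i := l / 2) (by omega)
          exact ⟨flipEnd_lt hl, (hp.flipEnd_const hl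
            (hct _ hb.1 hb.2 (by rwa [hp.mem_selIdx_iff (by omega)]))).symm⟩
      · have hseg : ∀ i < 4, c (vtx p (2 * i + 1)) = c (vtx p ((2 * i + 2) % 8)) := by
          refine fun i hi => hp.segment_const (fun x h1 h2 h3 => hct x h1 h2 fun hx => ?_) hcs hck hi
          obtain ⟨y, hy, -, e⟩ := mem_selIdx.1 hx
          exact h3 y hy e
        refine ⟨by unfold segAll; split <;> omega, ?_⟩
        unfold segAll
        split
        · have := hseg (l / 2) (by omega)
          rw [show 2 * (l / 2) + 1 = l by omega, show 2 * (l / 2) + 2 = l + 1 by omega] at this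
          exact this.symm
        · have := hseg ((l + 7) % 8 / 2) (by omega)
          rwa [show 2 * ((l + 7) % 8 / 2) + 1 = (l + 7) % 8 by omega,
            show (2 * ((l + 7) % 8 / 2) + 2) % 8 = l by omega] at this
    intro u hu v hv
    obtain ⟨a, ha, -, rfl⟩ := hp.exists_vtx hu
    obtain ⟨b, hb, -, rfl⟩ := hp.exists_vtx hv
    rw [key ha, key hb]
  · refine feasiblePat_subPat hU fun c hcM hct hcs hck => ?_
    have hout : ∀ u v, s(u, v) ∈ M → u ∉ pvs Q → v ∉ pvs Q → c u = c v := by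
      have hWQ : pvs W ⊆ pvs Q := fun u hu => by
        obtain ⟨j, hj, -, rfl⟩ := hp.exists_vtx hu
        exact hvQ hj
      intro u v huv hu hv
      have hu' := ((hm _ _).1 huv).1
      have hv' := ((hm v u).1 (by rwa [Sym2.eq_swap])).1
      exact hcM u v huv ((hUW u).2 ⟨hu', fun h => hu (hWQ h)⟩) ((hUW v).2 ⟨hv', fun h => hv (hWQ h)⟩)
    have step : ∀ {x}, x < 8 → ∀ {l}, l ∈ walk (restrictMatch (fun l => !sel l) mu) (segIn I) 4 x →
        c (vtx p l) = c (vtx p x) := by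
      refine fun {x} hx {l} h => walk_const (c := fun j => c (vtx p j)) (fun l hl => ?_)
        (fun l hl => ?_) hx h
      · by_cases hs : sel (l / 2) = true
        · simp only [restrictMatch, hs, Bool.not_true]
          have hb := hp.bounds (i := l / 2) (by omega)
          refine ⟨flipEnd_lt hl, (hp.flipEnd_const hl (hct _ hb.1 hb.2 fun hx => ?_)).symm⟩
          exact (Finset.mem_sdiff.1 hx).2 ((hp.mem_selIdx_iff (by omega)).2 hs)
        · simp only [restrictMatch, hs, Bool.not_false, if_true]
          have h1 : vtx p l ∉ pvs W := by rwa [hp.vtx_mem hl]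
          have h2 : vtx p (mu l) ∉ pvs W := by rwa [hp.vtx_mem (hmu l hl).1, hclosed l hl]
          exact ⟨(hmu l hl).1, (hcM _ _ (hedge hl) ((hUW _).2 ⟨mono hQ (hvQ hl), h1⟩)
            ((hUW _).2 ⟨mono hQ (hvQ (hmu l hl).1), h2⟩)).symm⟩
      · have hseg : ∀ i ∈ I, c (vtx p (2 * i + 1)) = c (vtx p (2 * i + 2)) := by
          intro i hi
          obtain ⟨h1, h2⟩ := hI i hi
          have hb := hp.bounds (i := i) (by omega)
          have hb' := hp.bounds (i := i + 1) (by omega)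
          rw [hp.vtx_odd (by omega), show 2 * i + 2 = 2 * (i + 1) by ring, IsListing.vtx_even, h2,
            hcs _ hb.1 (by omega)]
          congr 1
        unfold segIn
        split_ifs with h1 h2 h2
        · have := hseg _ h2
          have := (hI _ h2).1
          rw [show 2 * (l / 2) + 1 = l by omega, show 2 * (l / 2) + 2 = l + 1 by omega] at *
          exact ⟨by omega, by simp [*]⟩
        · exact ⟨hl, rfl⟩
        · have := hseg _ h2.2
          rw [show 2 * (l / 2 - 1) + 1 = l - 1 by omega, show 2 * (l / 2 - 1) + 2 = l by omega] at this
          exact ⟨by omega, this⟩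
        · exact ⟨hl, rfl⟩
    have link : c (vtx p i) = c (vtx p j) := hl c ⟨hout, fun e h1 h2 _ => hcs e h1 h2, hck⟩
    have key' : ∀ {l}, l < 8 → c (vtx p l) = c (vtx p i) := by
      intro l hl
      rcases hr₂ l hl with h | h
      · exact step hi h
      · rw [step hj h, link]
    have key : ∀ {l}, l < 8 → c (vtx p l) = c (vtx p 0) := fun hl => by
      rw [key' hl, key' (l := 0) (by omega)]
    have hconst := const_of_const_on hfeas hQ hMQ hout hcs hck (hvQ (j := 0) (by omega))
      fun u hu => by
        obtain ⟨a, ha, -, rfl⟩ := hp.exists_vtx hu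
        exact key ha
    intro u hu v hv
    rw [hconst u (mono hU hu), hconst v (mono hU hv)]

theorem reducible_of_isSplittingCut (hk : 5 ≤ k) (hM : IsMatchingOn M (pvs (Finset.Icc 1 k)))
    (hfeas : FeasiblePat M (Finset.Icc 1 k)) (hp : IsListing k p)
    (hm : ∀ u v, s(u, v) ∈ M ↔ u ∈ pvs (Finset.Icc 1 k) ∧ v = m u)
    (hmu : ∀ j < 8, mu j < 8 ∧ m (vtx p j) = vtx p (mu j))
    (hI : ∀ i ∈ I, i < 3 ∧ p (i + 1) = p i + 1) {sels : List (ℕ → Bool)} {C : List ℕ}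
    (h : IsSplittingCut I mu sels C) : Reducible M k := by
  obtain ⟨⟨j₀, hj₀, hC0⟩, ⟨j₁, hj₁, hCj₁⟩, hCmu, hCI, hlink⟩ := h
  set Q := selIdx p fun _ => true with hQdef
  have hvQ : ∀ {j}, j < 8 → vtx p j ∈ pvs Q := fun hj => (hp.vtx_mem hj).2 rfl
  set D : ℕ → Prop := fun u => ∃ j < 8, j ∈ C ∧ u = vtx p j with hD
  have hDj : ∀ {j}, j < 8 → (D (vtx p j) ↔ j ∈ C) := by
    refine fun {j} hj => ⟨?_, fun h => ⟨j, hj, h, rfl⟩⟩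
    rintro ⟨l, hl, h, e⟩
    rwa [hp.vtx_inj hj hl e]
  have hQp : ∀ u v, s(u, v) ∈ M → u ∈ pvs Q → ∃ j < 8, u = vtx p j ∧ v = vtx p (mu j) := by
    intro u v huv hu
    obtain ⟨j, hj, -, rfl⟩ := hp.exists_vtx hu
    exact ⟨j, hj, rfl, by rw [((hm _ _).1 huv).2, (hmu j hj).2]⟩
  have hseg : ∀ i ∈ I, 2 * p i = vtx p (2 * i + 1) ∧ 2 * p i + 1 = vtx p (2 * i + 2) := by
    intro i hi
    obtain ⟨h1, h2⟩ := hI i hi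
    refine ⟨(hp.vtx_odd (by omega)).symm, ?_⟩
    rw [show 2 * i + 2 = 2 * (i + 1) by ring, IsListing.vtx_even, h2]
    omega
  obtain ⟨u, hu, v, hv, hCu, hCv, htu, htv, hl⟩ := exists_linked (E := InnerIdx p I) (C := D) hfeas
    (hp.selIdx_subset fun _ => true)
    (fun u v huv hu => by
      obtain ⟨j, hj, rfl, rfl⟩ := hQp u v huv hu
      exact hvQ (hmu j hj).1)
    (by
      rintro e ⟨i, hi, rfl⟩
      obtain ⟨h1, h2⟩ := hI i hi
      have hb := hp.bounds (i := i) (by omega)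
      have hb' := hp.bounds (i := i + 1) (by omega)
      refine ⟨hb.1, by omega, ?_, ?_⟩
      · rw [(hseg i hi).1]
        exact hvQ (by omega)
      · rw [(hseg i hi).2]
        exact hvQ (by omega))
    (fun u v huv hu _ => by
      obtain ⟨j, hj, rfl, rfl⟩ := hQp u v huv hu
      rw [eq_iff_iff, hDj hj, hDj (hmu j hj).1, hCmu j hj])
    (by
      rintro e ⟨i, hi, rfl⟩
      have h1 := (hI i hi).1
      rw [(hseg i hi).2, (hseg i hi).1, eq_iff_iff, hDj (by omega), hDj (by omega), hCI i hi])
    (hvQ hj₀) (hvQ hj₁) ((hDj hj₀).2 hC0) (by simp [hDj hj₁, hCj₁])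
  obtain ⟨a, ha, -, rfl⟩ := hp.exists_vtx hu
  obtain ⟨b, hb, -, rfl⟩ := hp.exists_vtx hv
  rw [hDj ha] at hCu
  rw [hDj hb] at hCv
  have hterm : ∀ {a}, (∀ e, InnerIdx p I e → vtx p a ≠ 2 * e ∧ vtx p a ≠ 2 * e + 1) →
      IsTerminal I a := by
    intro a ht i hi
    obtain ⟨h1, h2⟩ := ht _ ⟨i, hi, rfl⟩
    rw [(hseg i hi).1] at h1
    rw [(hseg i hi).2] at h2
    exact ⟨fun e => h1 (e ▸ rfl), fun e => h2 (e ▸ rfl)⟩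
  obtain ⟨sel, -, hsel⟩ := hlink a ha b hb ⟨hCu, hterm htu, hCv, hterm htv⟩
  exact reducible_of_splits hk hM hfeas hp hm hmu hI ha hb hsel hl

end Transfer

/-! ### Two 2-swaps -/

/-- The three matchings on a 2-swap, in terms of the partner function. -/
def HasType (m : ℕ → ℕ) (a b t : ℕ) : Prop :=
  (t = 0 ∧ m (2 * a - 1) = 2 * a ∧ m (2 * a) = 2 * a - 1 ∧
    m (2 * b - 1) = 2 * b ∧ m (2 * b) = 2 * b - 1) ∨
  (t = 1 ∧ m (2 * a - 1) = 2 * b - 1 ∧ m (2 * a) = 2 * b ∧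
    m (2 * b - 1) = 2 * a - 1 ∧ m (2 * b) = 2 * a) ∨
  (t = 2 ∧ m (2 * a - 1) = 2 * b ∧ m (2 * a) = 2 * b - 1 ∧
    m (2 * b - 1) = 2 * a ∧ m (2 * b) = 2 * a - 1)

theorem exists_hasType {M : Finset (Sym2 ℕ)} {S : Finset ℕ} {m : ℕ → ℕ} {a b : ℕ} (ha : 1 ≤ a)
    (hab : a < b) (hm : ∀ u v, s(u, v) ∈ M ↔ u ∈ S ∧ v = m u)
    (hW : IsMatchingOn (subPat M {a, b}) (pvs {a, b})) : ∃ t < 3, HasType m a b t := by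
  have hmem : ∀ u, u ∈ pvs {a, b} ↔ u = 2 * a - 1 ∨ u = 2 * a ∨ u = 2 * b - 1 ∨ u = 2 * b := by
    intro u
    simp only [pvs, Finset.mem_biUnion, Finset.mem_insert, Finset.mem_singleton]
    constructor
    · rintro ⟨i, rfl | rfl, h⟩ <;> omega
    · rintro (h | h | h | h)
      · exact ⟨a, by simp, by omega⟩
      · exact ⟨a, by simp, by omega⟩
      · exact ⟨b, by simp, by omega⟩
      · exact ⟨b, by simp, by omega⟩
  have h1 := partner_mem hm hW ((hmem (2 * a - 1)).2 (by omega))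
  have h2 := partner_mem hm hW ((hmem (2 * a)).2 (by omega))
  have h3 := partner_mem hm hW ((hmem (2 * b - 1)).2 (by omega))
  have h4 := partner_mem hm hW ((hmem (2 * b)).2 (by omega))
  rw [hmem] at h1 h2 h3 h4
  obtain ⟨h1, n1, i1⟩ := h1
  obtain ⟨h2, n2, i2⟩ := h2
  obtain ⟨h3, n3, i3⟩ := h3
  obtain ⟨h4, n4, i4⟩ := h4
  rcases h1 with h1 | h1 | h1 | h1
  · omega
  · rw [h1] at i1
    refine ⟨0, by omega, Or.inl ⟨rfl, h1, i1, ?_⟩⟩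
    rcases h3 with h3 | h3 | h3 | h3 <;> rw [h3] at i3 <;> omega
  · rw [h1] at i1
    refine ⟨1, by omega, Or.inr (Or.inl ⟨rfl, h1, ?_⟩)⟩
    rcases h2 with h2 | h2 | h2 | h2 <;> rw [h2] at i2 <;> omega
  · rw [h1] at i1
    refine ⟨2, by omega, Or.inr (Or.inr ⟨rfl, h1, ?_⟩)⟩
    rcases h2 with h2 | h2 | h2 | h2 <;> rw [h2] at i2 <;> omega

/-- Listing of four numbers. -/
def listing (a b c d : ℕ) (i : ℕ) : ℕ :=
  match i with
  | 0 => a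
  | 1 => b
  | 2 => c
  | _ => d

theorem reducible_of_cfg {k : ℕ} {M : Finset (Sym2 ℕ)} {m p : ℕ → ℕ} {cfg : Bool × List ℕ}
    (hcfg : cfg ∈ [(false, [0, 1]), (false, [1, 2]), (false, [0, 2]), (true, [0, 2])])
    (hk : 5 ≤ k) (hM : IsMatchingOn M (pvs (Finset.Icc 1 k)))
    (hfeas : FeasiblePat M (Finset.Icc 1 k)) (hp : IsListing k p)
    (hm : ∀ u v, s(u, v) ∈ M ↔ u ∈ pvs (Finset.Icc 1 k) ∧ v = m u)
    (hI : ∀ i ∈ cfg.2, i < 3 ∧ p (i + 1) = p i + 1) {tx ty : ℕ} (htx : tx < 3) (hty : ty < 3)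
    (hmu : ∀ j < 8, m (vtx p j) = vtx p (modelPartner cfg.1 tx ty j)) : Reducible M k := by
  obtain ⟨s, -, hs⟩ := exists_isSplittingCut cfg hcfg tx
    (by interval_cases tx <;> simp) ty (by interval_cases ty <;> simp)
  exact reducible_of_isSplittingCut hk hM hfeas hp hm
    (fun j hj => ⟨modelPartner_lt _ tx htx ty hty j hj, hmu j hj⟩) hI hs

theorem model_alternating {k : ℕ} {m p : ℕ → ℕ} {tx ty : ℕ} (hp : IsListing k p)
    (hx : HasType m (p 0) (p 2) tx) (hy : HasType m (p 1) (p 3) ty) :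
    ∀ j < 8, m (vtx p j) = vtx p (modelPartner false tx ty j) := by
  obtain ⟨h0, h1, h2, h3, h4⟩ := hp
  have first : ∀ j ∈ [0, 1, 4, 5], m (vtx p j) = vtx p (modelPartner false tx ty j) := by
    rcases hx with ⟨rfl, x⟩ | ⟨rfl, x⟩ | ⟨rfl, x⟩ <;>
      simp [vtx, modelPartner, inFirst, mate, flipEnd] <;> grind
  have second : ∀ j ∈ [2, 3, 6, 7], m (vtx p j) = vtx p (modelPartner false tx ty j) := by
    rcases hy with ⟨rfl, y⟩ | ⟨rfl, y⟩ | ⟨rfl, y⟩ <;>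
      simp [vtx, modelPartner, inFirst, mate, flipEnd] <;> grind
  intro j hj
  interval_cases j
  · exact first _ (by simp)
  · exact first _ (by simp)
  · exact second _ (by simp)
  · exact second _ (by simp)
  · exact first _ (by simp)
  · exact first _ (by simp)
  · exact second _ (by simp)
  · exact second _ (by simp)

theorem model_nested {k : ℕ} {m p : ℕ → ℕ} {tx ty : ℕ} (hp : IsListing k p)
    (hx : HasType m (p 0) (p 3) tx) (hy : HasType m (p 1) (p 2) ty) :
    ∀ j < 8, m (vtx p j) = vtx p (modelPartner true tx ty j) := by
  obtain ⟨h0, h1, h2, h3, h4⟩ := hp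
  have first : ∀ j ∈ [0, 1, 6, 7], m (vtx p j) = vtx p (modelPartner true tx ty j) := by
    rcases hx with ⟨rfl, x⟩ | ⟨rfl, x⟩ | ⟨rfl, x⟩ <;>
      simp [vtx, modelPartner, inFirst, mate, flipEnd] <;> grind
  have second : ∀ j ∈ [2, 3, 4, 5], m (vtx p j) = vtx p (modelPartner true tx ty j) := by
    rcases hy with ⟨rfl, y⟩ | ⟨rfl, y⟩ | ⟨rfl, y⟩ <;>
      simp [vtx, modelPartner, inFirst, mate, flipEnd] <;> grind
  intro j hj
  interval_cases j
  · exact first _ (by simp)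
  · exact first _ (by simp)
  · exact second _ (by simp)
  · exact second _ (by simp)
  · exact second _ (by simp)
  · exact second _ (by simp)
  · exact first _ (by simp)
  · exact first _ (by simp)

/-- If two 2-swaps interact twice, the pattern is reducible; here the first swap contains the
smallest of the four indices. -/
theorem reducible_of_two_interactions {k : ℕ} {M : Finset (Sym2 ℕ)} {a b c d i₁ i₂ : ℕ}
    (hk : 5 ≤ k) (hM : IsMatchingOn M (pvs (Finset.Icc 1 k)))
    (hfeas : FeasiblePat M (Finset.Icc 1 k)) (ha : 1 ≤ a) (hab : a < b) (hcd : c < d) (hac : a < c)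
    (hbc : b ≠ c) (hbd : b ≠ d) (hbk : b ≤ k) (hdk : d ≤ k)
    (hMX : IsMatchingOn (subPat M {a, b}) (pvs {a, b}))
    (hMY : IsMatchingOn (subPat M {c, d}) (pvs {c, d})) (hi : i₁ < i₂)
    (h₁ : ((i₁ = a ∨ i₁ = b) ∧ (i₁ + 1 = c ∨ i₁ + 1 = d)) ∨
      ((i₁ = c ∨ i₁ = d) ∧ (i₁ + 1 = a ∨ i₁ + 1 = b)))
    (h₂ : ((i₂ = a ∨ i₂ = b) ∧ (i₂ + 1 = c ∨ i₂ + 1 = d)) ∨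
      ((i₂ = c ∨ i₂ = d) ∧ (i₂ + 1 = a ∨ i₂ + 1 = b))) : Reducible M k := by
  obtain ⟨m, hm⟩ := hM.exists_partner
  obtain ⟨tx, htx, hx⟩ := exists_hasType ha hab hm hMX
  obtain ⟨ty, hty, hy⟩ := exists_hasType (by omega) hcd hm hMY
  have cases : (c < b ∧ b < d ∧ ((c = a + 1 ∧ b = c + 1) ∨ (b = c + 1 ∧ d = b + 1) ∨
      (c = a + 1 ∧ d = b + 1))) ∨ (d < b ∧ c = a + 1 ∧ b = d + 1) := by omega
  rcases cases with ⟨hcb, hbd', h⟩ | ⟨hdb, h⟩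
  · have hp : IsListing k (listing a c b d) := ⟨ha, hac, hcb, hbd', hdk⟩
    have hmu := model_alternating hp hx hy
    rcases h with h | h | h
    · exact reducible_of_cfg (cfg := (false, [0, 1])) (by simp) hk hM hfeas hp hm
        (by simp [listing]; omega) htx hty hmu
    · exact reducible_of_cfg (cfg := (false, [1, 2])) (by simp) hk hM hfeas hp hm
        (by simp [listing]; omega) htx hty hmu
    · exact reducible_of_cfg (cfg := (false, [0, 2])) (by simp) hk hM hfeas hp hm
        (by simp [listing]; omega) htx hty hmu
  · have hp : IsListing k (listing a c d b) := ⟨ha, hac, hcd, hdb, hbk⟩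
    exact reducible_of_cfg (cfg := (true, [0, 2])) (by simp) hk hM hfeas hp hm
      (by simp [listing]; omega) htx hty (model_nested hp hx hy)

theorem exists_lt_of_card_eq_two {X : Finset ℕ} (h : X.card = 2) : ∃ a b, a < b ∧ X = {a, b} := by
  obtain ⟨a, b, hab, rfl⟩ := Finset.card_eq_two.1 h
  rcases hab.lt_or_gt with h | h
  · exact ⟨a, b, h, rfl⟩
  · exact ⟨b, a, h, Finset.pair_comm a b⟩

/-- For any `k ≥ 6`, there is no feasible and irreducible connection `k`-pattern that
contains two 2-swaps interacting at least twice: if the connection `k`-pattern `M` is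
feasible and irreducible and `M[X]`, `M[Y]` are two (disjoint) 2-swaps of `M`, then `X`
and `Y` interact at most once. -/
theorem no_two_interacting_two_swaps (k : ℕ) (hk : 6 ≤ k)
    (M : Finset (Sym2 ℕ)) (X Y : Finset ℕ)
    (hM : IsMatchingOn M (pvs (Finset.Icc 1 k)))
    (hfeas : FeasiblePat M (Finset.Icc 1 k))
    (hirr : ¬ Reducible M k)
    (hX : X ⊆ Finset.Icc 1 k) (hY : Y ⊆ Finset.Icc 1 k) (hXY : Disjoint X Y)
    (hX2 : X.card = 2) (hY2 : Y.card = 2)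
    (hMX : IsMatchingOn (subPat M X) (pvs X))
    (hMY : IsMatchingOn (subPat M Y) (pvs Y)) :
    ¬ (2 ≤ numInteractions k X Y) := by
  intro hnum
  apply hirr
  obtain ⟨a, b, hab, rfl⟩ := exists_lt_of_card_eq_two hX2
  obtain ⟨c, d, hcd, rfl⟩ := exists_lt_of_card_eq_two hY2
  obtain ⟨i₁, h₁, i₂, h₂, hi⟩ : ∃ i₁, _ ∧ ∃ i₂, _ ∧ i₁ < i₂ := by
    obtain ⟨x, hx, y, hy, hxy⟩ := Finset.one_lt_card.1 hnum
    have hx := (Finset.mem_filter.1 hx).2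
    have hy := (Finset.mem_filter.1 hy).2
    rcases hxy.lt_or_gt with h | h
    · exact ⟨x, hx, y, hy, h⟩
    · exact ⟨y, hy, x, hx, h⟩
  simp only [Finset.mem_insert, Finset.mem_singleton] at h₁ h₂
  have ha := Finset.mem_Icc.1 (hX (Finset.mem_insert_self a {b}))
  have hb := Finset.mem_Icc.1 (hX (show b ∈ ({a, b} : Finset ℕ) by simp))
  have hc := Finset.mem_Icc.1 (hY (Finset.mem_insert_self c {d}))
  have hd := Finset.mem_Icc.1 (hY (show d ∈ ({c, d} : Finset ℕ) by simp))
  have hne : a ≠ c ∧ a ≠ d ∧ b ≠ c ∧ b ≠ d := by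
    simp only [Finset.disjoint_insert_left, Finset.disjoint_singleton_left, Finset.mem_insert,
      Finset.mem_singleton, not_or] at hXY
    tauto
  obtain ⟨hac, had, hbc, hbd⟩ := hne
  rcases hac.lt_or_gt with h | h
  · exact reducible_of_two_interactions (by omega) hM hfeas ha.1 hab hcd h hbc hbd hb.2 hd.2
      hMX hMY hi h₁ h₂
  · exact reducible_of_two_interactions (by omega) hM hfeas hc.1 hcd hab h had.symm hbd.symm
      hd.2 hb.2 hMY hMX hi h₁.symm h₂.symm
end
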